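/- arXiv:1401.2249 — 4 statements merged into one kernel-verified Lean document; each statement's English description precedes it below -/
import Mathlib

section
/- Let Ω ⊆ ℂ be a nonempty bounded open set. There exist functions f_1, f_2, f_3 on Ω̄, each the restriction to Ω̄ of a C^∞ function on ℂ ≅ ℝ², and a compact set K ⊆ Ω, such that: (1) the graph 𝒢_f(Ω̄) = {(z, f_1(z), f_2(z), f_3(z)) : z ∈ Ω̄} ⊆ ℂ⁴ is polynomially convex; (2) for every closed proper subset S ⊊ Ω̄ there exists g ∈ [z,f]_{Ω̄} with sup_{S} |g| < sup_{Ω̄} |g| (i.e., the Shilov boundary of [z,f]_{Ω̄} is all of Ω̄); (3) every f ∈ C(Ω̄,ℂ) whose restriction to K lies in R(K) belongs to [z,f]_{Ω̄}; (4) [z,f]_{Ω̄} ≠ C(Ω̄,ℂ). -/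
open Metric

noncomputable def polyHull {m : ℕ} (K : Set (Fin m → ℂ)) : Set (Fin m → ℂ) :=
  {z | ∀ p : MvPolynomial (Fin m) ℂ,
    ‖MvPolynomial.eval z p‖ ≤ sSup ((fun w => ‖MvPolynomial.eval w p‖) '' K)}

noncomputable def genAlg {X : Type*} [TopologicalSpace X] (S : Set C(X, ℂ)) : Set C(X, ℂ) :=
  closure ((Algebra.adjoin ℂ S : Subalgebra ℂ C(X, ℂ)) : Set C(X, ℂ))

/-- `R(K)`: uniform closure on `K` of rational functions with poles off `K`. -/
noncomputable def ratAlg (K : Set ℂ) : Set C(K, ℂ) :=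
  closure {g : C(K, ℂ) | ∃ p q : Polynomial ℂ,
    (∀ z ∈ K, q.eval z ≠ 0) ∧ ∀ z : K, g z = p.eval (z : ℂ) / q.eval (z : ℂ)}

/-- Generators of the algebra `[z, f₁, …, f₃]_M` for `M ⊆ ℂ`. -/
def zfGens (M : Set ℂ) (f : Fin 3 → ℂ → ℂ) : Set C(M, ℂ) :=
  {g | (∀ z : M, g z = (z : ℂ)) ∨ ∃ j : Fin 3, ∀ z : M, g z = f j (z : ℂ)}

/-- The graph of `(f₁, f₂, f₃)` over `E ⊆ ℂ`, inside `ℂ⁴`. -/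
def graphF (f : Fin 3 → ℂ → ℂ) (E : Set ℂ) : Set (Fin 4 → ℂ) :=
  (fun z : ℂ => (Fin.cons z (fun j => f j z) : Fin 4 → ℂ)) '' E

open MeasureTheory in
lemma int_fderiv_zero (G : ℂ → ℂ) (hG : ContDiff ℝ 1 G) (hc : HasCompactSupport G) (v : ℂ) :
    ∫ x, fderiv ℝ G x v = 0 := by
  have h1 : Continuous fun x => fderiv ℝ G x v :=
    (hG.continuous_fderiv one_ne_zero).clm_apply continuous_const
  have h2 : HasCompactSupport fun x => fderiv ℝ G x v := hc.fderiv_apply ℝ v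
  have := integral_smul_fderiv_eq_neg_fderiv_smul_of_integrable (μ := volume) (𝕜 := ℝ)
    (f := fun _ : ℂ => (1:ℝ)) (g := G) (v := v) (by simp)
    (by simpa using h1.integrable_of_hasCompactSupport h2)
    (by simpa using hG.continuous.integrable_of_hasCompactSupport hc)
    (by fun_prop) (fun x _ => hG.differentiable (by simp) x)
  simpa using this

open MeasureTheory in
lemma green_est (φ : ℂ → ℝ) (hφ : ContDiff ℝ 1 φ) (hc : HasCompactSupport φ)
    (p q : Polynomial ℂ) (hq : ∀ z ∈ tsupport φ, q.eval z ≠ 0) (ε : ℝ)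
    (hε : ∀ z ∈ tsupport φ, ‖p.eval z / q.eval z - (starRingEnd ℂ) z‖ ≤ ε) :
    ∫ x, φ x ≤ ε * ∫ x, ‖fderiv ℝ φ x‖ := by
  set f : ℂ → ℂ := fun z => p.eval z / q.eval z with hf
  set F : ℂ → ℂ := fun z => f z - (starRingEnd ℂ) z with hF
  have hfd : ∀ z ∈ tsupport φ, ContDiffAt ℝ 1 f z := by
    intro z hz
    have : ContDiffAt ℂ 1 f z := by
      have h1 : ContDiff ℂ 1 (fun z => p.eval z) := by simpa using p.contDiff_aeval (𝕜 := ℂ) 1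
      have h2 : ContDiff ℂ 1 (fun z => q.eval z) := by simpa using q.contDiff_aeval (𝕜 := ℂ) 1
      exact h1.contDiffAt.div h2.contDiffAt (hq z hz)
    exact this.restrict_scalars ℝ
  have hfc : ∀ z ∈ tsupport φ, DifferentiableAt ℂ f z := by
    intro z hz
    exact (p.differentiable z).div (q.differentiable z) (hq z hz)
  have hconj : ∀ z, HasFDerivAt (fun z => (starRingEnd ℂ) z) (Complex.conjCLE : ℂ →L[ℝ] ℂ) z :=
    fun z => (Complex.conjCLE : ℂ →L[ℝ] ℂ).hasFDerivAt
  have hFd : ∀ z ∈ tsupport φ, ContDiffAt ℝ 1 F z := by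
    intro z hz
    exact (hfd z hz).sub Complex.conjCLE.contDiff.contDiffAt
  set G : ℂ → ℂ := fun z => φ z • F z with hGdef
  have hsupp : tsupport G ⊆ tsupport φ := tsupport_smul_subset_left φ F
  have hG : ContDiff ℝ 1 G := by
    rw [contDiff_iff_contDiffAt]
    intro x
    by_cases hx : x ∈ tsupport G
    · exact hφ.contDiffAt.smul (hFd x (hsupp hx))
    · exact (contDiffAt_const (c := (0:ℂ))).congr_of_eventuallyEq
        (notMem_tsupport_iff_eventuallyEq.1 hx)
  have hGc : HasCompactSupport G := hc.smul_right
  have key : ∀ x, fderiv ℝ G x 1 + Complex.I * fderiv ℝ G x Complex.I =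
      -2 * (φ x : ℂ) + F x * ((fderiv ℝ φ x 1 : ℝ) + Complex.I * (fderiv ℝ φ x Complex.I : ℝ)) := by
    intro x
    by_cases hx : x ∈ tsupport φ
    · have e1 : HasFDerivAt G (φ x • ((fderiv ℝ f x) - (Complex.conjCLE : ℂ →L[ℝ] ℂ)) +
          (fderiv ℝ φ x).smulRight (F x)) x :=
        ((hφ.differentiable (by simp) x).hasFDerivAt).smul
          ((((hfd x hx).differentiableAt (by simp)).hasFDerivAt).sub (hconj x))
      have e2 : fderiv ℝ f x = (fderiv ℂ f x).restrictScalars ℝ :=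
        ((hfc x hx).hasFDerivAt.restrictScalars ℝ).fderiv
      have e3 : fderiv ℂ f x Complex.I = Complex.I * fderiv ℂ f x 1 := by
        have := (fderiv ℂ f x).map_smul Complex.I 1
        rwa [smul_eq_mul, mul_one] at this
      rw [e1.fderiv, e2]
      simp [e3, -fderiv_eq_smul_deriv]
      linear_combination ((φ x : ℂ) * (fderiv ℂ f x 1 + 1)) * Complex.I_sq
    · have e1 : fderiv ℝ G x = 0 := by
        have : x ∉ tsupport G := fun h => hx (hsupp h)
        exact fderiv_of_notMem_tsupport ℝ this
      have e2 : fderiv ℝ φ x = 0 := fderiv_of_notMem_tsupport ℝ hx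
      have e3 : φ x = 0 := image_eq_zero_of_notMem_tsupport hx
      rw [e1, e2, e3]; simp
  have hi : ∀ v, Integrable (fun x => fderiv ℝ G x v) := fun v =>
    ((hG.continuous_fderiv one_ne_zero).clm_apply continuous_const).integrable_of_hasCompactSupport
      (hGc.fderiv_apply ℝ v)
  have hz : ∫ x, (fderiv ℝ G x 1 + Complex.I * fderiv ℝ G x Complex.I) = 0 := by
    rw [integral_add (hi 1) ((hi _).const_mul _), integral_const_mul,
      int_fderiv_zero G hG hGc, int_fderiv_zero G hG hGc]; simp
  have hφi : Integrable φ := hφ.continuous.integrable_of_hasCompactSupport hc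
  have hni : Integrable (fun x => ‖fderiv ℝ φ x‖) :=
    ((hφ.continuous_fderiv one_ne_zero).integrable_of_hasCompactSupport (hc.fderiv ℝ)).norm
  have hsum : ∫ x, (2 * (φ x : ℂ)) =
      ∫ x, F x * ((fderiv ℝ φ x 1 : ℝ) + Complex.I * (fderiv ℝ φ x Complex.I : ℝ)) := by
    have a1 : Integrable (fun x => (2 * (φ x : ℂ))) := (hφi.ofReal).const_mul 2
    have : ∀ x, F x * ((fderiv ℝ φ x 1 : ℝ) + Complex.I * (fderiv ℝ φ x Complex.I : ℝ)) =
      (fderiv ℝ G x 1 + Complex.I * fderiv ℝ G x Complex.I) + 2 * (φ x : ℂ) := by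
      intro x; rw [key x]; ring
    simp_rw [this]
    have a2 : Integrable (fun x => fderiv ℝ G x 1 + Complex.I * fderiv ℝ G x Complex.I) :=
      (hi 1).add ((hi _).const_mul _)
    rw [integral_add a2 a1, hz, zero_add]
  have hb : ‖∫ x, F x * ((fderiv ℝ φ x 1 : ℝ) + Complex.I * (fderiv ℝ φ x Complex.I : ℝ))‖
      ≤ ∫ x, (2 * ε) * ‖fderiv ℝ φ x‖ := by
    apply norm_integral_le_of_norm_le (hni.const_mul _)
    refine Filter.Eventually.of_forall fun x => ?_
    by_cases hx : x ∈ tsupport φ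
    · have b1 := (fderiv ℝ φ x).le_opNorm 1
      have b2 := (fderiv ℝ φ x).le_opNorm Complex.I
      simp at b1 b2
      have b3 : ‖((fderiv ℝ φ x 1 : ℝ) : ℂ) + Complex.I * (fderiv ℝ φ x Complex.I : ℝ)‖ ≤
          2 * ‖fderiv ℝ φ x‖ := by
        refine (norm_add_le _ _).trans ?_
        simp
        linarith
      rw [norm_mul]
      have b4 : ‖F x‖ ≤ ε := hε x hx
      calc _ ≤ ε * (2 * ‖fderiv ℝ φ x‖) := by gcongr; exact (norm_nonneg _).trans b4
        _ = _ := by ring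
    · have e2 : fderiv ℝ φ x = 0 := fderiv_of_notMem_tsupport ℝ hx
      rw [e2]; simp
  rw [← hsum, integral_const_mul, integral_const_mul, integral_complex_ofReal] at hb
  rw [norm_mul, Complex.norm_real] at hb
  simp at hb
  have := le_abs_self (∫ x, φ x)
  linarith

open MeasureTheory in
lemma cheese (c0 : ℂ) (R : ℝ) (hR : 0 < R) : ∃ K : Set ℂ, K ⊆ closedBall c0 R ∧ IsCompact K ∧
    interior K = ∅ ∧ ∀ G : C(K, ℂ), (∀ z, G z = (starRingEnd ℂ) (z:ℂ)) → G ∉ ratAlg K := by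
  let ψ : ContDiffBump c0 := ⟨R/2, R, by linarith, by linarith⟩
  let χ : ContDiffBump (0:ℂ) := ⟨1, 2, by norm_num, by norm_num⟩
  have hψc : HasCompactSupport ψ := ψ.hasCompactSupport
  have hχc : HasCompactSupport χ := χ.hasCompactSupport
  have hψs : ContDiff ℝ 1 ψ := ψ.contDiff
  have hχs : ContDiff ℝ 1 χ := χ.contDiff
  set s := ∫ x, ψ x with hs
  have hspos : 0 < s := ψ.integral_pos
  set X := ∫ x, χ x with hX
  have hXpos : 0 < X := χ.integral_pos
  set M := ∫ x, ‖fderiv ℝ χ x‖ with hM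
  have hM0 : 0 ≤ M := integral_nonneg fun _ => norm_nonneg _
  set N0 := ∫ x, ‖fderiv ℝ ψ x‖ with hN0
  have hN00 : 0 ≤ N0 := integral_nonneg fun _ => norm_nonneg _
  set δ := min 1 (s / (4 * X)) with hδ
  have hδ0 : 0 < δ := by positivity
  have hδ1 : δ ≤ 1 := min_le_left _ _
  have hδ2 : δ * (4 * X) ≤ s := by
    rw [← le_div_iff₀ (by positivity)]; exact min_le_right _ _
  set r : ℕ → ℝ := fun j => δ * (1/2)^j with hr
  have hr0 : ∀ j, 0 < r j := fun j => by positivity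
  have hr1 : ∀ j, r j ≤ 1 := fun j => by
    have : ((1:ℝ)/2)^j ≤ 1 := pow_le_one₀ (by norm_num) (by norm_num)
    have h2 : (0:ℝ) ≤ (1/2)^j := by positivity
    simp only [hr]; nlinarith
  let a : ℕ → ℂ := TopologicalSpace.denseSeq ℂ
  let χj : ℕ → ℂ → ℝ := fun j z => χ ((r j)⁻¹ • (z - a j))
  have hχjs : ∀ j, ContDiff ℝ 1 (χj j) := fun j =>
    hχs.comp ((contDiff_id.sub contDiff_const).const_smul _)
  have hχj0 : ∀ j z, 0 ≤ χj j z := fun j z => χ.nonneg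
  have hχj1 : ∀ j z, χj j z ≤ 1 := fun j z => χ.le_one
  have hχjc : ∀ j, HasCompactSupport (χj j) := by
    intro j
    apply HasCompactSupport.of_support_subset_isCompact (isCompact_closedBall (a j) (2 * r j))
    intro z hz
    by_contra hzz
    apply hz
    apply χ.zero_of_le_dist
    simp only [mem_closedBall, not_le] at hzz
    rw [dist_zero_right, norm_smul, ← dist_eq_norm, norm_inv, Real.norm_of_nonneg (hr0 j).le]
    rw [inv_mul_eq_div, le_div_iff₀ (hr0 j)]
    exact hzz.le
  have hχjone : ∀ j, ∀ z ∈ ball (a j) (r j), χj j z = 1 := by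
    intro j z hz
    apply χ.one_of_mem_closedBall
    rw [mem_closedBall, dist_zero_right, norm_smul, ← dist_eq_norm, norm_inv,
      Real.norm_of_nonneg (hr0 j).le, inv_mul_eq_div, div_le_iff₀ (hr0 j)]
    have : χ.rIn = 1 := rfl
    rw [this, one_mul]; exact (mem_ball.1 hz).le
  have hint : ∀ j, ∫ z, χj j z = (r j)^2 * X := by
    intro j
    have h1 : ∫ z, χj j z = ∫ z, χ ((r j)⁻¹ • z) :=
      integral_sub_right_eq_self (fun z => χ ((r j)⁻¹ • z)) (a j)
    rw [h1, Measure.integral_comp_smul, ← hX]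
    simp [abs_of_pos (hr0 j)]
  have hint' : ∀ j, ∫ z, ‖fderiv ℝ (χj j) z‖ = (r j) * M := by
    intro j
    have h0 : ∀ z, ‖fderiv ℝ (χj j) z‖ = (r j)⁻¹ * ‖fderiv ℝ χ ((r j)⁻¹ • (z - a j))‖ := by
      intro z
      have : HasFDerivAt (χj j) ((fderiv ℝ χ ((r j)⁻¹ • (z - a j))).comp
          ((r j)⁻¹ • ContinuousLinearMap.id ℝ ℂ)) z := by
        have := (hχs.differentiable (by simp) ((r j)⁻¹ • (z - a j))).hasFDerivAt
        have h2 : HasFDerivAt (fun z => (r j)⁻¹ • (z - a j))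
            ((r j)⁻¹ • ContinuousLinearMap.id ℝ ℂ) z :=
          ((hasFDerivAt_id z).sub_const (a j)).const_smul (r j)⁻¹
        exact HasFDerivAt.comp (g := χ) (f := fun z => (r j)⁻¹ • (z - a j)) z this h2
      rw [this.fderiv, ContinuousLinearMap.comp_smul, norm_smul, ContinuousLinearMap.comp_id,
        Real.norm_of_nonneg (inv_nonneg.2 (hr0 j).le)]
    simp_rw [h0]
    rw [integral_const_mul,
      integral_sub_right_eq_self (fun z => ‖fderiv ℝ χ ((r j)⁻¹ • z)‖) (a j),
      Measure.integral_comp_smul volume (fun z => ‖fderiv ℝ χ z‖)]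
    simp [abs_of_pos (hr0 j)]
    rw [← hM]
    have := (hr0 j).ne'
    field_simp
  let φ : ℕ → ℂ → ℝ := fun m => Nat.rec (fun z => ψ z) (fun j f z => f z * (1 - χj j z)) m
  have φ0 : φ 0 = ψ := rfl
  have φs : ∀ m, φ (m+1) = fun z => φ m z * (1 - χj m z) := fun m => rfl
  let Km : ℕ → Set ℂ := fun m => closedBall c0 R \ ⋃ j < m, ball (a j) (r j)
  have hKmc : ∀ m, IsCompact (Km m) := fun m =>
    (isCompact_closedBall c0 R).diff (isOpen_biUnion fun _ _ => isOpen_ball)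
  have hφ : ∀ m, ContDiff ℝ 1 (φ m) ∧ HasCompactSupport (φ m) ∧ (∀ z, 0 ≤ φ m z ∧ φ m z ≤ 1) ∧
      Function.support (φ m) ⊆ Km m ∧ s - 2 * δ * X * (1 - (1/2)^m) ≤ ∫ z, φ m z ∧
      ∫ z, ‖fderiv ℝ (φ m) z‖ ≤ N0 + 2 * δ * M * (1 - (1/2)^m) := by
    intro m
    induction m with
    | zero =>
      refine ⟨hψs, hψc, fun z => ⟨ψ.nonneg, ψ.le_one⟩, ?_, by simp [φ0, hs], by simp [φ0, hN0]⟩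
      rw [φ0, ψ.support_eq]
      simp [Km]
      exact ball_subset_closedBall
    | succ m ih =>
      obtain ⟨i1, i2, i3, i4, i5, i6⟩ := ih
      have j1 : ContDiff ℝ 1 (φ (m+1)) := i1.mul (contDiff_const.sub (hχjs m))
      have j2 : HasCompactSupport (φ (m+1)) := i2.mul_right
      have k1 : Integrable (φ m) := i1.continuous.integrable_of_hasCompactSupport i2
      have k2 : Integrable (φ (m+1)) := j1.continuous.integrable_of_hasCompactSupport j2
      have k3 : Integrable (χj m) := (hχjs m).continuous.integrable_of_hasCompactSupport (hχjc m)
      have l1 : Integrable (fun z => ‖fderiv ℝ (φ m) z‖) :=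
        ((i1.continuous_fderiv one_ne_zero).integrable_of_hasCompactSupport (i2.fderiv ℝ)).norm
      have l2 : Integrable (fun z => ‖fderiv ℝ (φ (m+1)) z‖) :=
        ((j1.continuous_fderiv one_ne_zero).integrable_of_hasCompactSupport (j2.fderiv ℝ)).norm
      have l3 : Integrable (fun z => ‖fderiv ℝ (χj m) z‖) :=
        (((hχjs m).continuous_fderiv one_ne_zero).integrable_of_hasCompactSupport
          ((hχjc m).fderiv ℝ)).norm
      have hp : (0:ℝ) < (1/2)^m := by positivity
      refine ⟨j1, j2, fun z => ?_, ?_, ?_, ?_⟩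
      · rw [φs]
        have := hχj0 m z
        have := hχj1 m z
        obtain ⟨u, v⟩ := i3 z
        constructor
        · exact mul_nonneg u (by linarith)
        · exact mul_le_one₀ v (by linarith) (by linarith)
      · intro z hz
        rw [Function.mem_support, φs] at hz
        have z1 : φ m z ≠ 0 := left_ne_zero_of_mul hz
        have z2 : 1 - χj m z ≠ 0 := right_ne_zero_of_mul hz
        have z3 := i4 z1
        refine ⟨z3.1, ?_⟩
        intro hzz
        simp only [Set.mem_iUnion] at hzz
        obtain ⟨j, hj, hjz⟩ := hzz
        rcases Nat.lt_succ_iff_lt_or_eq.1 hj with h | h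
        · exact z3.2 (by simp only [Set.mem_iUnion]; exact ⟨j, h, hjz⟩)
        · subst h
          exact z2 (by rw [hχjone j z hjz]; simp)
      · have : ∫ z, (φ m z - χj m z) ≤ ∫ z, φ (m+1) z := by
          apply integral_mono (k1.sub k3) k2
          intro z
          show φ m z - χj m z ≤ φ m z * (1 - χj m z)
          have := hχj0 m z
          have := i3 z
          nlinarith
        rw [integral_sub k1 k3, hint] at this
        have h3 : r m ^ 2 ≤ δ * (1/2)^m := by
          have := hr1 m
          have := hr0 m
          have e : r m = δ * (1/2)^m := rfl
          rw [← e]; nlinarith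
        have h4 : r m ^ 2 * X ≤ δ * (1/2)^m * X := by gcongr
        rw [pow_succ]
        nlinarith
      · have : ∫ z, ‖fderiv ℝ (φ (m+1)) z‖ ≤ ∫ z, (‖fderiv ℝ (φ m) z‖ + ‖fderiv ℝ (χj m) z‖) := by
          apply integral_mono l2 (l1.add l3)
          intro z
          have d1 := (i1.differentiable (by simp) z).hasFDerivAt
          have d2 := ((hχjs m).differentiable (by simp) z).hasFDerivAt
          have d3 := (d1.mul (d2.const_sub 1)).fderiv
          have d4 : fderiv ℝ (φ (m+1)) z = φ m z • -fderiv ℝ (χj m) z +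
            (1 - χj m z) • fderiv ℝ (φ m) z := d3
          show ‖fderiv ℝ (φ (m+1)) z‖ ≤ ‖fderiv ℝ (φ m) z‖ + ‖fderiv ℝ (χj m) z‖
          rw [d4]
          refine (norm_add_le _ _).trans ?_
          rw [norm_smul, norm_smul, norm_neg]
          have := hχj0 m z
          have := hχj1 m z
          obtain ⟨u, v⟩ := i3 z
          rw [Real.norm_of_nonneg u, Real.norm_of_nonneg (by linarith : 0 ≤ 1 - χj m z)]
          have := norm_nonneg (fderiv ℝ (χj m) z)
          have := norm_nonneg (fderiv ℝ (φ m) z)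
          nlinarith
        rw [integral_add l1 l3, hint'] at this
        have e : r m = δ * (1/2)^m := rfl
        rw [pow_succ]
        rw [e] at this
        nlinarith
  let K : Set ℂ := ⋂ m, Km m
  have hK0 : K ⊆ closedBall c0 R := fun z hz => (Set.mem_iInter.1 hz 0).1
  have hKc : IsCompact K := (isCompact_closedBall c0 R).of_isClosed_subset
    (isClosed_iInter fun m => (hKmc m).isClosed) hK0
  refine ⟨K, hK0, hKc, ?_, ?_⟩
  · by_contra hne
    obtain ⟨z, hz⟩ := Set.nonempty_iff_ne_empty.2 hne
    obtain ⟨y, hy, n, rfl⟩ := (TopologicalSpace.denseRange_denseSeq ℂ).inter_open_nonempty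
      _ isOpen_interior ⟨z, hz⟩
    have := Set.mem_iInter.1 (interior_subset hy) (n+1)
    apply this.2
    simp only [Set.mem_iUnion]
    exact ⟨n, by omega, mem_ball_self (hr0 n)⟩
  · intro G hG hmem
    set N := N0 + 2 * δ * M with hN
    have hNn : 0 ≤ N := by positivity
    set ε := s / (8 * (N + 1)) with hε
    have hε0 : 0 < ε := by positivity
    have : CompactSpace K := isCompact_iff_compactSpace.1 hKc
    obtain ⟨g, ⟨p, q, hq, hg⟩, hd⟩ := Metric.mem_closure_iff.1 hmem ε hε0
    have hclose : ∀ z ∈ K, ‖p.eval z / q.eval z - (starRingEnd ℂ) z‖ < ε := by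
      intro z hz
      have := (ContinuousMap.dist_lt_iff hε0).1 hd ⟨z, hz⟩
      rw [hG, hg, dist_comm, dist_eq_norm] at this
      exact this
    have hnb : ∃ m, Km m ⊆ {z | q.eval z ≠ 0 ∧ ‖p.eval z / q.eval z - (starRingEnd ℂ) z‖ < ε} := by
      apply exists_subset_nhds_of_isCompact' (V := Km)
      · apply directed_of_isDirected_le
        intro i j hij z hz
        refine ⟨hz.1, fun h => hz.2 ?_⟩
        simp only [Set.mem_iUnion] at h ⊢
        obtain ⟨k, hk, h⟩ := h
        exact ⟨k, by omega, h⟩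
      · exact hKmc
      · exact fun m => (hKmc m).isClosed
      · intro x hx
        have c1 : ContinuousAt (fun z => q.eval z) x := q.continuous.continuousAt
        have c2 : ContinuousAt (fun z => ‖p.eval z / q.eval z - (starRingEnd ℂ) z‖) x :=
          ((p.continuous.continuousAt.div c1 (hq x hx)).sub
            Complex.continuous_conj.continuousAt).norm
        exact (c1.eventually_ne (hq x hx)).and (c2.eventually_lt_const (hclose x hx))
    obtain ⟨m, hm⟩ := hnb
    obtain ⟨i1, i2, i3, i4, i5, i6⟩ := hφ m
    have hts : tsupport (φ m) ⊆ Km m := closure_minimal i4 (hKmc m).isClosed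
    have := green_est (φ m) i1 i2 p q (fun z hz => (hm (hts hz)).1) ε
      (fun z hz => (hm (hts hz)).2.le)
    have hp : (0:ℝ) < (1/2)^m := by positivity
    have q1 : ∫ z, ‖fderiv ℝ (φ m) z‖ ≤ N := i6.trans (by
      have : 0 ≤ δ * M * (1/2)^m := by positivity
      nlinarith)
    have q2 : s / 2 ≤ ∫ z, φ m z := le_trans (by
      have : 0 ≤ δ * X * (1/2)^m := by positivity
      nlinarith) i5
    have q3 : ε * ∫ z, ‖fderiv ℝ (φ m) z‖ ≤ ε * N := by gcongr
    have q4 : ε * (8 * (N+1)) = s := by rw [hε]; field_simp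
    nlinarith
lemma coef_seq (D : ℕ → ℝ) (hD : ∀ n, 1 ≤ D n) : ∃ c : ℕ → ℝ, (∀ n, 0 < c n) ∧
    (∀ n, c n * D n ≤ (1/4)^n) ∧ ∀ n j, c (j + n + 1) * D (j + n + 1) ≤ c n * (1/4)^(j+1) := by
  let c : ℕ → ℝ := fun n => Nat.rec (D 0)⁻¹ (fun k x => x / (4 * D (k+1))) n
  have c0 : c 0 = (D 0)⁻¹ := rfl
  have cs : ∀ k, c (k+1) = c k / (4 * D (k+1)) := fun k => rfl
  have hD0 : ∀ n, 0 < D n := fun n => lt_of_lt_of_le one_pos (hD n)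
  have cp : ∀ n, 0 < c n := by
    intro n
    induction n with
    | zero => rw [c0]; exact inv_pos.2 (hD0 0)
    | succ k ih => rw [cs]; exact div_pos ih (by have := hD0 (k+1); positivity)
  have cD : ∀ k, c (k+1) * D (k+1) = c k * (1/4) := by
    intro k; rw [cs]; have := (hD0 (k+1)).ne'; field_simp
  have cle : ∀ k, c (k+1) ≤ c k * (1/4) := by
    intro k; rw [← cD]; exact le_mul_of_one_le_right (cp (k+1)).le (hD (k+1))
  have h3 : ∀ n j, c (j + n + 1) * D (j + n + 1) ≤ c n * (1/4)^(j+1) := by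
    intro n j
    have : c (j + n) ≤ c n * (1/4)^j := by
      induction j with
      | zero => simp
      | succ j ih =>
        have := cle (j+n)
        rw [show j + 1 + n = j + n + 1 by ring, pow_succ]
        linarith
    rw [cD, pow_succ]; linarith
  refine ⟨c, cp, ?_, h3⟩
  intro n
  cases n with
  | zero => rw [c0]; simp [(hD0 0).ne']
  | succ k =>
    have := h3 0 k
    have c01 : c 0 ≤ 1 := by rw [c0]; exact inv_le_one_of_one_le₀ (hD 0)
    simp only [add_zero] at this
    refine this.trans ?_
    have : (0:ℝ) ≤ (1/4)^(k+1) := by positivity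
    nlinarith

open scoped ContDiff in
lemma pole_fun (K : Set ℂ) (hK : IsCompact K) (a : ℂ) (ha : a ∉ K) :
    ∃ h : ℂ → ℂ, ContDiff ℝ ∞ h ∧ HasCompactSupport h ∧ ∀ z ∈ K, h z = (z - a)⁻¹ := by
  obtain ⟨d, hd, hdK⟩ := Metric.isOpen_iff.1 hK.isClosed.isOpen_compl a ha
  obtain ⟨R, hR, hRK⟩ := hK.isBounded.subset_closedBall_lt 0 0
  let β : ContDiffBump a := ⟨d/2, d, by linarith, by linarith⟩
  let γ : ContDiffBump (0:ℂ) := ⟨R, R+1, hR, by linarith⟩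
  have hβ : ContDiff ℝ ∞ β := β.contDiff
  have hγ : ContDiff ℝ ∞ γ := γ.contDiff
  refine ⟨fun z => γ z • ((1 - β z) • (z - a)⁻¹), ?_, ?_, ?_⟩
  · apply hγ.smul
    rw [contDiff_iff_contDiffAt]
    intro x
    by_cases hx : x = a
    · subst hx
      apply (contDiffAt_const (c := (0:ℂ))).congr_of_eventuallyEq
      filter_upwards [β.eventuallyEq_one] with z hz
      simp [hz]
    · apply (contDiff_const.sub hβ).contDiffAt.smul
      exact (contDiffAt_id.sub contDiffAt_const).inv (sub_ne_zero.2 hx)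
  · exact γ.hasCompactSupport.smul_right
  · intro z hz
    have h1 : γ z = 1 := γ.one_of_mem_closedBall (hRK hz)
    have h2 : β z = 0 := by
      apply β.zero_of_le_dist
      by_contra h
      exact hdK (mem_ball.2 (not_le.1 h)) hz
    simp [h1, h2]

open scoped ContDiff in
lemma deriv_bd (h : ℂ → ℂ) (hs : ContDiff ℝ ∞ h) (hc : HasCompactSupport h) (n : ℕ) :
    ∃ C : ℝ, 1 ≤ C ∧ ∀ i ≤ n, ∀ x, ‖iteratedFDeriv ℝ i h x‖ ≤ C := by
  have : ∀ i, ∃ R, ∀ x, ‖iteratedFDeriv ℝ i h x‖ ≤ R := by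
    intro i
    have : BddAbove (Set.range fun x => ‖iteratedFDeriv ℝ i h x‖) := by
      apply (hs.continuous_iteratedFDeriv
        (mod_cast le_top)).norm.bddAbove_range_of_hasCompactSupport
      apply HasCompactSupport.comp_left _ norm_zero
      apply hc.iteratedFDeriv
    rcases this with ⟨R, hR⟩
    exact ⟨R, fun x => hR (Set.mem_range_self _)⟩
  choose R hR using this
  refine ⟨1 + ∑ i ∈ Finset.range (n+1), |R i|, ?_, ?_⟩
  · have : 0 ≤ ∑ i ∈ Finset.range (n+1), |R i| := Finset.sum_nonneg fun _ _ => abs_nonneg _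
    linarith
  · intro i hi x
    have := Finset.single_le_sum (f := fun i => |R i|) (fun _ _ => abs_nonneg _)
      (Finset.mem_range.2 (Nat.lt_succ_of_le hi))
    have h2 := hR i x
    have h3 := le_abs_self (R i)
    linarith

lemma unit_mem {X : Type*} [TopologicalSpace X] [CompactSpace X] (B : Subalgebra ℂ C(X, ℂ))
    (hB : IsClosed (B : Set C(X, ℂ))) (u : C(X, ℂ)) (hu : u ∈ B) (h : ‖u - 1‖ < 1) :
    ∃ v ∈ B, u * v = 1 := by
  have : CompleteSpace B := hB.completeSpace_coe
  let e : B := 1 - ⟨u, hu⟩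
  have he : ‖e‖ < 1 := by
    have : ‖e‖ = ‖1 - u‖ := rfl
    rw [this, norm_sub_rev]; exact h
  obtain ⟨w, hw⟩ := isUnit_one_sub_of_norm_lt_one he
  refine ⟨(↑w⁻¹ : B), SetLike.coe_mem _, ?_⟩
  have h1 : (w : B) * (↑w⁻¹ : B) = 1 := w.mul_inv
  rw [hw] at h1
  have h2 : (1 - e) = ⟨u, hu⟩ := by simp [e]
  rw [h2] at h1
  exact congrArg Subtype.val h1

lemma rat_sub (K : Set ℂ) [CompactSpace K] (B : Subalgebra ℂ C(K, ℂ))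
    (hB : IsClosed (B : Set C(K, ℂ))) (Z : C(K, ℂ)) (hZv : ∀ z, Z z = (z : ℂ)) (hZ : Z ∈ B)
    (hinv : ∀ a ∉ K, ∃ v ∈ B, (Z - algebraMap ℂ _ a) * v = 1) : ratAlg K ⊆ B := by
  apply closure_minimal _ hB
  rintro g ⟨p, q, hq, hg⟩
  let Zb : B := ⟨Z, hZ⟩
  have hval : ∀ (p : Polynomial ℂ) (z : K), (Polynomial.aeval Zb p : B).1 z = p.eval (z:ℂ) := by
    intro p z
    have h1 : (Polynomial.aeval Zb p : B).1 = Polynomial.aeval Z p := by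
      have := Polynomial.aeval_algHom_apply B.val Zb p
      exact this.symm
    rw [h1]
    induction p using Polynomial.induction_on' with
    | add p q hp hq => simp_all
    | monomial n c => simp [Polynomial.aeval_monomial, hZv]
  have hsp : spectrum ℂ Zb ⊆ K := by
    intro a ha
    by_contra hn
    obtain ⟨v, hv, hv1⟩ := hinv a hn
    rw [spectrum.mem_iff] at ha
    apply ha
    have h2 : (Zb - algebraMap ℂ B a) * ⟨v, hv⟩ = 1 := Subtype.ext hv1
    rw [← neg_sub]
    exact (IsUnit.of_mul_eq_one _ h2).neg
  have hu : IsUnit (Polynomial.aeval Zb q) := by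
    rcases lt_or_ge 0 q.degree with hdeg | hdeg
    · have := spectrum.map_polynomial_aeval_of_degree_pos Zb q hdeg
      rw [← spectrum.zero_notMem_iff ℂ, this]
      rintro ⟨a, ha, h0⟩
      exact hq a (hsp ha) h0
    · rw [Polynomial.eq_C_of_degree_le_zero hdeg, Polynomial.aeval_C]
      by_cases h0 : q.coeff 0 = 0
      · have hK : IsEmpty K := by
          constructor
          intro z
          apply hq z z.2
          rw [Polynomial.eq_C_of_degree_le_zero hdeg, h0]; simp
        have : Subsingleton B := ⟨fun x y => Subtype.ext (by ext z; exact (hK.false z).elim)⟩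
        exact isUnit_of_subsingleton _
      · exact (IsUnit.mk0 _ h0).map (algebraMap ℂ B)
  obtain ⟨w, hw⟩ := hu
  have h1 : (w : B) * (↑w⁻¹ : B) = 1 := w.mul_inv
  have : g = (Polynomial.aeval Zb p * (↑w⁻¹ : B) : B).1 := by
    ext z
    have h2 := congrArg (fun x : B => x.1 z) h1
    rw [hw] at h2
    have h3 : q.eval (z:ℂ) * (↑w⁻¹ : B).1 z = 1 := by rw [← hval]; exact h2
    have h4 : (Polynomial.aeval Zb p * (↑w⁻¹ : B) : B).1 z = p.eval (z:ℂ) * (↑w⁻¹ : B).1 z := by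
      rw [← hval]; rfl
    rw [h4, hg, eq_inv_of_mul_eq_one_right h3, div_eq_mul_inv]
  rw [this]
  exact SetLike.coe_mem _

def ratSub (K : Set ℂ) : Subalgebra ℂ C(K, ℂ) where
  carrier := {g : C(K, ℂ) | ∃ p q : Polynomial ℂ,
    (∀ z ∈ K, q.eval z ≠ 0) ∧ ∀ z : K, g z = p.eval (z : ℂ) / q.eval (z : ℂ)}
  mul_mem' := by
    rintro g h ⟨p, q, hq, hg⟩ ⟨p', q', hq', hh⟩
    refine ⟨p * p', q * q', fun z hz => ?_, fun z => ?_⟩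
    · rw [Polynomial.eval_mul]; exact mul_ne_zero (hq z hz) (hq' z hz)
    · simp only [ContinuousMap.mul_apply, hg, hh, Polynomial.eval_mul]
      rw [div_mul_div_comm]
  add_mem' := by
    rintro g h ⟨p, q, hq, hg⟩ ⟨p', q', hq', hh⟩
    refine ⟨p * q' + q * p', q * q', fun z hz => ?_, fun z => ?_⟩
    · rw [Polynomial.eval_mul]; exact mul_ne_zero (hq z hz) (hq' z hz)
    · simp only [ContinuousMap.add_apply, hg, hh, Polynomial.eval_mul, Polynomial.eval_add]
      rw [div_add_div _ _ (hq z z.2) (hq' z z.2)]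
  algebraMap_mem' := by
    intro r
    exact ⟨Polynomial.C r, 1, by simp, by simp⟩

lemma ratSub_closure (K : Set ℂ) [CompactSpace K] :
    ((ratSub K).topologicalClosure : Set C(K, ℂ)) = ratAlg K := rfl

set_option maxHeartbeats 1000000 in
open scoped ContDiff in
lemma gen (K : Set ℂ) (hK : IsCompact K) : ∃ g : ℂ → ℂ, ∃ hg : ContDiff ℝ ∞ g,
    (⟨fun z => g z, hg.continuous.comp continuous_subtype_val⟩ : C(K, ℂ)) ∈ ratAlg K ∧
    ratAlg K ⊆ genAlg {⟨fun z => (z:ℂ), continuous_subtype_val⟩,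
      (⟨fun z => g z, hg.continuous.comp continuous_subtype_val⟩ : C(K, ℂ))} := by
  have : CompactSpace K := isCompact_iff_compactSpace.1 hK
  have hne : Nonempty (Kᶜ : Set ℂ) := by
    rw [Set.nonempty_coe_sort, Set.nonempty_compl]
    rintro rfl
    exact noncompact_univ ℂ hK
  let a : ℕ → (Kᶜ : Set ℂ) := TopologicalSpace.denseSeq _
  choose h hs hc hv using fun n => pole_fun K hK (a n) (a n).2
  choose C hC1 hC using fun n => deriv_bd (h n) (hs n) (hc n) n
  let Z : C(K, ℂ) := ⟨fun z => (z:ℂ), continuous_subtype_val⟩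
  let W : ℕ → ℝ := fun n => ‖Z - algebraMap ℂ _ (a n : ℂ)‖
  let V : ℕ → ℝ := fun n => 1 + ∑ i ∈ Finset.range (n+1), W i
  have hW0 : ∀ n, 0 ≤ W n := fun n => norm_nonneg _
  have hV1 : ∀ n, 1 ≤ V n := fun n => by
    have : 0 ≤ ∑ i ∈ Finset.range (n+1), W i := Finset.sum_nonneg fun _ _ => hW0 _
    simp only [V]; linarith
  have hWV : ∀ i n, i ≤ n → W i ≤ V n := fun i n hi => by
    have := Finset.single_le_sum (f := W) (fun _ _ => hW0 _)
      (Finset.mem_range.2 (Nat.lt_succ_of_le hi))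
    simp only [V]; linarith
  obtain ⟨c, cp, c1, c2⟩ := coef_seq (fun n => C n * V n)
    (fun n => one_le_mul_of_one_le_of_one_le (hC1 n) (hV1 n))
  have hcC : ∀ n, c n * C n ≤ (1/4)^n := fun n => by
    refine le_trans ?_ (c1 n)
    have := hC1 n
    have := cp n
    gcongr
    exact le_mul_of_one_le_right (by linarith) (hV1 n)
  have hsum : Summable (fun n : ℕ => ((1:ℝ)/4)^n) :=
    summable_geometric_of_lt_one (by norm_num) (by norm_num)
  let g : ℂ → ℂ := fun z => ∑' n, (c n • h n) z
  have hg : ContDiff ℝ ∞ g := by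
    refine contDiff_tsum_of_eventually (fun k => (hs k).const_smul (c k))
        (v := fun _ n => (1/4)^n) (fun k _ => hsum) ?_
    intro i _
    simp only [Nat.cofinite_eq_atTop, Filter.eventually_atTop]
    refine ⟨i, fun n hn x => ?_⟩
    rw [iteratedFDeriv_const_smul_apply ((hs n).contDiffAt.of_le (mod_cast le_top)), norm_smul,
      Real.norm_of_nonneg (cp n).le]
    exact le_trans (mul_le_mul_of_nonneg_left (hC n i hn x) (cp n).le) (hcC n)
  refine ⟨g, hg, ?_⟩
  set G : C(K, ℂ) := ⟨fun z => g z, hg.continuous.comp continuous_subtype_val⟩ with hG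
  let H : ℕ → C(K, ℂ) := fun n => ⟨fun z => h n z, (hs n).continuous.comp continuous_subtype_val⟩
  have hHn : ∀ n, ‖H n‖ ≤ C n := by
    intro n
    rw [ContinuousMap.norm_le _ (zero_le_one.trans (hC1 n))]
    intro z
    have := hC n 0 (Nat.zero_le _) z
    rwa [norm_iteratedFDeriv_zero] at this
  have hcH : ∀ n, ‖c n • H n‖ ≤ c n * C n := fun n => by
    rw [norm_smul, Real.norm_of_nonneg (cp n).le]
    exact mul_le_mul_of_nonneg_left (hHn n) (cp n).le
  have hS : Summable (fun n => c n • H n) :=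
    Summable.of_norm_bounded hsum (fun n => (hcH n).trans (hcC n))
  have hGs : G = ∑' n, c n • H n := by
    ext z
    rw [← ContinuousMap.tsum_apply hS]
    rfl
  have hHZ : ∀ n, (Z - algebraMap ℂ _ (a n : ℂ)) * H n = 1 := by
    intro n
    ext z
    have : (z:ℂ) - a n ≠ 0 := sub_ne_zero.2 (fun e => (a n).2 (e ▸ z.2))
    simp [Z, H, hv n z z.2, this]
  constructor
  · have hcl : IsClosed (ratAlg K) := isClosed_closure
    rw [hGs]
    refine hcl.mem_of_tendsto hS.hasSum (Filter.Eventually.of_forall fun s => ?_)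
    rw [← ratSub_closure]
    refine Subalgebra.sum_mem _ fun n _ => ?_
    have : c n • H n = (c n : ℂ) • H n := by ext z; simp
    rw [this]
    refine Subalgebra.smul_mem _ ?_ _
    apply subset_closure
    refine ⟨1, Polynomial.X - Polynomial.C (a n : ℂ), fun z hz => ?_, fun z => ?_⟩
    · simp only [Polynomial.eval_sub, Polynomial.eval_X, Polynomial.eval_C]
      exact sub_ne_zero.2 (fun e => (a n).2 (e ▸ hz))
    · simp [H, hv n z z.2]
  · let B : Subalgebra ℂ C(K, ℂ) := (Algebra.adjoin ℂ {Z, G}).topologicalClosure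
    have hBc : IsClosed (B : Set C(K, ℂ)) := Subalgebra.isClosed_topologicalClosure _
    have hZB : Z ∈ B := subset_closure (Algebra.subset_adjoin (by simp))
    have hGB : G ∈ B := subset_closure (Algebra.subset_adjoin (by simp))
    have hHB : ∀ n, H n ∈ B := by
      intro n
      induction n using Nat.strong_induction_on with
      | _ n ih =>
      let T := G - ∑ j ∈ Finset.range n, c j • H j
      let E := ∑' j, c (j + (n+1)) • H (j + (n+1))
      have hTE : T = c n • H n + E := by
        have := hS.sum_add_tsum_nat_add (n+1)
        rw [Finset.sum_range_succ, ← hGs] at this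
        simp only [T, E, ← this]
        abel
      have hTB : T ∈ B := by
        refine B.sub_mem hGB (B.sum_mem fun j hj => ?_)
        have : c j • H j = (c j : ℂ) • H j := by ext z; simp
        rw [this]
        exact B.smul_mem (ih j (Finset.mem_range.1 hj)) _
      have hgeo : HasSum (fun j : ℕ => c n * ((1:ℝ)/4)^(j+1)) (c n * (1/3)) := by
        have := (hasSum_geometric_of_lt_one (r := (1:ℝ)/4) (by norm_num) (by norm_num)).mul_left
          (c n * (1/4))
        have e1 : (fun j : ℕ => c n * ((1:ℝ)/4)^(j+1)) = fun j => c n * (1/4) * (1/4)^j := by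
          funext j; rw [pow_succ]; ring
        have e2 : c n * ((1:ℝ)/3) = c n * (1/4) * (1 - 1/4)⁻¹ := by norm_num; ring
        rw [e1, e2]; exact this
      have hE : ‖(Z - algebraMap ℂ _ (a n : ℂ)) * E‖ ≤ c n * (1/3) := by
        have hS' : Summable (fun j => c (j + (n+1)) • H (j + (n+1))) :=
          (summable_nat_add_iff (n+1)).2 hS
        simp only [E]
        rw [← hS'.tsum_mul_left]
        refine tsum_of_norm_bounded hgeo fun j => ?_
        refine (norm_mul_le _ _).trans ?_
        have e1 := hcH (j + (n+1))
        have e2 := c2 n j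
        have e3 : W n ≤ V (j + (n+1)) := hWV _ _ (by omega)
        calc W n * ‖c (j + (n+1)) • H (j + (n+1))‖
            ≤ V (j + (n+1)) * (c (j + (n+1)) * C (j + (n+1))) := by
              gcongr
          _ = c (j + n + 1) * (C (j + n + 1) * V (j + n + 1)) := by
            rw [show j + (n+1) = j + n + 1 by ring]; ring
          _ ≤ _ := e2
      let L : C(K, ℂ) := algebraMap ℂ _ ((c n : ℂ)⁻¹)
      have hLB : L ∈ B := B.algebraMap_mem _
      have hcn : (c n : ℂ) ≠ 0 := by exact_mod_cast (cp n).ne'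
      let u := (Z - algebraMap ℂ _ (a n : ℂ)) * (T * L)
      have hu : u ∈ B := B.mul_mem (B.sub_mem hZB (B.algebraMap_mem _)) (B.mul_mem hTB hLB)
      have hu1 : u - 1 = (c n)⁻¹ • ((Z - algebraMap ℂ _ (a n : ℂ)) * E) := by
        have : u = L * (c n • ((Z - algebraMap ℂ _ (a n : ℂ)) * H n)) +
            L * ((Z - algebraMap ℂ _ (a n : ℂ)) * E) := by
          simp only [u, hTE, mul_add, add_mul, mul_smul_comm, smul_mul_assoc]
          congr 1
          · congr 1; ring
          · ring
        rw [this, hHZ]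
        ext z
        simp [L, hcn]
      obtain ⟨v, hv, huv⟩ := unit_mem B hBc u hu (by
        rw [hu1, norm_smul, norm_inv, Real.norm_of_nonneg (cp n).le, inv_mul_lt_iff₀ (cp n)]
        have := cp n
        linarith)
      have : H n = T * L * v := by
        calc H n = H n * (u * v) := by rw [huv, mul_one]
          _ = ((Z - algebraMap ℂ _ (a n : ℂ)) * H n) * (T * L * v) := by simp only [u]; ring
          _ = _ := by rw [hHZ, one_mul]
      rw [this]
      exact B.mul_mem (B.mul_mem hTB hLB) hv
    refine rat_sub K B hBc Z (fun _ => rfl) hZB ?_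
    have hun : ∀ b : (Kᶜ : Set ℂ), IsUnit (Z - algebraMap ℂ C(K, ℂ) (b:ℂ)) := by
      intro b
      obtain ⟨h', hs', -, hv'⟩ := pole_fun K hK b b.2
      refine IsUnit.of_mul_eq_one ⟨fun z => h' z, hs'.continuous.comp continuous_subtype_val⟩ ?_
      ext z
      have : (z:ℂ) - b ≠ 0 := sub_ne_zero.2 (fun e => b.2 (e ▸ z.2))
      simp [Z, hv' z z.2, this]
    have hcont : Continuous fun b : (Kᶜ : Set ℂ) => Ring.inverse (Z - algebraMap ℂ C(K, ℂ) (b:ℂ)) := by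
      rw [continuous_iff_continuousAt]
      intro b
      obtain ⟨w, hw⟩ := hun b
      have e1 := NormedRing.inverse_continuousAt w
      rw [hw] at e1
      have e2 : Continuous fun b : (Kᶜ : Set ℂ) => Z - algebraMap ℂ C(K, ℂ) (b:ℂ) :=
        continuous_const.sub ((continuous_algebraMap ℂ _).comp continuous_subtype_val)
      exact ContinuousAt.comp (g := Ring.inverse) e1 e2.continuousAt
    have hall : ∀ b : (Kᶜ : Set ℂ), Ring.inverse (Z - algebraMap ℂ C(K, ℂ) (b:ℂ)) ∈ B := by
      intro b
      refine (TopologicalSpace.denseRange_denseSeq (Kᶜ : Set ℂ)).induction_on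
        (p := fun b => Ring.inverse (Z - algebraMap ℂ C(K, ℂ) (b:ℂ)) ∈ B) b
        (hBc.preimage hcont) ?_
      intro n
      have : Ring.inverse (Z - algebraMap ℂ C(K, ℂ) (a n:ℂ)) = H n := by
        have e := Ring.inverse_mul_cancel _ (hun (a n))
        calc _ = Ring.inverse (Z - algebraMap ℂ C(K, ℂ) (a n:ℂ)) *
              ((Z - algebraMap ℂ _ (a n : ℂ)) * H n) := by rw [hHZ, mul_one]
          _ = _ := by rw [← mul_assoc, e, one_mul]
      show Ring.inverse (Z - algebraMap ℂ C(K, ℂ) (a n:ℂ)) ∈ B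
      rw [this]; exact hHB n
    intro b hb
    exact ⟨_, hall ⟨b, hb⟩, Ring.mul_inverse_cancel _ (hun ⟨b, hb⟩)⟩
lemma ideal_mem (X : Set ℂ) [CompactSpace X] (K : Set ℂ) (r Z s : C(X, ℂ))
    (hZ : ∀ x, Z x = (x : ℂ)) (hr0 : ∀ x : X, r x = 0 ↔ (x:ℂ) ∈ K)
    (hrs : star r = r) (hs : s = r * star Z)
    (B : Subalgebra ℂ C(X, ℂ)) (hB : IsClosed (B : Set C(X, ℂ)))
    (hrB : r ∈ B) (hZB : Z ∈ B) (hsB : s ∈ B)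
    (F : C(X, ℂ)) (hF : ∀ x : X, (x:ℂ) ∈ K → F x = 0) : F ∈ B := by
  let Θ : X → ℂ × ℂ := fun x => (r x, r x * Z x)
  have hΘ : Continuous Θ := by fun_prop
  let Y := Set.range Θ
  have hYc : CompactSpace Y := isCompact_iff_compactSpace.1 (isCompact_range hΘ)
  let π : C(X, Y) := ⟨Set.rangeFactorization Θ, hΘ.subtype_mk _⟩
  have hπ : Topology.IsQuotientMap π :=
    Topology.IsQuotientMap.of_surjective_continuous Set.rangeFactorization_surjective π.continuous
  have hfac : Function.FactorsThrough F π := by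
    intro x y hxy
    have h1 : Θ x = Θ y := congrArg Subtype.val hxy
    have h2 : r x = r y := congrArg Prod.fst h1
    have h3 : r x * Z x = r y * Z y := congrArg Prod.snd h1
    by_cases h : r x = 0
    · rw [hF x ((hr0 x).1 h), hF y ((hr0 y).1 (h2 ▸ h))]
    · rw [← h2] at h3
      have := mul_left_cancel₀ h h3
      rw [hZ, hZ] at this
      rw [Subtype.ext this]
  let Fl : C(Y, ℂ) := hπ.lift F hfac
  have hFl : Fl.comp π = F := hπ.lift_comp F hfac
  let t : C(Y, ℂ) := ⟨fun y => y.1.1, by fun_prop⟩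
  let w : C(Y, ℂ) := ⟨fun y => y.1.2, by fun_prop⟩
  let A₀ : StarSubalgebra ℂ C(Y, ℂ) := StarAlgebra.adjoin ℂ {t, w}
  have hsep : A₀.SeparatesPoints := by
    intro x y hxy
    by_cases h : x.1.1 = y.1.1
    · refine ⟨w, ⟨w, StarAlgebra.subset_adjoin ℂ _ (by simp), rfl⟩, ?_⟩
      intro h2
      exact hxy (Subtype.ext (Prod.ext h h2))
    · exact ⟨t, ⟨t, StarAlgebra.subset_adjoin ℂ _ (by simp), rfl⟩, h⟩
  have htop := ContinuousMap.starSubalgebra_topologicalClosure_eq_top_of_separatesPoints A₀ hsep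
  let φ : C(Y, ℂ) →ₐ[ℂ] C(X, ℂ) := ContinuousMap.compRightAlgHom ℂ ℂ π
  have hφc : Continuous φ := ContinuousMap.continuous_precomp π
  have hle : A₀.toSubalgebra ≤ B.comap φ := by
    show (StarAlgebra.adjoin ℂ {t, w}).toSubalgebra ≤ _
    rw [StarAlgebra.adjoin_toSubalgebra, Algebra.adjoin_le_iff]
    have et : φ t = r := rfl
    have ew : φ w = r * Z := rfl
    have ets : φ (star t) = r := by rw [← hrs]; rfl
    have ews : φ (star w) = s := by
      have : φ (star w) = star (r * Z) := rfl
      rw [this, star_mul, hrs, hs, mul_comm]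
    rintro y (hy | hy)
    · rcases hy with rfl | rfl
      · show φ t ∈ B
        rw [et]; exact hrB
      · show φ w ∈ B
        rw [ew]; exact B.mul_mem hrB hZB
    · rw [Set.mem_star] at hy
      rcases hy with hy | hy
      · have : y = star t := by rw [← hy, star_star]
        rw [this]
        show φ (star t) ∈ B
        rw [ets]; exact hrB
      · have : y = star w := by rw [← Set.mem_singleton_iff.1 hy, star_star]
        rw [this]
        show φ (star w) ∈ B
        rw [ews]; exact hsB
  have hmem : Fl ∈ A₀.topologicalClosure := by rw [htop]; trivial
  have hcl : closure (A₀ : Set C(Y, ℂ)) ⊆ φ ⁻¹' (B : Set C(X, ℂ)) :=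
    closure_minimal hle (hB.preimage hφc)
  have := hcl hmem
  have e : φ Fl = F := hFl
  rw [Set.mem_preimage, e] at this
  exact this

lemma trunc {X : Type*} [TopologicalSpace X] [CompactSpace X] (e : C(X, ℂ)) (ε : ℝ) (hε : 0 < ε) :
    ∃ e' : C(X, ℂ), (∀ x, ‖e x‖ ≤ ε → e' x = 0) ∧ ‖e - e'‖ ≤ ε := by
  have hm : ∀ x, 0 < max ε ‖e x‖ := fun x => lt_max_of_lt_left hε
  let d : C(X, ℂ) := ⟨fun x => (ε / max ε ‖e x‖) • e x, by
    refine Continuous.smul (continuous_const.div (by fun_prop) fun x => (hm x).ne') (by fun_prop)⟩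
  refine ⟨e - d, fun x hx => ?_, ?_⟩
  · show e x - (ε / max ε ‖e x‖) • e x = 0
    rw [max_eq_left hx, div_self hε.ne', one_smul, sub_self]
  · rw [sub_sub_cancel, ContinuousMap.norm_le _ hε.le]
    intro x
    show ‖(ε / max ε ‖e x‖) • e x‖ ≤ ε
    rw [norm_smul, Real.norm_of_nonneg (by have := hm x; positivity), div_mul_eq_mul_div,
      div_le_iff₀ (hm x)]
    gcongr
    exact le_max_right _ _

lemma hull_est (X : Set ℂ) [CompactSpace X] (f : Fin 3 → ℂ → ℂ)
    (G : Fin 4 → C(X, ℂ)) (hG : ∀ i x, G i x = (Fin.cons (x:ℂ) (fun j => f j x) : Fin 4 → ℂ) i)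
    (w : Fin 4 → ℂ) (hw : w ∈ polyHull (graphF f X)) (u : Fin 4 → C(X, ℂ))
    (hu : ∀ i, u i ∈ genAlg (zfGens X f)) :
    ¬ ‖1 - ∑ i, (G i - algebraMap ℂ _ (w i)) * u i‖ < 1 := by
  intro hlt
  let S : Set (Fin 4 → C(X, ℂ)) := {u | ‖1 - ∑ i, (G i - algebraMap ℂ _ (w i)) * u i‖ < 1}
  have hS : IsOpen S := by
    apply isOpen_lt _ continuous_const
    fun_prop
  let A : Set C(X, ℂ) := Algebra.adjoin ℂ (zfGens X f)
  have hcl : u ∈ closure (Set.pi Set.univ fun _ : Fin 4 => A) := by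
    rw [closure_pi_set]
    intro i _
    exact hu i
  obtain ⟨v, hvS, hvA⟩ := mem_closure_iff.1 hcl S hS hlt
  have hAr : Algebra.adjoin ℂ (zfGens X f) ≤ (MvPolynomial.aeval (R := ℂ) G).range := by
    rw [Algebra.adjoin_le_iff]
    rintro y (hy | ⟨j, hy⟩)
    · refine ⟨MvPolynomial.X 0, ?_⟩
      ext x
      simp [hy, hG]
    · refine ⟨MvPolynomial.X j.succ, ?_⟩
      ext x
      simp [hy, hG]
  choose p hp using fun i => hAr (hvA i trivial)
  have hp' : ∀ i, MvPolynomial.aeval G (p i) = v i := hp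
  let Q : MvPolynomial (Fin 4) ℂ := 1 - ∑ i, (MvPolynomial.X i - MvPolynomial.C (w i)) * p i
  have hQ1 : MvPolynomial.eval w Q = 1 := by simp [Q]
  have hQ2 : MvPolynomial.aeval G Q = 1 - ∑ i, (G i - algebraMap ℂ _ (w i)) * v i := by
    simp only [Q, map_sub, map_one, map_sum, map_mul, MvPolynomial.aeval_X, hp',
      MvPolynomial.algHom_C]
  have hev : ∀ (q : MvPolynomial (Fin 4) ℂ) (x : X), MvPolynomial.eval
      (Fin.cons (x:ℂ) (fun j => f j x) : Fin 4 → ℂ) q = MvPolynomial.aeval G q x := by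
    intro q x
    induction q using MvPolynomial.induction_on with
    | C c => simp
    | add p q hp hq => simp [hp, hq]
    | mul_X p i hp => simp [hp, hG]
  have h1 := hw Q
  rw [hQ1, norm_one] at h1
  have h2 : sSup ((fun w => ‖MvPolynomial.eval w Q‖) '' graphF f X) ≤ ‖MvPolynomial.aeval G Q‖ := by
    apply Real.sSup_le _ (norm_nonneg _)
    rintro _ ⟨_, ⟨z, hz, rfl⟩, rfl⟩
    show ‖MvPolynomial.eval (Fin.cons z (fun j => f j z) : Fin 4 → ℂ) Q‖ ≤ _
    rw [hev Q ⟨z, hz⟩]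
    exact ContinuousMap.norm_coe_le_norm _ _
  have h3 : ‖MvPolynomial.aeval G Q‖ < 1 := by rw [hQ2]; exact hvS
  linarith

lemma rat_quot (K : Set ℂ) (hK : IsCompact K) (g : C(K, ℂ)) (hg : g ∈ ratAlg K) (a : ℂ)
    (ha : a ∈ K) (ε : ℝ) (hε : 0 < ε) :
    ∃ s ∈ ratAlg K, ∀ z : K, ‖g z - g ⟨a, ha⟩ - ((z:ℂ) - a) * s z‖ ≤ ε := by
  have : CompactSpace K := isCompact_iff_compactSpace.1 hK
  obtain ⟨r, ⟨p, q, hq, hr⟩, hd⟩ := Metric.mem_closure_iff.1 hg (ε/2) (by linarith)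
  have hroot : (p * Polynomial.C (q.eval a) - q * Polynomial.C (p.eval a)).IsRoot a := by
    simp [Polynomial.IsRoot, mul_comm]
  obtain ⟨t, ht⟩ := Polynomial.dvd_iff_isRoot.2 hroot
  let s : C(K, ℂ) := ⟨fun z => t.eval (z:ℂ) / (q * Polynomial.C (q.eval a)).eval (z:ℂ), by
    refine Continuous.div (t.continuous.comp continuous_subtype_val)
      ((Polynomial.continuous _).comp continuous_subtype_val) fun z => ?_
    simp [hq z z.2, hq a ha]⟩
  refine ⟨s, subset_closure ⟨t, _, ?_, fun z => rfl⟩, fun z => ?_⟩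
  · intro z hz
    simp [hq z hz, hq a ha]
  · have e : r z - r ⟨a, ha⟩ = ((z:ℂ) - a) * s z := by
      have h1 := congrArg (Polynomial.eval (z:ℂ)) ht
      simp at h1
      have h2 := hq z z.2
      have h3 := hq a ha
      simp only [hr, s, ContinuousMap.coe_mk, Polynomial.eval_mul, Polynomial.eval_C]
      field_simp
      linear_combination h1
    rw [← e]
    have d1 := (ContinuousMap.dist_lt_iff (by linarith)).1 hd z
    have d2 := (ContinuousMap.dist_lt_iff (by linarith)).1 hd ⟨a, ha⟩
    rw [dist_eq_norm] at d1 d2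
    calc _ = ‖(g z - r z) - (g ⟨a, ha⟩ - r ⟨a, ha⟩)‖ := by congr 1; ring
      _ ≤ _ := norm_sub_le _ _
      _ ≤ ε := by linarith
set_option maxHeartbeats 2000000 in
theorem stmt6 (Ω : Set ℂ) (hne : Ω.Nonempty) (hopen : IsOpen Ω)
    (hbd : Bornology.IsBounded Ω) :
    ∃ f : Fin 3 → ℂ → ℂ, (∀ j, ContDiff ℝ (⊤ : ℕ∞) (f j)) ∧
      ∃ K : Set ℂ, ∃ hKΩ : K ⊆ Ω, IsCompact K ∧
        -- (1) the graph of f over Ω̄ is polynomially convex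
        polyHull (graphF f (closure Ω)) = graphF f (closure Ω) ∧
        -- (2) the Shilov boundary of [z,f]_Ω̄ is all of Ω̄
        (∀ S : Set (closure Ω), IsClosed S → S ≠ Set.univ →
          ∃ g ∈ genAlg (zfGens (closure Ω) f),
            sSup ((fun w => ‖g w‖) '' S) < sSup ((fun w => ‖g w‖) '' Set.univ)) ∧
        -- (3) C(Ω̄) ∩ R(K) ⊆ [z,f]_Ω̄
        (∀ F : C(closure Ω, ℂ),
          F.comp ⟨Set.inclusion (hKΩ.trans subset_closure),
            continuous_inclusion (hKΩ.trans subset_closure)⟩ ∈ ratAlg K →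
          F ∈ genAlg (zfGens (closure Ω) f)) ∧
        -- (4) [z,f]_Ω̄ ≠ C(Ω̄)
        genAlg (zfGens (closure Ω) f) ≠ Set.univ := by

  obtain ⟨c0, hc0⟩ := hne
  obtain ⟨R, hR, hRΩ⟩ := Metric.nhds_basis_closedBall.mem_iff.1 (hopen.mem_nhds hc0)
  obtain ⟨K, hKb, hKc, hKi, hKr⟩ := cheese c0 R hR
  have hKΩ : K ⊆ Ω := hKb.trans hRΩ
  obtain ⟨g, hg, hg1, hg2⟩ := gen K hKc
  obtain ⟨ρ, hρs, hρ, -⟩ := hKc.isClosed.isOpen_compl.exists_contDiff_support_eq (n := ⊤)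
  have hρ0 : ∀ z, ρ z = 0 ↔ z ∈ K := by
    intro z
    have : z ∈ Function.support ρ ↔ z ∈ Kᶜ := by rw [hρs]
    rw [Function.mem_support, Set.mem_compl_iff] at this
    exact not_iff_not.1 this
  let f : Fin 3 → ℂ → ℂ :=
    ![g, fun z => (ρ z : ℂ), fun z => (ρ z : ℂ) * (starRingEnd ℂ) z]
  have hρc : ContDiff ℝ (⊤ : ℕ∞) fun z => (ρ z : ℂ) := Complex.ofRealCLM.contDiff.comp hρ
  have hf : ∀ j, ContDiff ℝ (⊤ : ℕ∞) (f j) := by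
    intro j
    fin_cases j
    · exact hg
    · exact hρc
    · exact hρc.mul Complex.conjCLE.contDiff
  refine ⟨f, hf, K, hKΩ, hKc, ?_⟩
  have hXc : IsCompact (closure Ω) := hbd.isCompact_closure
  have hKX : K ⊆ closure Ω := hKΩ.trans subset_closure
  have hΩX : Ω ⊆ closure Ω := subset_closure
  have hΩd : ∀ S : Set (closure Ω), IsClosed S → S ≠ Set.univ → ∃ x : closure Ω, x ∉ S ∧ (x:ℂ) ∉ K := by
    intro S hS hSne
    obtain ⟨x, hx⟩ := (Set.ne_univ_iff_exists_notMem S).1 hSne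
    obtain ⟨U, hU, hUS⟩ := isOpen_induced_iff.1 hS.isOpen_compl
    have hxU : (x:ℂ) ∈ U := by
      have : x ∈ Subtype.val ⁻¹' U := by rw [hUS]; exact hx
      exact this
    obtain ⟨y, hyU, hyΩ⟩ := mem_closure_iff.1 x.2 U hU hxU
    have hn : ¬ (U ∩ Ω ⊆ K) := by
      intro h
      have := interior_maximal h (hU.inter hopen)
      rw [hKi] at this
      exact this ⟨hyU, hyΩ⟩
    obtain ⟨v, hv, hvK⟩ := Set.not_subset.1 hn
    refine ⟨⟨v, hΩX hv.2⟩, ?_, hvK⟩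
    have : (⟨v, hΩX hv.2⟩ : closure Ω) ∈ Subtype.val ⁻¹' U := hv.1
    rw [hUS] at this
    exact this
  suffices key : ∀ X : Set ℂ, IsCompact X → ∀ hKX : K ⊆ X,
      (∀ S : Set X, IsClosed S → S ≠ Set.univ → ∃ x : X, x ∉ S ∧ (x:ℂ) ∉ K) →
      polyHull (graphF f X) = graphF f X ∧
        (∀ S : Set X, IsClosed S → S ≠ Set.univ →
          ∃ g ∈ genAlg (zfGens X f),
            sSup ((fun w => ‖g w‖) '' S) < sSup ((fun w => ‖g w‖) '' Set.univ)) ∧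
        (∀ F : C(X, ℂ),
          F.comp ⟨Set.inclusion hKX, continuous_inclusion hKX⟩ ∈ ratAlg K →
          F ∈ genAlg (zfGens X f)) ∧
        genAlg (zfGens X f) ≠ Set.univ from key _ hXc hKX hΩd
  clear hΩd hKX hXc hΩX
  intro X hXc hKX hΩd
  have : CompactSpace X := isCompact_iff_compactSpace.1 hXc
  have : CompactSpace K := isCompact_iff_compactSpace.1 hKc
  let A : Subalgebra ℂ C(X, ℂ) := Algebra.adjoin ℂ (zfGens X f)
  let B : Subalgebra ℂ C(X, ℂ) := A.topologicalClosure
  have hBgen : genAlg (zfGens X f) = (B : Set C(X, ℂ)) := rfl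
  have hBc : IsClosed (B : Set C(X, ℂ)) := Subalgebra.isClosed_topologicalClosure _
  have hAB : A ≤ B := Subalgebra.le_topologicalClosure _
  let G : Fin 4 → C(X, ℂ) := Fin.cons ⟨fun x => (x:ℂ), continuous_subtype_val⟩
    (fun j => ⟨fun x => f j x, (hf j).continuous.comp continuous_subtype_val⟩)
  have hG : ∀ i x, G i x = (Fin.cons (x:ℂ) (fun j => f j x) : Fin 4 → ℂ) i := by
    intro i x
    refine Fin.cases ?_ (fun j => ?_) i <;> simp [G]
  have hG0 : ∀ x, G 0 x = (x:ℂ) := fun x => rfl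
  have hG1 : ∀ x, G 1 x = g x := fun x => rfl
  have hG2 : ∀ x, G 2 x = (ρ x : ℂ) := fun x => rfl
  have hG3 : ∀ x, G 3 x = (ρ x : ℂ) * (starRingEnd ℂ) (x:ℂ) := fun x => rfl
  have hGA : ∀ i, G i ∈ A := by
    intro i
    refine Fin.cases ?_ (fun j => ?_) i
    · exact Algebra.subset_adjoin (Or.inl fun z => rfl)
    · exact Algebra.subset_adjoin (Or.inr ⟨j, fun z => rfl⟩)
  have hideal : ∀ F : C(X, ℂ), (∀ x : X, (x:ℂ) ∈ K → F x = 0) → F ∈ B := by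
    intro F hF
    refine ideal_mem X K (G 2) (G 0) (G 3) hG0 ?_ ?_ ?_ B hBc (hAB (hGA 2)) (hAB (hGA 0))
      (hAB (hGA 3)) F hF
    · intro x
      rw [hG2, ← hρ0]; simp
    · ext x
      rw [ContinuousMap.star_apply, hG2]; simp
    · ext x
      rw [hG3, ContinuousMap.mul_apply, hG2, ContinuousMap.star_apply, hG0]; rfl
  let ι : C(K, X) := ⟨Set.inclusion hKX, continuous_inclusion hKX⟩
  let res : C(X, ℂ) →ₐ[ℂ] C(K, ℂ) := ContinuousMap.compRightAlgHom ℂ ℂ ι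
  have hresc : Continuous res := ContinuousMap.continuous_precomp ι
  have hlift : ∀ r ∈ ratAlg K, ∀ ε > 0, ∃ P ∈ A, ∀ z : K, ‖r z - P (ι z)‖ ≤ ε := by
    intro r hr ε hε
    obtain ⟨p, hp, hd⟩ := Metric.mem_closure_iff.1 (hg2 hr) ε hε
    have e : ({⟨fun z => (z:ℂ), continuous_subtype_val⟩,
      (⟨fun z => g z, hg.continuous.comp continuous_subtype_val⟩ : C(K, ℂ))} : Set C(K, ℂ)) =
        res '' {G 0, G 1} := by
      rw [Set.image_pair]; rfl
    rw [e, ← AlgHom.map_adjoin] at hp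
    obtain ⟨P, hP, rfl⟩ := hp
    refine ⟨P, ?_, fun z => ?_⟩
    · refine Algebra.adjoin_le ?_ hP
      rintro y (rfl | rfl)
      · exact hGA 0
      · exact hGA 1
    · have := (ContinuousMap.dist_lt_iff hε).1 hd z
      rw [dist_eq_norm] at this
      exact this.le
  have h3 : ∀ F : C(X, ℂ), res F ∈ ratAlg K → F ∈ B := by
    intro F hF
    have : F ∈ closure (B : Set C(X, ℂ)) := by
      rw [Metric.mem_closure_iff]
      intro ε hε
      obtain ⟨P, hP, hPF⟩ := hlift _ hF (ε/2) (by linarith)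
      obtain ⟨e', he', hn⟩ := trunc (F - P) (ε/2) (by linarith)
      refine ⟨P + e', B.add_mem (hAB hP) (hideal e' fun x hx => he' x (hPF ⟨x, hx⟩)), ?_⟩
      rw [dist_eq_norm, ← sub_sub]
      linarith
    rwa [hBc.closure_eq] at this
  rw [hBgen]
  refine ⟨?_, ?_, h3, ?_⟩
  · apply Set.Subset.antisymm
    · intro w hw
      by_contra hwn
      have hfinish : ∀ v : Fin 4 → C(X, ℂ), (∀ i, v i ∈ B) →
          (∀ x : X, (x:ℂ) ∈ K →
            ‖(1 - ∑ i, (G i - algebraMap ℂ _ (w i)) * v i : C(X, ℂ)) x‖ ≤ 1/2) → False := by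
        intro v hv hvK
        obtain ⟨e', he', hn⟩ := trunc (1 - ∑ i, (G i - algebraMap ℂ _ (w i)) * v i) (1/2)
          (by norm_num)
        have hpos : ∀ x : X, (∑ i, ‖G i x - w i‖^2) ≠ 0 := by
          intro x h0
          rw [Finset.sum_eq_zero_iff_of_nonneg (fun _ _ => by positivity)] at h0
          apply hwn
          refine ⟨x, x.2, ?_⟩
          funext i
          have := h0 i (Finset.mem_univ i)
          rw [pow_eq_zero_iff (by norm_num), norm_eq_zero, sub_eq_zero] at this
          rw [← this, hG]
        let d : C(X, ℂ) := ⟨fun x => ((∑ i, ‖G i x - w i‖^2 : ℝ) : ℂ)⁻¹, by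
          refine Continuous.inv₀ (by fun_prop) fun x => ?_
          exact_mod_cast hpos x⟩
        let u : Fin 4 → C(X, ℂ) := fun i =>
          v i + star (G i - algebraMap ℂ _ (w i)) * (e' * d)
        have hu : ∀ i, u i ∈ B := by
          intro i
          refine B.add_mem (hv i) (hideal _ fun x hx => ?_)
          simp [he' x (hvK x hx)]
        apply hull_est X f G hG w hw u hu
        have : (1 - ∑ i, (G i - algebraMap ℂ _ (w i)) * u i : C(X, ℂ)) =
            1 - ∑ i, (G i - algebraMap ℂ _ (w i)) * v i - e' := by
          have e1 : ∑ i, (G i - algebraMap ℂ C(X, ℂ) (w i)) *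
              (star (G i - algebraMap ℂ C(X, ℂ) (w i)) * (e' * d)) = e' := by
            simp_rw [← mul_assoc]
            rw [← Finset.sum_mul, ← Finset.sum_mul]
            ext x
            have e2 : (∑ i, (G i - algebraMap ℂ C(X, ℂ) (w i)) *
                star (G i - algebraMap ℂ C(X, ℂ) (w i))) x =
                ((∑ i, ‖G i x - w i‖^2 : ℝ) : ℂ) := by
              rw [ContinuousMap.sum_apply]
              push_cast
              refine Finset.sum_congr rfl fun i _ => ?_
              have := Complex.mul_conj' (G i x - w i)
              rw [← this]
              rfl
            rw [ContinuousMap.mul_apply, ContinuousMap.mul_apply, e2]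
            show _ * _ * ((∑ i, ‖G i x - w i‖^2 : ℝ) : ℂ)⁻¹ = _
            have : ((∑ i, ‖G i x - w i‖^2 : ℝ) : ℂ) ≠ 0 := by exact_mod_cast hpos x
            field_simp
          simp only [u, mul_add, Finset.sum_add_distrib]
          rw [e1, sub_sub]
        rw [this]
        linarith
      have hsum : ∀ (v : Fin 4 → C(X, ℂ)) (x : X),
          (1 - ∑ i, (G i - algebraMap ℂ _ (w i)) * v i : C(X, ℂ)) x =
          1 - (((x:ℂ) - w 0) * v 0 x + (g x - w 1) * v 1 x + ((ρ x : ℂ) - w 2) * v 2 x +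
            ((ρ x : ℂ) * (starRingEnd ℂ) (x:ℂ) - w 3) * v 3 x) := by
        intro v x
        rw [Fin.sum_univ_four]
        rfl
      obtain ⟨D, hD0, hD⟩ : ∃ D : ℝ, 0 < D ∧ ∀ z ∈ K, ‖z - w 0‖ ≤ D := by
        obtain ⟨D, hD0, hD⟩ := hKc.isBounded.subset_closedBall_lt 0 (w 0)
        exact ⟨D, hD0, fun z hz => by rw [← dist_eq_norm]; exact hD hz⟩
      by_cases haK : w 0 ∈ K
      · have hρK : ∀ x ∈ K, ρ x = 0 := fun x hx => (hρ0 x).2 hx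
        by_cases h2 : w 2 = 0
        · by_cases h33 : w 3 = 0
          · have hη : g (w 0) - w 1 ≠ 0 := by
              intro h
              apply hwn
              refine ⟨w 0, hKX haK, ?_⟩
              funext i
              fin_cases i
              · rfl
              · exact sub_eq_zero.1 h
              · show (ρ (w 0) : ℂ) = w 2
                rw [h2, hρK _ haK]; simp
              · show (ρ (w 0) : ℂ) * (starRingEnd ℂ) (w 0) = w 3
                rw [h33, hρK _ haK]; simp
            set η := g (w 0) - w 1 with hηd
            have hηp : 0 < ‖η‖ := norm_pos_iff.2 hη
            obtain ⟨s, hs, hsq⟩ := rat_quot K hKc _ hg1 (w 0) haK (‖η‖/4) (by positivity)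
            obtain ⟨P, hP, hPs⟩ := hlift s hs (‖η‖/(4*D)) (by positivity)
            refine hfinish ![- (algebraMap ℂ _ η⁻¹ * P), algebraMap ℂ _ η⁻¹, 0, 0] ?_ ?_
            · intro i
              fin_cases i
              · exact B.neg_mem (B.mul_mem (B.algebraMap_mem _) (hAB hP))
              · exact B.algebraMap_mem _
              · exact B.zero_mem
              · exact B.zero_mem
            · intro x hx
              rw [hsum]
              have e1 := hsq ⟨x, hx⟩
              have e2 := hPs ⟨x, hx⟩
              have e3 : ι ⟨x, hx⟩ = x := rfl
              rw [e3] at e2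
              simp only [ContinuousMap.coe_mk] at e1
              set sx := s ⟨x, hx⟩
              have e4 : (1 - (((x:ℂ) - w 0) * (- (algebraMap ℂ C(X, ℂ) η⁻¹ * P)) x +
                  (g x - w 1) * (algebraMap ℂ C(X, ℂ) η⁻¹) x + ((ρ x : ℂ) - w 2) * (0 : C(X, ℂ)) x +
                  ((ρ x : ℂ) * (starRingEnd ℂ) (x:ℂ) - w 3) * (0 : C(X, ℂ)) x)) =
                  η⁻¹ * (-(g x - g (w 0) - ((x:ℂ) - w 0) * sx) - ((x:ℂ) - w 0) * (sx - P x)) := by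
                simp
                field_simp
                rw [hηd]; ring
              show ‖(1 - (((x:ℂ) - w 0) * (- (algebraMap ℂ C(X, ℂ) η⁻¹ * P)) x +
                  (g x - w 1) * (algebraMap ℂ C(X, ℂ) η⁻¹) x + ((ρ x : ℂ) - w 2) * (0 : C(X, ℂ)) x +
                  ((ρ x : ℂ) * (starRingEnd ℂ) (x:ℂ) - w 3) * (0 : C(X, ℂ)) x))‖ ≤ 1/2
              rw [e4, norm_mul, norm_inv, inv_mul_le_iff₀ hηp]
              refine (norm_sub_le _ _).trans ?_
              rw [norm_neg, norm_mul]
              have e5 : ‖(x:ℂ) - w 0‖ * ‖sx - P x‖ ≤ D * (‖η‖/(4*D)) := by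
                gcongr
                exact hD x hx
              have e6 : D * (‖η‖/(4*D)) = ‖η‖/4 := by field_simp
              linarith
          · refine hfinish ![0, 0, 0, algebraMap ℂ _ (-(w 3)⁻¹)] ?_ ?_
            · intro i
              fin_cases i
              · exact B.zero_mem
              · exact B.zero_mem
              · exact B.zero_mem
              · exact B.algebraMap_mem _
            · intro x hx
              rw [hsum, hρK _ hx]
              simp [h33]
        · refine hfinish ![0, 0, algebraMap ℂ _ (-(w 2)⁻¹), 0] ?_ ?_
          · intro i
            fin_cases i
            · exact B.zero_mem
            · exact B.zero_mem
            · exact B.algebraMap_mem _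
            · exact B.zero_mem
          · intro x hx
            rw [hsum, hρK _ hx]
            simp [h2]
      · obtain ⟨h, hhs, -, hhv⟩ := pole_fun K hKc (w 0) haK
        let H : C(X, ℂ) := ⟨fun x => h x, hhs.continuous.comp continuous_subtype_val⟩
        have hH : H ∈ B := by
          apply h3
          apply subset_closure
          refine ⟨1, Polynomial.X - Polynomial.C (w 0), fun z hz => ?_, fun z => ?_⟩
          · simp only [Polynomial.eval_sub, Polynomial.eval_X, Polynomial.eval_C]
            exact sub_ne_zero.2 (fun e => haK (e ▸ hz))
          · have : res H z = h z := rfl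
            rw [this, hhv z z.2]
            simp
        refine hfinish ![H, 0, 0, 0] ?_ ?_
        · intro i
          fin_cases i
          · exact hH
          · exact B.zero_mem
          · exact B.zero_mem
          · exact B.zero_mem
        · intro x hx
          rw [hsum]
          have e : (x:ℂ) - w 0 ≠ 0 := sub_ne_zero.2 (fun e => haK (e ▸ hx))
          have e2 : H x = ((x:ℂ) - w 0)⁻¹ := hhv x hx
          simp [e2, e]
    · intro w hw p
      have hcont : Continuous fun z : ℂ => (Fin.cons z (fun j => f j z) : Fin 4 → ℂ) := by
        refine continuous_pi fun i => ?_
        refine Fin.cases ?_ (fun j => ?_) i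
        · exact continuous_id
        · exact (hf j).continuous
      have hcomp : IsCompact (graphF f X) := hXc.image hcont
      refine le_csSup (hcomp.image (f := fun w => ‖MvPolynomial.eval w p‖) ?_).bddAbove
        ⟨w, hw, rfl⟩
      exact (MvPolynomial.continuous_eval p).norm
  · intro S hS hSne
    obtain ⟨x, hxS, hxK⟩ := hΩd S hS hSne
    have hcl : IsClosed (S ∪ Subtype.val ⁻¹' K) :=
      hS.union (hKc.isClosed.preimage continuous_subtype_val)
    obtain ⟨φ, h0, h1, h01⟩ := exists_continuous_zero_one_of_isClosed hcl
      (isClosed_singleton (x := x)) (by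
        rw [Set.disjoint_singleton_right]
        rintro (h | h)
        · exact hxS h
        · exact hxK h)
    let F : C(X, ℂ) := ⟨fun y => (φ y : ℂ), by fun_prop⟩
    refine ⟨F, hideal F fun y hy => ?_, ?_⟩
    · have : φ y = 0 := h0 (Or.inr hy)
      show (φ y : ℂ) = 0
      rw [this]; simp
    · have a1 : sSup ((fun w => ‖F w‖) '' S) ≤ 0 := by
        apply Real.sSup_le _ le_rfl
        rintro _ ⟨y, hy, rfl⟩
        have : φ y = 0 := h0 (Or.inl hy)
        show ‖(φ y : ℂ)‖ ≤ 0
        rw [this]; simp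
      have a2 : 1 ≤ sSup ((fun w => ‖F w‖) '' Set.univ) := by
        refine le_csSup ?_ ⟨x, trivial, ?_⟩
        · exact (isCompact_univ.image (by fun_prop)).bddAbove
        · have : φ x = 1 := h1 rfl
          show ‖(φ x : ℂ)‖ = 1
          rw [this]; simp
      linarith
  · intro htop
    let cj : C(X, ℂ) := star (G 0)
    have hcj : cj ∈ (B : Set C(X, ℂ)) := by rw [htop]; trivial
    have hle : A ≤ (ratSub K).topologicalClosure.comap res := by
      rw [Algebra.adjoin_le_iff]
      rintro y (hy | ⟨j, hy⟩)
      · apply subset_closure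
        refine ⟨Polynomial.X, 1, by simp, fun z => ?_⟩
        have : res y z = y (ι z) := rfl
        refine this.trans ?_
        rw [hy]; simp [ι]
      · have hz : ∀ z : K, res y z = f j z := fun z => hy (ι z)
        have hzero : (∀ z : K, res y z = 0) → y ∈ (ratSub K).topologicalClosure.comap res := by
          intro h
          have : res y = 0 := by ext z; exact h z
          show res y ∈ (ratSub K).topologicalClosure
          rw [this]; exact Subalgebra.zero_mem _
        fin_cases j
        · have : res y = ⟨fun z => g z, hg.continuous.comp continuous_subtype_val⟩ := by
            ext z; exact hz z
          show res y ∈ ratAlg K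
          rw [this]; exact hg1
        · apply hzero
          intro z
          rw [hz]
          show (ρ z : ℂ) = 0
          rw [(hρ0 z).2 z.2]; simp
        · apply hzero
          intro z
          rw [hz]
          show (ρ z : ℂ) * (starRingEnd ℂ) (z:ℂ) = 0
          rw [(hρ0 z).2 z.2]; simp
    have hcl : closure (A : Set C(X, ℂ)) ⊆ res ⁻¹' (ratAlg K) :=
      closure_minimal hle (isClosed_closure.preimage hresc)
    exact hKr (res cj) (fun z => rfl) (hcl hcj)
end

section
/- Let K ⊆ ℂ^n be a compact set, let P : ℂ^n → ℂ^k be a polynomial map, and let F = P|_K. Assume that [w_1,…,w_k]_{F(K)} = C(F(K),ℂ), where w_1,…,w_k are the coordinate functions on ℂ^k. Then K̂ = ⋃_{w ∈ ℂ^k} (K ∩ P^{-1}(w))^̂. -/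
/-- Generators of the algebra `[w₁,…,w_k]_M`: the coordinate functions. -/
def coordGens {k : ℕ} (M : Set (Fin k → ℂ)) : Set C(M, ℂ) :=
  {g | ∃ i : Fin k, ∀ z : M, g z = (z : Fin k → ℂ) i}

theorem aux_alg {n k : ℕ} (K : Set (Fin n → ℂ))
    (p : Fin k → MvPolynomial (Fin n) ℂ) (P : (Fin n → ℂ) → (Fin k → ℂ))
    (hP : ∀ z i, P z i = MvPolynomial.eval z (p i))
    (a : C(P '' K, ℂ)) (ha : a ∈ Algebra.adjoin ℂ (coordGens (P '' K))) :
    ∃ q : MvPolynomial (Fin n) ℂ, ∀ x (hx : x ∈ K),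
      a ⟨P x, Set.mem_image_of_mem P hx⟩ = MvPolynomial.eval x q := by
  induction ha using Algebra.adjoin_induction with
  | mem a h =>
    obtain ⟨i, hi⟩ := h
    exact ⟨p i, fun x hx => by rw [hi, ← hP]⟩
  | algebraMap r => exact ⟨MvPolynomial.C r, fun x hx => by simp⟩
  | add a b _ _ h1 h2 =>
    obtain ⟨q1, h1⟩ := h1
    obtain ⟨q2, h2⟩ := h2
    exact ⟨q1 + q2, fun x hx => by simp [h1 x hx, h2 x hx]⟩
  | mul a b _ _ h1 h2 =>
    obtain ⟨q1, h1⟩ := h1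
    obtain ⟨q2, h2⟩ := h2
    exact ⟨q1 * q2, fun x hx => by simp [h1 x hx, h2 x hx]⟩

theorem aux_cont {n : ℕ} (f : MvPolynomial (Fin n) ℂ) :
    Continuous fun x : Fin n → ℂ => MvPolynomial.eval x f := MvPolynomial.continuous_eval f

theorem aux_bdd {n : ℕ} (K : Set (Fin n → ℂ)) (hK : IsCompact K) (f : MvPolynomial (Fin n) ℂ) :
    BddAbove ((fun w => ‖MvPolynomial.eval w f‖) '' K) :=
  (hK.image (aux_cont f).norm).bddAbove

theorem aux_approx {n k : ℕ} (K : Set (Fin n → ℂ)) (hK : IsCompact K)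
    (p : Fin k → MvPolynomial (Fin n) ℂ) (P : (Fin n → ℂ) → (Fin k → ℂ))
    (hP : ∀ z i, P z i = MvPolynomial.eval z (p i))
    (hCF : genAlg (coordGens (P '' K)) = Set.univ) (z : Fin n → ℂ)
    (g : Fin k → (Fin k → ℂ) → ℂ) (hg : ∀ i, Continuous (g i)) (ε : ℝ) (hε : 0 < ε) :
    ∃ Q : MvPolynomial (Fin n) ℂ, MvPolynomial.eval z Q = 1 ∧ ∀ x ∈ K,
      ‖MvPolynomial.eval x Q - (1 - ∑ i, (P x i - P z i) * g i (P x))‖ ≤ ε := by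
  have hPc : Continuous P := continuous_pi fun i => by
    simp only [hP]; exact aux_cont _
  haveI : CompactSpace (P '' K) := isCompact_iff_compactSpace.mp (hK.image hPc)
  obtain ⟨B, hB⟩ := (hK.image (f := fun x => ∑ i, ‖P x i - P z i‖) (by fun_prop)).bddAbove
  have hB' : ∀ x ∈ K, ∑ i, ‖P x i - P z i‖ ≤ |B| + 1 := fun x hx =>
    (hB (Set.mem_image_of_mem _ hx)).trans (by linarith [le_abs_self B])
  have hB0 : 0 < |B| + 1 := by positivity
  have key : ∀ i, ∃ q : MvPolynomial (Fin n) ℂ, ∀ x ∈ K,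
      ‖g i (P x) - MvPolynomial.eval x q‖ ≤ ε / (|B| + 1) := by
    intro i
    let G : C(P '' K, ℂ) := ⟨fun w => g i w, (hg i).comp continuous_subtype_val⟩
    have hG : G ∈ genAlg (coordGens (P '' K)) := by rw [hCF]; trivial
    obtain ⟨a, ha, hd⟩ := Metric.mem_closure_iff.mp hG (ε / (|B| + 1)) (by positivity)
    obtain ⟨q, hq⟩ := aux_alg K p P hP a ha
    refine ⟨q, fun x hx => ?_⟩
    rw [← hq x hx, ← dist_eq_norm]
    exact (ContinuousMap.dist_apply_le_dist (f := G) (g := a) ⟨P x, Set.mem_image_of_mem P hx⟩).trans hd.le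
  choose q hq using key
  refine ⟨1 - ∑ i, (p i - MvPolynomial.C (P z i)) * q i, by simp [← hP], fun x hx => ?_⟩
  have e : MvPolynomial.eval x (1 - ∑ i, (p i - MvPolynomial.C (P z i)) * q i)
      - (1 - ∑ i, (P x i - P z i) * g i (P x))
      = ∑ i, (P x i - P z i) * (g i (P x) - MvPolynomial.eval x (q i)) := by
    simp [← hP, mul_sub, Finset.sum_sub_distrib]
  rw [e]
  calc _ ≤ ∑ i, ‖P x i - P z i‖ * (ε / (|B| + 1)) := by
        refine (norm_sum_le _ _).trans (Finset.sum_le_sum fun i _ => ?_)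
        rw [norm_mul]
        exact mul_le_mul_of_nonneg_left (hq i x hx) (norm_nonneg _)
    _ = (∑ i, ‖P x i - P z i‖) * (ε / (|B| + 1)) := by rw [Finset.sum_mul]
    _ ≤ (|B| + 1) * (ε / (|B| + 1)) := mul_le_mul_of_nonneg_right (hB' x hx) (by positivity)
    _ = ε := by field_simp

theorem stmt8 {n k : ℕ} (K : Set (Fin n → ℂ)) (hK : IsCompact K)
    (p : Fin k → MvPolynomial (Fin n) ℂ) (P : (Fin n → ℂ) → (Fin k → ℂ))
    (hP : ∀ z i, P z i = MvPolynomial.eval z (p i))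
    (hCF : genAlg (coordGens (P '' K)) = Set.univ) :
    polyHull K = ⋃ w : Fin k → ℂ, polyHull (K ∩ P ⁻¹' {w}) := by
  have hPc : Continuous P := continuous_pi fun i => by
    simp only [hP]; exact aux_cont _
  apply Set.Subset.antisymm
  · intro z hz
    refine Set.mem_iUnion.mpr ⟨P z, fun f => ?_⟩
    set s := sSup ((fun w => ‖MvPolynomial.eval w f‖) '' (K ∩ P ⁻¹' {P z})) with hs
    have hs0 : 0 ≤ s := Real.sSup_nonneg (by rintro _ ⟨x, _, rfl⟩; exact norm_nonneg _)
    have hsx : ∀ x ∈ K, P x = P z → ‖MvPolynomial.eval x f‖ ≤ s := fun x hx h =>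
      le_csSup ((aux_bdd K hK f).mono (Set.image_mono Set.inter_subset_left)) ⟨x, ⟨hx, h⟩, rfl⟩
    obtain ⟨M0, hM0⟩ := aux_bdd K hK f
    obtain ⟨M, hM, hMx⟩ : ∃ M : ℝ, 0 < M ∧ ∀ x ∈ K, ‖MvPolynomial.eval x f‖ ≤ M :=
      ⟨|M0| + 1, by positivity, fun x hx =>
        (hM0 (Set.mem_image_of_mem _ hx)).trans (by linarith [le_abs_self M0])⟩
    suffices h : ∀ ε > 0, ‖MvPolynomial.eval z f‖ ≤ s + (ε + ε) by
      refine le_of_forall_pos_le_add fun ε hε => ?_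
      have := h (ε / 2) (by positivity)
      linarith
    intro ε hε
    let D : (Fin k → ℂ) → ℝ := fun w => ∑ i, ‖w i - P z i‖ ^ 2
    have hD0 : ∀ w, 0 ≤ D w := fun w => by positivity
    have hDc : Continuous D := by fun_prop
    have hT : IsCompact (K ∩ {x | s + ε ≤ ‖MvPolynomial.eval x f‖}) :=
      hK.inter_right (isClosed_le continuous_const (aux_cont f).norm)
    obtain ⟨η, hη, hηx⟩ := hT.exists_forall_le' (f := fun x => D (P x)) (a := 0)
      (hDc.comp hPc).continuousOn (by
        rintro x ⟨hx, hxs⟩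
        refine (hD0 _).lt_of_ne fun h0 => ?_
        have h1 := (Finset.sum_eq_zero_iff_of_nonneg (fun i _ => by positivity)).mp h0.symm
        have : P x = P z := by
          ext i
          have := h1 i (Finset.mem_univ i)
          simpa [sub_eq_zero] using this
        have := hsx x hx this
        simp only [Set.mem_setOf_eq] at hxs
        linarith)
    have hδ : 0 < η * ε / M := by positivity
    set δ := η * ε / M with hδd
    have hne : ∀ w, ((D w + δ : ℝ) : ℂ) ≠ 0 := fun w => by
      have := hD0 w
      exact_mod_cast (by positivity : D w + δ ≠ 0)
    obtain ⟨Q, hQz, hQ⟩ := aux_approx K hK p P hP hCF z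
      (fun i w => (starRingEnd ℂ) (w i - P z i) / ((D w + δ : ℝ) : ℂ))
      (fun i => by
        refine Continuous.div ?_ ?_ hne
        · exact Complex.continuous_conj.comp (by fun_prop)
        · exact Complex.continuous_ofReal.comp (by fun_prop)) (ε / M) (by positivity)
    have hh : ∀ w : Fin k → ℂ, (1 - ∑ i, (w i - P z i) *
        ((starRingEnd ℂ) (w i - P z i) / ((D w + δ : ℝ) : ℂ))) = ((δ / (D w + δ) : ℝ) : ℂ) := by
      intro w
      have : ∑ i, (w i - P z i) * ((starRingEnd ℂ) (w i - P z i) / ((D w + δ : ℝ) : ℂ))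
          = ((D w : ℝ) : ℂ) / ((D w + δ : ℝ) : ℂ) := by
        simp only [← mul_div_assoc, ← Finset.sum_div, Complex.mul_conj', D]
        push_cast
        rfl
      rw [this, Complex.ofReal_div, eq_div_iff (hne w), sub_mul, div_mul_cancel₀ _ (hne w)]
      push_cast
      ring
    have hQb : ∀ x ∈ K, ‖MvPolynomial.eval x Q‖ ≤ δ / (D (P x) + δ) + ε / M := by
      intro x hx
      have h1 := hQ x hx
      rw [hh (P x)] at h1
      have h2 := norm_le_norm_add_norm_sub' (MvPolynomial.eval x Q) ((δ / (D (P x) + δ) : ℝ) : ℂ)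
      have h3 : 0 ≤ δ / (D (P x) + δ) := by have := hD0 (P x); positivity
      rw [Complex.norm_real, Real.norm_of_nonneg h3] at h2
      linarith
    have hfin := hz (f * Q)
    rw [map_mul, hQz, mul_one] at hfin
    refine hfin.trans (Real.sSup_le ?_ (by positivity))
    rintro _ ⟨x, hx, rfl⟩
    simp only [map_mul, norm_mul]
    have hDx := hD0 (P x)
    have hMe : ‖MvPolynomial.eval x f‖ * (ε / M) ≤ ε := by
      calc _ ≤ M * (ε / M) := mul_le_mul_of_nonneg_right (hMx x hx) (by positivity)
        _ = ε := by field_simp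
    have hstep := mul_le_mul_of_nonneg_left (hQb x hx) (norm_nonneg (MvPolynomial.eval x f))
    rw [mul_add] at hstep
    suffices ‖MvPolynomial.eval x f‖ * (δ / (D (P x) + δ)) ≤ s + ε by linarith
    by_cases hc : s + ε ≤ ‖MvPolynomial.eval x f‖
    · have h1 : η ≤ D (P x) := hηx x ⟨hx, hc⟩
      calc _ ≤ M * (δ / η) := by
            refine mul_le_mul (hMx x hx) ?_ (by positivity) hM.le
            exact div_le_div_of_nonneg_left hδ.le hη (by linarith)
        _ = ε := by rw [hδd]; field_simp
        _ ≤ s + ε := by linarith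
    · have h1 : δ / (D (P x) + δ) ≤ 1 := by
        rw [div_le_one (by positivity)]; linarith
      exact (mul_le_of_le_one_right (norm_nonneg _) h1).trans (not_le.mp hc).le
  · refine Set.iUnion_subset fun w z hz f => ?_
    rcases (K ∩ P ⁻¹' {w}).eq_empty_or_nonempty with h | h
    · have := hz 1
      rw [h] at this
      simp at this
      linarith
    · exact (hz f).trans (csSup_le_csSup (aux_bdd K hK f) (h.image _)
        (Set.image_mono Set.inter_subset_left))
end

section
/- There exists a closed subset X of the torus Γ such that: (i) X̂ \ X is nonempty and contains no analytic disk; and (ii) Γ \ X is the union of two disjoint open subsets U and V of Γ, and for each of U and V there exists c ∈ ℂ with |c| = 1 (depending on the set) such that the set is disjoint from the circle {(z_1,z_2) ∈ Γ : z_1 = c}. -/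
open Metric

def NoAnalyticDisk {m : ℕ} (S : Set (Fin m → ℂ)) : Prop :=
  ∀ φ : ℂ → (Fin m → ℂ), DifferentiableOn ℂ φ (ball (0:ℂ) 1) →
    (∀ z ∈ ball (0:ℂ) 1, φ z ∈ S) →
    ∀ z ∈ ball (0:ℂ) 1, ∀ w ∈ ball (0:ℂ) 1, φ z = φ w

/-- The unit torus, the distinguished boundary of the bidisk. -/
def Torus : Set (Fin 2 → ℂ) := {z | ‖z 0‖ = 1 ∧ ‖z 1‖ = 1}


namespace HullTorus

open MvPolynomial Filter Topology

noncomputable def ev (z x : ℂ) (P : MvPolynomial (Fin 2) ℂ) : ℂ := MvPolynomial.eval ![z, x] P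

lemma ev_cont (P : MvPolynomial (Fin 2) ℂ) : Continuous (fun t : ℂ × ℂ => ev t.1 t.2 P) := by
  unfold ev
  apply (MvPolynomial.continuous_eval P).comp
  refine continuous_pi fun i => ?_
  fin_cases i
  · exact continuous_fst
  · exact continuous_snd

noncomputable def qq (a z : ℂ) : ℂ := (z - a) * (1 - (starRingEnd ℂ) a * z)

lemma split_AB (a e : ℂ) (P : MvPolynomial (Fin 2) ℂ) :
    ∃ A B : MvPolynomial (Fin 2) ℂ, ∀ z x y : ℂ, y ^ 2 = qq a z →
      ev z (x + e * y) P = ev z x A + y * ev z x B := by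
  induction P using MvPolynomial.induction_on with
  | C c => exact ⟨C c, 0, fun z x y _ => by simp [ev]⟩
  | add p q hp hq =>
    obtain ⟨A, B, h⟩ := hp
    obtain ⟨A', B', h'⟩ := hq
    refine ⟨A + A', B + B', fun z x y hy => ?_⟩
    have h1 := h z x y hy
    have h2 := h' z x y hy
    simp only [ev, map_add] at h1 h2 ⊢
    rw [h1, h2]; ring
  | mul_X p i hp =>
    obtain ⟨A, B, h⟩ := hp
    fin_cases i
    · refine ⟨A * X 0, B * X 0, fun z x y hy => ?_⟩
      have h1 := h z x y hy
      simp only [ev, map_mul] at h1 ⊢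
      simp [h1]; ring
    · refine ⟨A * X 1 + C e * B * ((X 0 - C a) * (1 - C ((starRingEnd ℂ) a) * X 0)),
        B * X 1 + C e * A, fun z x y hy => ?_⟩
      have h1 := h z x y hy
      simp only [ev, map_mul, map_add] at h1 ⊢
      simp [h1]
      simp only [qq] at hy
      linear_combination (e * (eval ![z, x]) B) * hy

/-- product of two shifts -/
lemma exists_next (a e : ℂ) (P : MvPolynomial (Fin 2) ℂ) :
    ∃ Q : MvPolynomial (Fin 2) ℂ, ∀ z x y : ℂ, y ^ 2 = qq a z →
      ev z x Q = ev z (x + e * y) P * ev z (x - e * y) P := by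
  obtain ⟨A, B, h⟩ := split_AB a e P
  refine ⟨A ^ 2 - ((X 0 - C a) * (1 - C ((starRingEnd ℂ) a) * X 0)) * B ^ 2, fun z x y hy => ?_⟩
  have h2 := h z x (-y) (by rw [neg_sq, hy])
  rw [show x + e * -y = x - e * y by ring] at h2
  rw [h z x y hy, h2]
  simp only [qq] at hy
  simp [ev]
  linear_combination ((eval ![z, x]) B ^ 2) * hy

/-- homogenization -/
lemma exists_hom (P : MvPolynomial (Fin 2) ℂ) :
    ∃ (d : ℕ) (Q : MvPolynomial (Fin 2) ℂ), ∀ z w x : ℂ, z - w = x * (1 - w) →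
      ev z w Q = (1 - w) ^ d * ev z x P := by
  induction P using MvPolynomial.induction_on with
  | C c => exact ⟨0, C c, fun z w x _ => by simp [ev]⟩
  | add p q hp hq =>
    obtain ⟨d, A, h⟩ := hp
    obtain ⟨d', A', h'⟩ := hq
    refine ⟨d + d', A * (1 - X 1) ^ d' + A' * (1 - X 1) ^ d, fun z w x hx => ?_⟩
    have h1 := h z w x hx
    have h2 := h' z w x hx
    simp only [ev, map_add, map_mul] at h1 h2 ⊢
    rw [h1, h2]; simp; ring
  | mul_X p i hp =>
    obtain ⟨d, A, h⟩ := hp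
    fin_cases i
    · refine ⟨d, A * X 0, fun z w x hx => ?_⟩
      have h1 := h z w x hx
      simp only [ev, map_mul] at h1 ⊢
      simp [h1]; ring
    · refine ⟨d + 1, A * (X 0 - X 1), fun z w x hx => ?_⟩
      have h1 := h z w x hx
      simp only [ev, map_mul] at h1 ⊢
      simp [h1]
      rw [hx]; ring

lemma exists_sqrt (c : ℂ) : ∃ y : ℂ, y ^ 2 = c := by
  obtain ⟨y, hy⟩ := IsAlgClosed.exists_pow_nat_eq c (n := 2) (by norm_num)
  exact ⟨y, hy⟩

lemma pow_bound {r m C : ℝ} (hm : 0 ≤ m) (h : ∀ k : ℕ, r ^ k ≤ C * m ^ k) : r ≤ m := by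
  by_contra hlt
  push Not at hlt
  rcases hm.eq_or_lt with rfl | hm
  · have := h 1; simp at this; linarith
  have h1 : 1 < r / m := by rw [lt_div_iff₀ hm]; linarith
  obtain ⟨k, hk⟩ := pow_unbounded_of_one_lt C h1
  have := h k
  rw [div_pow, lt_div_iff₀ (by positivity)] at hk
  linarith

lemma max_zero (F : MvPolynomial (Fin 2) ℂ) (m : ℝ)
    (h : ∀ z : ℂ, ‖z‖ = 1 → ‖ev z 0 F‖ ≤ m) (z : ℂ) (hz : ‖z‖ ≤ 1) : ‖ev z 0 F‖ ≤ m := by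
  have hd : Differentiable ℂ (fun z => ev z 0 F) := by
    clear h
    unfold ev
    induction F using MvPolynomial.induction_on with
    | C c => simp
    | add p q hp hq => 
      simp only [map_add]
      exact hp.add hq
    | mul_X p i hp =>
      simp only [map_mul]
      refine hp.mul ?_
      fin_cases i
      · simp
      · simp
  refine Complex.norm_le_of_forall_mem_frontier_norm_le (U := ball (0:ℂ) 1) isBounded_ball
    hd.diffContOnCl ?_ ?_
  · intro w hw
    rw [frontier_ball _ one_ne_zero] at hw
    exact h w (by simpa using hw)
  · rw [closure_ball _ one_ne_zero]; simpa using hz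

lemma max_fin (a : ℕ → ℂ) (e : ℕ → ℂ) (n : ℕ) : ∀ (F : MvPolynomial (Fin 2) ℂ) (m : ℝ),
    (∀ (z : ℂ) (y : ℕ → ℂ), ‖z‖ = 1 → (∀ j, y j ^ 2 = qq (a j) z) →
      ‖ev z (∑ j ∈ Finset.range n, e j * y j) F‖ ≤ m) →
    ∀ (z : ℂ) (y : ℕ → ℂ), ‖z‖ ≤ 1 → (∀ j, y j ^ 2 = qq (a j) z) →
      ‖ev z (∑ j ∈ Finset.range n, e j * y j) F‖ ≤ m := by
  induction n with
  | zero =>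
    intro F m h z y hz hy
    simp only [Finset.range_zero, Finset.sum_empty] at h ⊢
    refine max_zero F m (fun z hz => ?_) z hz
    choose y hy using fun j => exists_sqrt (qq (a j) z)
    exact h z y hz hy
  | succ n ih =>
    intro F m h z y hz hy
    have hm : 0 ≤ m := by
      choose y hy using fun j => exists_sqrt (qq (a j) 1)
      exact (norm_nonneg _).trans (h 1 y (by simp) hy)
    refine pow_bound (C := 2) hm fun k => ?_
    obtain ⟨A, B, hAB⟩ := split_AB (a n) (e n) (F ^ k)
    have key : ∀ (z : ℂ) (y : ℕ → ℂ), ‖z‖ = 1 → (∀ j, y j ^ 2 = qq (a j) z) →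
        ‖ev z (∑ j ∈ Finset.range n, e j * y j) A‖ ≤ m ^ k ∧
        ‖y n * ev z (∑ j ∈ Finset.range n, e j * y j) B‖ ≤ m ^ k := by
      intro z y hz hy
      set x := ∑ j ∈ Finset.range n, e j * y j with hx
      have h1 := hAB z x (y n) (hy n)
      have h2 := hAB z x (-y n) (by rw [neg_sq, hy n])
      have b1 : ‖ev z (x + e n * y n) (F ^ k)‖ ≤ m ^ k := by
        have := h z y hz hy
        rw [Finset.sum_range_succ] at this
        simp only [ev, map_pow, norm_pow] at this ⊢
        gcongr
      have b2 : ‖ev z (x + e n * -y n) (F ^ k)‖ ≤ m ^ k := by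
        have := h z (Function.update y n (-y n)) hz (fun j => by
          by_cases hj : j = n
          · subst hj; simp [hy j]
          · simp [hj, hy j])
        rw [Finset.sum_range_succ, Function.update_self] at this
        rw [Finset.sum_congr rfl (g := fun j => e j * y j) (fun j hj => by
          rw [Function.update_of_ne (by simp at hj; omega)])] at this
        simp only [ev, map_pow, norm_pow] at this ⊢
        gcongr
      constructor
      · have : ev z x A = (ev z (x + e n * y n) (F ^ k) + ev z (x + e n * -y n) (F ^ k)) / 2 := by
          rw [h1, h2]; ring
        rw [this, norm_div]
        have := norm_add_le (ev z (x + e n * y n) (F ^ k)) (ev z (x + e n * -y n) (F ^ k))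
        rw [Complex.norm_ofNat]; linarith
      · have : y n * ev z x B = (ev z (x + e n * y n) (F ^ k) - ev z (x + e n * -y n) (F ^ k)) / 2 := by
          rw [h1, h2]; ring
        rw [this, norm_div]
        have := norm_sub_le (ev z (x + e n * y n) (F ^ k)) (ev z (x + e n * -y n) (F ^ k))
        rw [Complex.norm_ofNat]; linarith
    have kA := ih A (m ^ k) (fun z y hz hy => (key z y hz hy).1) z y hz hy
    have kB := ih (((X 0 - C (a n)) * (1 - C ((starRingEnd ℂ) (a n)) * X 0)) * B ^ 2) ((m ^ k) ^ 2)
      (fun z y hz hy => by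
        have := (key z y hz hy).2
        have h3 : ev z (∑ j ∈ Finset.range n, e j * y j)
            (((X 0 - C (a n)) * (1 - C ((starRingEnd ℂ) (a n)) * X 0)) * B ^ 2)
            = (y n * ev z (∑ j ∈ Finset.range n, e j * y j) B) ^ 2 := by
          rw [mul_pow, hy n]; simp [ev, qq]
        rw [h3, norm_pow]; gcongr) z y hz hy
    have h3 : ev z (∑ j ∈ Finset.range n, e j * y j)
            (((X 0 - C (a n)) * (1 - C ((starRingEnd ℂ) (a n)) * X 0)) * B ^ 2)
            = (y n * ev z (∑ j ∈ Finset.range n, e j * y j) B) ^ 2 := by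
          rw [mul_pow, hy n]; simp [ev, qq]
    rw [h3, norm_pow] at kB
    have kB' := (pow_le_pow_iff_left₀ (norm_nonneg _) (pow_nonneg hm k) two_ne_zero).1 kB
    have h1 := hAB z (∑ j ∈ Finset.range n, e j * y j) (y n) (hy n)
    rw [Finset.sum_range_succ]
    have h4 : ‖ev z (∑ j ∈ Finset.range n, e j * y j + e n * y n) F‖ ^ k
      = ‖ev z (∑ j ∈ Finset.range n, e j * y j + e n * y n) (F ^ k)‖ := by simp [ev]
    rw [h4, h1]
    refine (norm_add_le _ _).trans ?_
    linarith

end HullTorus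

namespace HullTorus

open MvPolynomial Filter Topology

lemma sqrt_near (a b : ℂ) (hb : qq a b ≠ 0) : ∃ L : ℝ, 0 ≤ L ∧ ∀ z : ℂ, ‖z - b‖ ≤ 1 → ∀ y : ℂ,
    y ^ 2 = qq a z → ∃ y0 : ℂ, y0 ^ 2 = qq a b ∧ ‖y - y0‖ ≤ L * ‖z - b‖ := by
  obtain ⟨r, hr⟩ := exists_sqrt (qq a b)
  have hr0 : r ≠ 0 := by rintro rfl; apply hb; rw [← hr]; simp
  have hr1 : 0 < ‖r‖ := norm_pos_iff.2 hr0
  set M : ℝ := 1 + ‖a‖ * ‖a‖ + ‖a‖ * (1 + 2 * ‖b‖) with hM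
  have hM0 : 0 ≤ M := by positivity
  refine ⟨M / ‖r‖, by positivity, fun z hz y hy => ?_⟩
  have hd : ‖qq a z - qq a b‖ ≤ M * ‖z - b‖ := by
    have : qq a z - qq a b = (1 + a * (starRingEnd ℂ) a - (starRingEnd ℂ) a * ((z - b) + 2 * b)) * (z - b) := by
      simp only [qq]; ring
    rw [this, norm_mul]
    gcongr
    refine (norm_sub_le _ _).trans ?_
    have h1 := norm_add_le 1 (a * (starRingEnd ℂ) a)
    have h2 := norm_add_le (z - b) (2 * b)
    simp only [norm_mul, RCLike.norm_conj, norm_one, Complex.norm_ofNat] at h1 h2 ⊢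
    have h3 : ‖a‖ * ‖z - b + 2 * b‖ ≤ ‖a‖ * (1 + 2 * ‖b‖) := by
      gcongr; linarith
    rw [hM]; linarith
  have key : ∀ r : ℂ, r ^ 2 = qq a b → 0 < ‖r‖ → ‖r‖ ≤ ‖y + r‖ → ‖y - r‖ ≤ M / ‖r‖ * ‖z - b‖ := by
    intro r hr hr1 h
    have : ‖y - r‖ * ‖y + r‖ ≤ M * ‖z - b‖ := by
      rw [← norm_mul, show (y - r) * (y + r) = qq a z - qq a b by rw [← hy, ← hr]; ring]
      exact hd
    rw [div_mul_eq_mul_div, le_div_iff₀ hr1]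
    calc ‖y - r‖ * ‖r‖ ≤ ‖y - r‖ * ‖y + r‖ := by gcongr
      _ ≤ _ := this
  by_cases h : ‖r‖ ≤ ‖y + r‖
  · exact ⟨r, hr, key r hr hr1 h⟩
  · refine ⟨-r, by rw [neg_sq, hr], ?_⟩
    have := key (-r) (by rw [neg_sq, hr]) (by simpa using hr1) (by
      rw [norm_neg]
      push Not at h
      have h1 : ‖(2:ℂ) * r‖ ≤ ‖y + r‖ + ‖y + -r‖ := by
        rw [show (2:ℂ) * r = (y + r) - (y + -r) by ring]; exact norm_sub_le _ _
      rw [norm_mul, Complex.norm_ofNat] at h1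
      linarith)
    simpa using this

lemma roots_near (a e : ℕ → ℂ) (n : ℕ) (b : ℂ) (hb : ∀ j < n, qq (a j) b ≠ 0) :
    ∃ L : ℝ, 0 ≤ L ∧ ∀ z : ℂ, ‖z - b‖ ≤ 1 → ∀ y : ℕ → ℂ, (∀ j, y j ^ 2 = qq (a j) z) →
      ∃ y0 : ℕ → ℂ, (∀ j, y0 j ^ 2 = qq (a j) b) ∧
        ‖∑ j ∈ Finset.range n, e j * y j - ∑ j ∈ Finset.range n, e j * y0 j‖ ≤ L * ‖z - b‖ := by
  have H : ∀ j, ∃ L : ℝ, 0 ≤ L ∧ ∀ z : ℂ, ‖z - b‖ ≤ 1 → ∀ y : ℂ,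
    y ^ 2 = qq (a j) z → ∃ y0 : ℂ, y0 ^ 2 = qq (a j) b ∧ (j < n → ‖y - y0‖ ≤ L * ‖z - b‖) := by
    intro j
    by_cases hj : j < n
    · obtain ⟨L, hL, h⟩ := sqrt_near (a j) b (hb j hj)
      refine ⟨L, hL, fun z hz y hy => ?_⟩
      obtain ⟨y0, h1, h2⟩ := h z hz y hy
      exact ⟨y0, h1, fun _ => h2⟩
    · refine ⟨0, le_rfl, fun z hz y hy => ?_⟩
      obtain ⟨y0, h⟩ := exists_sqrt (qq (a j) b)
      exact ⟨y0, h, fun h => absurd h hj⟩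
  choose L hL H using H
  refine ⟨∑ j ∈ Finset.range n, ‖e j‖ * L j, Finset.sum_nonneg fun j _ => mul_nonneg (norm_nonneg _) (hL j), fun z hz y hy => ?_⟩
  choose y0 h1 h2 using fun j => H j z hz (y j) (hy j)
  refine ⟨y0, h1, ?_⟩
  rw [← Finset.sum_sub_distrib, Finset.sum_mul]
  refine norm_sum_le_of_le _ fun j hj => ?_
  rw [← mul_sub, norm_mul, mul_assoc]
  gcongr
  exact h2 j (by simpa using hj)

lemma roots_finite (a e : ℕ → ℂ) (n : ℕ) (z : ℂ) :
    {x : ℂ | ∃ y : ℕ → ℂ, (∀ j, y j ^ 2 = qq (a j) z) ∧ x = ∑ j ∈ Finset.range n, e j * y j}.Finite := by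
  induction n with
  | zero =>
    refine (Set.finite_singleton (0:ℂ)).subset ?_
    rintro x ⟨y, -, rfl⟩; simp
  | succ n ih =>
    obtain ⟨r, hr⟩ := exists_sqrt (qq (a n) z)
    refine (Set.Finite.image2 (fun x y => x + e n * y) ih (Set.toFinite {r, -r})).subset ?_
    rintro x ⟨y, hy, rfl⟩
    refine ⟨_, ⟨y, hy, rfl⟩, y n, ?_, ?_⟩
    · have := hy n
      rw [← hr, sq_eq_sq_iff_eq_or_eq_neg] at this
      exact this
    · simp [Finset.sum_range_succ]

lemma finite_gap {S : Set ℂ} (hS : S.Finite) :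
    ∃ γ : ℝ, 0 < γ ∧ ∀ x ∈ S, ∀ x' ∈ S, x ≠ x' → γ ≤ ‖x - x'‖ := by
  by_cases hne : S.offDiag.Nonempty
  · obtain ⟨p, hp, h⟩ := Set.exists_min_image S.offDiag (fun p => ‖p.1 - p.2‖) hS.offDiag hne
    refine ⟨‖p.1 - p.2‖, ?_, fun x hx x' hx' hxx => h (x, x') ⟨hx, hx', hxx⟩⟩
    exact norm_pos_iff.2 (sub_ne_zero.2 hp.2.2)
  · refine ⟨1, one_pos, fun x hx x' hx' hxx => absurd ⟨(x, x'), hx, hx', hxx⟩ hne⟩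

lemma small_tau (k L c γ E D : ℝ) (hk : 0 < k) (hc : 0 < c) (hγ : 0 < γ) (hD : 0 < D) :
    ∃ τ : ℝ, 0 < τ ∧ τ ^ 2 ≤ k ∧ τ ^ 2 ≤ D ∧ τ ^ 2 ≤ 1 ∧ L * τ < c ∧ E * τ + L * τ ^ 2 < γ := by
  have h : ∀ (f : ℝ → ℝ), Continuous f → ∀ u, f 0 < u → ∀ᶠ τ in 𝓝[>] (0:ℝ), f τ < u := by
    intro f hf u hu
    exact nhdsWithin_le_nhds ((hf.tendsto 0).eventually (gt_mem_nhds hu))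
  have h1 := h (fun τ => τ ^ 2) (by fun_prop) k (by simpa using hk)
  have h2 := h (fun τ => τ ^ 2) (by fun_prop) D (by simpa using hD)
  have h3 := h (fun τ => τ ^ 2) (by fun_prop) 1 (by simp)
  have h4 := h (fun τ => L * τ) (by fun_prop) c (by simpa using hc)
  have h5 := h (fun τ => E * τ + L * τ ^ 2) (by fun_prop) γ (by simpa using hγ)
  obtain ⟨τ, a1, a2, a3, a4, a5, a6⟩ := (h1.and (h2.and (h3.and (h4.and (h5.and self_mem_nhdsWithin))))).exists
  exact ⟨τ, a6, a1.le, a2.le, a3.le, a4, a5⟩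

lemma sep (a e : ℕ → ℂ) (n : ℕ) (ha : ‖a n‖ < 1) (hq : ∀ j < n, qq (a j) (a n) ≠ 0) (he : e n ≠ 0) :
    ∃ s : ℝ, 0 < s ∧ s ≤ 1 / (n + 1) ∧ ∀ y y' : ℕ → ℂ, (∀ j, y j ^ 2 = qq (a j) (a n)) →
      (∀ j, y' j ^ 2 = qq (a j) (a n + s)) →
      (n + 1) * s < ‖∑ j ∈ Finset.range (n+1), e j * y j - ∑ j ∈ Finset.range (n+1), e j * y' j‖ := by
  obtain ⟨L, hL, hroot⟩ := roots_near a e n (a n) hq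
  obtain ⟨γ, hγ, hgap⟩ := finite_gap (roots_finite a e n (a n))
  have he' : 0 < ‖e n‖ := norm_pos_iff.2 he
  have h1a : 0 < 1 - ‖a n‖ ^ 2 := by nlinarith [norm_nonneg (a n)]
  set c : ℝ := Real.sqrt ((1 - ‖a n‖ ^ 2) / 2) with hc
  have hc0 : 0 < c := Real.sqrt_pos.2 (by linarith)
  obtain ⟨τ, t0, t1, t2, t3, t4, t5⟩ := small_tau (1 / (n + 1)) (n + 1 + L) (‖e n‖ * c) γ (‖e n‖ * 2)
    ((1 - ‖a n‖ ^ 2) / 2) (by positivity) (by positivity) hγ (by linarith)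
  refine ⟨τ ^ 2, by positivity, t1, fun y y' hy hy' => ?_⟩
  obtain ⟨y0, hy0, hd⟩ := hroot (a n + (τ ^ 2 : ℝ)) (by
    rw [add_sub_cancel_left, Complex.norm_real, Real.norm_of_nonneg (by positivity)]; exact t3) y' hy'
  rw [add_sub_cancel_left, Complex.norm_real, Real.norm_of_nonneg (by positivity)] at hd
  have hyn : y n = 0 := by
    have := hy n
    simp only [qq, sub_self, zero_mul] at this
    exact pow_eq_zero_iff (two_ne_zero) |>.1 this
  have hqn : y' n ^ 2 = (τ ^ 2 : ℝ) * ((1 - ‖a n‖ ^ 2 : ℝ) - (starRingEnd ℂ) (a n) * (τ ^ 2 : ℝ)) := by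
    rw [hy' n]
    simp only [qq]
    have := Complex.mul_conj' (a n)
    push_cast
    rw [← this]; ring
  have hn2 : ‖y' n‖ ^ 2 = τ ^ 2 * ‖((1 - ‖a n‖ ^ 2 : ℝ) : ℂ) - (starRingEnd ℂ) (a n) * (τ ^ 2 : ℝ)‖ := by
    rw [← norm_pow, hqn, norm_mul, Complex.norm_real, Real.norm_of_nonneg (by positivity)]
  have hprod : ‖(starRingEnd ℂ) (a n) * (τ ^ 2 : ℝ)‖ ≤ τ ^ 2 := by
    rw [norm_mul, RCLike.norm_conj, Complex.norm_real, Real.norm_of_nonneg (by positivity)]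
    nlinarith [sq_nonneg τ]
  have hre : ‖((1 - ‖a n‖ ^ 2 : ℝ) : ℂ)‖ = 1 - ‖a n‖ ^ 2 := by
    rw [Complex.norm_real, Real.norm_of_nonneg h1a.le]
  have hlow : c * τ ≤ ‖y' n‖ := by
    refine (pow_le_pow_iff_left₀ (by positivity) (norm_nonneg _) two_ne_zero).1 ?_
    rw [hn2, mul_pow, hc, Real.sq_sqrt (by linarith), mul_comm]
    gcongr
    have := norm_sub_norm_le ((1 - ‖a n‖ ^ 2 : ℝ) : ℂ) ((starRingEnd ℂ) (a n) * (τ ^ 2 : ℝ))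
    linarith
  have hup : ‖y' n‖ ≤ 2 * τ := by
    refine (pow_le_pow_iff_left₀ (norm_nonneg _) (by positivity) two_ne_zero).1 ?_
    rw [hn2, mul_pow, mul_comm]
    gcongr
    have := norm_sub_le ((1 - ‖a n‖ ^ 2 : ℝ) : ℂ) ((starRingEnd ℂ) (a n) * (τ ^ 2 : ℝ))
    nlinarith [norm_nonneg (a n)]
  rw [Finset.sum_range_succ, Finset.sum_range_succ, hyn]
  set x := ∑ j ∈ Finset.range n, e j * y j with hx
  set x0 := ∑ j ∈ Finset.range n, e j * y0 j with hx0
  set x' := ∑ j ∈ Finset.range n, e j * y' j with hx'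
  by_cases hxx : x = x0
  · have h1 : ‖e n * y' n‖ ≤ ‖x + e n * 0 - (x' + e n * y' n)‖ + ‖x' - x0‖ := by
      rw [← norm_neg (e n * y' n)]
      rw [show -(e n * y' n) = (x + e n * 0 - (x' + e n * y' n)) + (x' - x0) by rw [hxx]; ring]
      exact norm_add_le _ _
    rw [norm_mul] at h1
    have h2 : ‖e n‖ * (c * τ) ≤ ‖e n‖ * ‖y' n‖ := by gcongr
    have h3 : (n + 1 + L) * τ * τ < ‖e n‖ * c * τ := by gcongr
    nlinarith
  · have h1 := hgap x ⟨y, hy, rfl⟩ x0 ⟨y0, hy0, rfl⟩ hxx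
    have h2 : ‖x - x0‖ ≤ ‖x + e n * 0 - (x' + e n * y' n)‖ + ‖x' - x0‖ + ‖e n * y' n‖ := by
      rw [show x - x0 = (x + e n * 0 - (x' + e n * y' n)) + (x' - x0) + e n * y' n by ring]
      exact norm_add₃_le
    rw [norm_mul] at h2
    have h3 : ‖e n‖ * ‖y' n‖ ≤ ‖e n‖ * (2 * τ) := by gcongr
    nlinarith

end HullTorus

namespace HullTorus

open MvPolynomial Filter Topology

def PH (Y : Set (ℂ × ℂ)) (z w : ℂ) : Prop :=
  ‖z‖ ≤ 1 ∧ ‖w‖ ≤ 1 ∧ ∀ (p : MvPolynomial (Fin 2) ℂ) (m : ℝ),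
    (∀ t ∈ Y, ‖ev t.1 ((t.1 - t.2) / (1 - t.2)) p‖ ≤ m) → ‖ev z w p‖ ≤ m

def Good (n : ℕ) (P : MvPolynomial (Fin 2) ℂ) (b : ℂ) (θ : ℝ) : Prop :=
  ∀ Y : Set (ℂ × ℂ), (∀ t ∈ Y, ‖t.1‖ = 1 ∧ ‖t.2‖ ≤ 1 / 2 ∧ ‖(t.1 - t.2) / (1 - t.2)‖ ≤ 1 ∧
      ∃ x : ℂ, ‖x‖ ≤ 1 ∧ ev t.1 x P = 0 ∧ ‖t.2 - x‖ ≤ θ) →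
    (∃ s : ℝ, 0 < s ∧ s ≤ 1 / (n + 1) ∧ ∀ w w' : ℂ, PH Y b w → PH Y (b + s) w' →
      1 / (n + 1) ≤ ‖1 - w‖ → 1 / (n + 1) ≤ ‖1 - w'‖ →
      (n + 1) * s < ‖(b - w) / (1 - w) - (b + s - w') / (1 - w')‖) ∧
    ∀ z c : ℂ, ¬ ∀ v ∈ closedBall (0:ℂ) (1 / (n + 1)), ∃ w, PH Y z w ∧ 1 / (n + 1) ≤ ‖1 - w‖ ∧
      c + v = (z - w) / (1 - w)

lemma stage1 (n : ℕ) (P : MvPolynomial (Fin 2) ℂ) (b : ℂ) (s M : ℝ)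
    (hsep : ∀ x x' : ℂ, ev b x P = 0 → ev (b + s) x' P = 0 →
      (n + 1) * s < ‖x - x'‖) : ∃ δ1 : ℝ, 0 < δ1 ∧ ∀ t ∈ (closedBall (0:ℂ) M ×ˢ closedBall (0:ℂ) M) ∩
      {t : ℂ × ℂ | ‖t.1 - t.2‖ ≤ (n + 1) * s}, δ1 ≤ ‖ev b t.1 P‖ + ‖ev (b + s) t.2 P‖ := by
  refine IsCompact.exists_forall_le' ?_ ?_ ?_
  · refine ((isCompact_closedBall _ _).prod (isCompact_closedBall _ _)).inter_right ?_
    exact isClosed_le (by fun_prop) (by fun_prop)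
  · refine Continuous.continuousOn ?_
    refine Continuous.add ?_ ?_
    · exact ((ev_cont P).comp (continuous_const.prodMk continuous_fst)).norm
    · exact ((ev_cont P).comp (continuous_const.prodMk continuous_snd)).norm
  · rintro ⟨x, x'⟩ ⟨-, hx⟩
    simp only [Set.mem_ofPred_eq] at hx
    by_contra hcon
    push Not at hcon
    have h2 : ev b x P = 0 := by
      rw [← norm_eq_zero]; have := norm_nonneg (ev b x P); have := norm_nonneg (ev (b+s) x' P)
      simp only at hcon; linarith
    have h3 : ev (b+s) x' P = 0 := by
      rw [← norm_eq_zero]; have := norm_nonneg (ev b x P); have := norm_nonneg (ev (b+s) x' P)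
      simp only at hcon; linarith
    have := hsep x x' h2 h3
    linarith

lemma stage2 (n : ℕ) (P : MvPolynomial (Fin 2) ℂ) (M : ℝ)
    (hfin : ∀ z, {x | ev z x P = 0}.Finite) : ∃ δ2 : ℝ, 0 < δ2 ∧ ∀ t ∈ closedBall (0:ℂ) 1 ×ˢ closedBall (0:ℂ) M,
      δ2 ≤ sSup ((fun v => ‖ev t.1 (t.2 + v) P‖) '' closedBall (0:ℂ) (1 / ((n:ℝ) + 1))) := by
  have hcont : Continuous (fun r : (ℂ × ℂ) × ℂ => ‖ev r.1.1 (r.1.2 + r.2) P‖) :=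
    ((ev_cont P).comp ((continuous_fst.comp continuous_fst).prodMk
        ((continuous_snd.comp continuous_fst).add continuous_snd))).norm
  refine IsCompact.exists_forall_le' ((isCompact_closedBall _ _).prod (isCompact_closedBall _ _)) ?_ ?_
  · refine Continuous.continuousOn ?_
    exact IsCompact.continuous_sSup (f := fun (t : ℂ × ℂ) v => ‖ev t.1 (t.2 + v) P‖)
      (isCompact_closedBall _ _) hcont
  · rintro ⟨z, c⟩ -
    have hinf : (closedBall c (1 / ((n:ℝ) + 1))).Infinite := by
      intro hf
      have hz : (interior (closedBall c (1 / ((n:ℝ) + 1)))).Nonempty :=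
        ⟨c, ball_subset_interior_closedBall (mem_ball_self (by positivity))⟩
      have := hf.isClosed
      exact (infinite_of_mem_nhds c (closedBall_mem_nhds c (by positivity : (0:ℝ) < 1 / (n + 1)))) hf
    obtain ⟨x, hx, hx'⟩ := hinf.exists_notMem_finite (hfin z)
    have hc2 : Continuous (fun v => ‖ev z (c + v) P‖) :=
      ((ev_cont P).comp ((continuous_const (y := z)).prodMk (continuous_const.add continuous_id))).norm
    have hb : BddAbove ((fun v => ‖ev z (c + v) P‖) '' closedBall (0:ℂ) (1 / ((n:ℝ) + 1))) :=
      ((isCompact_closedBall (0:ℂ) (1 / ((n:ℝ) + 1))).image hc2).bddAbove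
    have := le_csSup hb ⟨x - c, by simpa [dist_eq_norm] using hx, rfl⟩
    refine lt_of_lt_of_le ?_ this
    simp only [add_sub_cancel]
    exact norm_pos_iff.2 hx'

set_option maxHeartbeats 1000000 in
lemma stage (n : ℕ) (P : MvPolynomial (Fin 2) ℂ) (b : ℂ)
    (hsep : ∃ s : ℝ, 0 < s ∧ s ≤ 1 / (n + 1) ∧ ∀ x x' : ℂ, ev b x P = 0 → ev (b + s) x' P = 0 →
      (n + 1) * s < ‖x - x'‖)
    (hfin : ∀ z, {x | ev z x P = 0}.Finite) : ∃ θ > 0, Good n P b θ := by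
  obtain ⟨s, hs0, hs1, hsep⟩ := hsep
  have hn : (0:ℝ) < n + 1 := by positivity
  set M : ℝ := 2 * (n + 1) with hM
  obtain ⟨δ1, hδ1, h1⟩ := stage1 n P b s M hsep
  obtain ⟨δ2, hδ2, h2⟩ := stage2 n P M hfin
  obtain ⟨d, Q, hQ⟩ := exists_hom P
  set δ := min (δ1 / 4) (δ2 / 2) with hδ
  have hδ0 : 0 < δ := by positivity
  obtain ⟨θ, hθ, hunif⟩ : ∃ θ > 0, ∀ z x x' : ℂ, ‖z‖ ≤ 1 → ‖x‖ ≤ 1 → ‖x'‖ ≤ 1 → ‖x - x'‖ ≤ θ →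
      ‖ev z x P - ev z x' P‖ ≤ δ / (2 * (n + 1)) ^ d := by
    have huc := ((isCompact_closedBall (0:ℂ) 1).prod (isCompact_closedBall (0:ℂ) 1)).uniformContinuousOn_of_continuous
      (ev_cont P).continuousOn
    rw [Metric.uniformContinuousOn_iff] at huc
    obtain ⟨θ, hθ, h⟩ := huc (δ / (2 * (n + 1)) ^ d) (by positivity)
    refine ⟨θ / 2, by positivity, fun z x x' hz hx hx' hd => ?_⟩
    have := h (z, x) (by simpa using ⟨hz, hx⟩) (z, x') (by simpa using ⟨hz, hx'⟩) (by
      rw [Prod.dist_eq]; simp only [dist_self, dist_eq_norm]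
      rw [max_lt_iff]; exact ⟨hθ, by linarith⟩)
    rw [dist_eq_norm] at this
    exact this.le
  refine ⟨θ, hθ, fun Y hY => ?_⟩
  have key : ∀ z w : ℂ, PH Y z w → 1 / (n + 1) ≤ ‖1 - w‖ →
      ‖ev z ((z - w) / (1 - w)) P‖ ≤ δ ∧ ‖(z - w) / (1 - w)‖ ≤ M := by
    rintro z w ⟨hz, hw, h⟩ hw1
    have hpos : 0 < ‖1 - w‖ := lt_of_lt_of_le (by positivity) hw1
    have hne : 1 - w ≠ 0 := norm_pos_iff.1 hpos
    constructor
    · have hb := h Q (2 ^ d * (δ / (2 * (n + 1)) ^ d)) (by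
        rintro ⟨z, ρ⟩ ht
        obtain ⟨h1, h2, h3, x, hx, hx0, hxθ⟩ := hY _ ht
        simp only at h1 h2 h3 hx0 hxθ ⊢
        have hρ : 1 - ρ ≠ 0 := by
          intro h0
          have : ρ = 1 := by linear_combination -h0
          rw [this] at h2; norm_num at h2
        rw [hQ z _ ρ (by field_simp; ring), norm_mul, norm_pow]
        gcongr
        · refine (norm_sub_le _ _).trans ?_
          rw [norm_one]; linarith
        · have := hunif z ρ x h1.le (by linarith) hx hxθ
          rwa [hx0, sub_zero] at this)
      rw [hQ z w ((z - w) / (1 - w)) (by field_simp), norm_mul, norm_pow] at hb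
      have h4 : (1 / ((n:ℝ) + 1)) ^ d ≤ ‖1 - w‖ ^ d := by gcongr
      have h5 : (1 / ((n:ℝ) + 1)) ^ d * ‖ev z ((z - w) / (1 - w)) P‖ ≤ 2 ^ d * (δ / (2 * (n + 1)) ^ d) :=
        le_trans (by gcongr) hb
      rw [mul_pow, div_pow, one_pow] at h5
      field_simp at h5
      exact h5
    · rw [norm_div, div_le_iff₀ hpos]
      have h4 := norm_sub_le z w
      have : M * (1 / (n + 1)) ≤ M * ‖1 - w‖ := by gcongr
      have h6 : M * (1 / (n + 1)) = 2 := by rw [hM]; field_simp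
      linarith
  refine ⟨⟨s, hs0, hs1, fun w w' hw hw' h3 h4 => ?_⟩, fun z c hcon => ?_⟩
  · obtain ⟨k1, k2⟩ := key _ _ hw h3
    obtain ⟨k3, k4⟩ := key _ _ hw' h4
    by_contra hcon
    push Not at hcon
    have := h1 ((b - w) / (1 - w), (b + s - w') / (1 - w'))
      ⟨⟨by simpa using k2, by simpa using k4⟩, hcon⟩
    simp only at this
    have : δ ≤ δ1 / 4 := min_le_left _ _
    linarith
  · have hz : ‖z‖ ≤ 1 ∧ ‖c‖ ≤ M := by
      obtain ⟨w, hw, hw1, hc⟩ := hcon 0 (by simp; positivity)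
      refine ⟨hw.1, ?_⟩
      rw [add_zero] at hc
      rw [hc]; exact (key _ _ hw hw1).2
    have := h2 (z, c) ⟨by simpa using hz.1, by simpa using hz.2⟩
    have h3 : sSup ((fun v => ‖ev z (c + v) P‖) '' closedBall (0:ℂ) (1 / (n + 1))) ≤ δ := by
      refine csSup_le ⟨_, 0, by simp; positivity, rfl⟩ ?_
      rintro _ ⟨v, hv, rfl⟩
      obtain ⟨w, hw, hw1, hc⟩ := hcon v hv
      simp only [hc]
      exact (key _ _ hw hw1).1
    have : δ ≤ δ2 / 2 := min_le_right _ _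
    simp only at *
    linarith

end HullTorus

namespace HullTorus

open MvPolynomial Filter Topology

lemma dense_seq : ∃ a : ℕ → ℂ, Function.Injective a ∧ (∀ n, ‖a n‖ < 1) ∧
    ∀ b : ℂ, ‖b‖ < 1 → ∀ r > 0, ∀ N : ℕ, ∃ n ≥ N, ‖a n - b‖ < r := by
  obtain ⟨s, hs, hd⟩ := TopologicalSpace.exists_countable_dense ℂ
  have key : ∀ b : ℂ, ‖b‖ < 1 → ∀ r > 0, ∀ F : Set ℂ, F.Finite → ∃ x ∈ s, ‖x‖ < 1 ∧ ‖x - b‖ < r ∧ x ∉ F := by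
    intro b hb r hr F hF
    have hO : IsOpen ((ball b r ∩ ball 0 1) \ F) := (isOpen_ball.inter isOpen_ball).sdiff hF.isClosed
    have hinf : (ball b r ∩ ball (0:ℂ) 1).Infinite :=
      infinite_of_mem_nhds b (inter_mem (ball_mem_nhds b hr) (isOpen_ball.mem_nhds (by simpa using hb)))
    obtain ⟨x, hx, hx'⟩ := hinf.exists_notMem_finite hF
    obtain ⟨y, hy, hys⟩ := hd.inter_open_nonempty _ hO ⟨x, hx, hx'⟩
    exact ⟨y, hys, by simpa using hy.1.2, by simpa [dist_eq_norm] using hy.1.1, hy.2⟩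
  set D : Set ℂ := s ∩ ball 0 1 with hD
  have hDc : D.Countable := hs.mono Set.inter_subset_left
  have hDi : D.Infinite := by
    intro hf
    obtain ⟨x, hx, h1, -, h2⟩ := key 0 (by simp) 1 one_pos D hf
    exact h2 ⟨hx, by simpa using h1⟩
  have : Countable D := hDc.to_subtype
  have : Infinite D := hDi.to_subtype
  obtain ⟨f⟩ := nonempty_denumerable D
  let g : ℕ ≃ D := (Denumerable.eqv D).symm
  refine ⟨fun n => (g n : ℂ), ?_, ?_, ?_⟩
  · exact Subtype.val_injective.comp g.injective
  · intro n
    simpa using (g n).2.2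
  · intro b hb r hr N
    obtain ⟨x, hx, h1, h2, h3⟩ := key b hb r hr ((fun n => (g n : ℂ)) '' Set.Iio N)
      ((Set.finite_Iio N).image _)
    refine ⟨g.symm ⟨x, hx, by simpa using h1⟩, ?_, ?_⟩
    · by_contra hcon
      push Not at hcon
      exact h3 ⟨_, hcon, by simp⟩
    · simpa using h2

lemma construct (a : ℕ → ℂ) (ai : Function.Injective a) (ha : ∀ n, ‖a n‖ < 1) :
    ∃ (P : ℕ → MvPolynomial (Fin 2) ℂ) (ε θ : ℕ → ℝ), (∀ n, 0 < ε n) ∧ ε 0 ≤ 1 / 8 ∧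
      (∀ n, ε (n + 1) ≤ ε n / 4) ∧ (∀ n, ε (n + 1) ≤ θ n / 8) ∧
      (∀ n z x, ev z x (P n) = 0 ↔ ∃ y : ℕ → ℂ, (∀ j, y j ^ 2 = qq (a j) z) ∧
        x = ∑ j ∈ Finset.range n, (ε j : ℂ) * y j) ∧ ∀ n, Good n (P (n + 1)) (a n) (θ n) := by
  choose nx hnx using exists_next
  have hΘ : ∀ (n : ℕ) P, ∃ θ : ℝ, 0 < θ ∧ ((∃ s : ℝ, 0 < s ∧ s ≤ 1 / (n + 1) ∧ ∀ x x' : ℂ, ev (a n) x P = 0 →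
      ev (a n + s) x' P = 0 → (n + 1) * s < ‖x - x'‖) →
      (∀ z, {x | ev z x P = 0}.Finite) → Good n P (a n) θ) := by
    intro n P
    by_cases h : (∃ s : ℝ, 0 < s ∧ s ≤ 1 / ((n:ℝ) + 1) ∧ ∀ x x' : ℂ, ev (a n) x P = 0 →
      ev (a n + s) x' P = 0 → (n + 1) * s < ‖x - x'‖) ∧ (∀ z, {x | ev z x P = 0}.Finite)
    · obtain ⟨θ, h1, h2⟩ := stage n P (a n) h.1 h.2
      exact ⟨θ, h1, fun _ _ => h2⟩
    · exact ⟨1, one_pos, fun h1 h2 => absurd ⟨h1, h2⟩ h⟩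
  choose Θ hΘ0 hΘ using hΘ
  let S : ℕ → MvPolynomial (Fin 2) ℂ × ℝ := fun n => Nat.rec (X 1, 1 / 8)
    (fun n q => (nx (a n) (q.2 : ℂ) q.1, min (q.2 / 4) (Θ n (nx (a n) (q.2 : ℂ) q.1) / 8))) n
  have hS : ∀ n, S (n + 1) = (nx (a n) ((S n).2 : ℂ) (S n).1,
    min ((S n).2 / 4) (Θ n (nx (a n) ((S n).2 : ℂ) (S n).1) / 8)) := fun n => rfl
  have hS1 : ∀ n, (S (n+1)).1 = nx (a n) ((S n).2 : ℂ) (S n).1 := fun n => rfl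
  have hS2 : ∀ n, (S (n+1)).2 = min ((S n).2 / 4) (Θ n (S (n+1)).1 / 8) := fun n => rfl
  have hS0 : S 0 = (X 1, 1 / 8) := rfl
  clear_value S
  have hpos : ∀ n, 0 < (S n).2 := by
    intro n
    induction n with
    | zero => rw [hS0]; norm_num
    | succ n ih =>
      rw [hS2]
      have := hΘ0 n (S (n+1)).1
      positivity
  have hroot : ∀ n z x, ev z x (S n).1 = 0 ↔ ∃ y : ℕ → ℂ, (∀ j, y j ^ 2 = qq (a j) z) ∧
        x = ∑ j ∈ Finset.range n, ((S j).2 : ℂ) * y j := by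
    intro n
    induction n with
    | zero =>
      intro z x
      rw [hS0]
      simp only [ev, eval_X, Finset.range_zero, Finset.sum_empty]
      choose y hy using fun j => exists_sqrt (qq (a j) z)
      constructor
      · intro h; exact ⟨y, hy, by simpa using h⟩
      · rintro ⟨_, _, h⟩; simpa using h
    | succ n ih =>
      intro z x
      obtain ⟨y0, hy0⟩ := exists_sqrt (qq (a n) z)
      rw [hS1, hnx _ _ _ z x y0 hy0, mul_eq_zero, ih, ih]
      have hup : ∀ (y : ℕ → ℂ) (c : ℂ), (∀ j, y j ^ 2 = qq (a j) z) → c ^ 2 = qq (a n) z →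
          x = (∑ j ∈ Finset.range n, ((S j).2 : ℂ) * y j) + (S n).2 * c →
          ∃ y : ℕ → ℂ, (∀ j, y j ^ 2 = qq (a j) z) ∧
            x = ∑ j ∈ Finset.range (n+1), ((S j).2 : ℂ) * y j := by
        intro y c hy hc hx
        refine ⟨Function.update y n c, fun j => ?_, ?_⟩
        · by_cases hj : j = n
          · subst hj; simpa using hc
          · simpa [hj] using hy j
        · rw [Finset.sum_range_succ, hx]
          congr 1
          · refine Finset.sum_congr rfl fun j hj => ?_
            rw [Function.update_of_ne (Finset.mem_range.1 hj).ne]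
          · simp
      constructor
      · rintro (⟨y, hy, hx⟩ | ⟨y, hy, hx⟩)
        · exact hup y (-y0) hy (by rw [neg_sq, hy0]) (by rw [← hx]; ring)
        · exact hup y y0 hy hy0 (by rw [← hx]; ring)
      · rintro ⟨y, hy, hx⟩
        rw [Finset.sum_range_succ] at hx
        have : (y n - y0) * (y n + y0) = 0 := by
          have := hy n
          linear_combination this - hy0
        rcases mul_eq_zero.1 this with h | h
        · right
          refine ⟨y, hy, ?_⟩
          rw [hx]; linear_combination ((S n).2 : ℂ) * h
        · left
          refine ⟨y, hy, ?_⟩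
          rw [hx]; linear_combination ((S n).2 : ℂ) * h
  refine ⟨fun n => (S n).1, fun n => (S n).2, fun n => Θ n (S (n+1)).1, hpos, by simp [hS0], ?_, ?_, hroot, ?_⟩
  · intro n; simp only [hS2 n]; exact min_le_left _ _
  · intro n; simp only [hS2 n]; exact min_le_right _ _
  · intro n
    apply hΘ
    · have hq : ∀ j < n, qq (a j) (a n) ≠ 0 := by
        intro j hj h0
        rw [qq, mul_eq_zero] at h0
        rcases h0 with h | h
        · exact hj.ne (ai (sub_eq_zero.1 h)).symm
        · have h1 : ‖(starRingEnd ℂ) (a j) * a n‖ = 1 := by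
            rw [← sub_eq_zero.1 h, norm_one]
          rw [norm_mul, RCLike.norm_conj] at h1
          nlinarith [ha j, ha n, norm_nonneg (a j), norm_nonneg (a n)]
      obtain ⟨s, h0, h1, h2⟩ := sep a (fun j => ((S j).2 : ℂ)) n (ha n) hq (by
        simpa using (hpos n).ne')
      refine ⟨s, h0, h1, fun x x' hx hx' => ?_⟩
      obtain ⟨y, hy, rfl⟩ := (hroot _ _ _).1 hx
      obtain ⟨y', hy', rfl⟩ := (hroot _ _ _).1 hx'
      exact h2 y y' hy hy'
    · intro z
      refine (roots_finite a (fun j => ((S j).2 : ℂ)) (n+1) z).subset fun x hx => ?_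
      exact (hroot _ _ _).1 hx

end HullTorus

namespace HullTorus

open MvPolynomial Filter Topology

lemma y_bound (a z y : ℂ) (ha : ‖a‖ < 1) (hz : ‖z‖ ≤ 1) (hy : y ^ 2 = qq a z) : ‖y‖ ≤ 2 := by
  have h1 : ‖y‖ ^ 2 ≤ 2 * 2 := by
    rw [← norm_pow, hy, qq, norm_mul]
    have h3 : ‖(starRingEnd ℂ) a * z‖ ≤ 1 := by
      rw [norm_mul, RCLike.norm_conj]
      nlinarith [norm_nonneg a, norm_nonneg z]
    gcongr
    · exact (norm_sub_le _ _).trans (by linarith)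
    · exact (norm_sub_le _ _).trans (by rw [norm_one]; linarith)
  nlinarith [norm_nonneg y]

lemma y_sym (a z y : ℂ) (hz : ‖z‖ = 1) (hy : y ^ 2 = qq a z) : y = z * (starRingEnd ℂ) y := by
  by_cases h0 : y = 0
  · simp [h0]
  have hzz : z * (starRingEnd ℂ) z = 1 := by
    rw [Complex.mul_conj, Complex.normSq_eq_norm_sq, hz]; norm_num
  have h1 : qq a z = z * ((‖z - a‖ : ℂ) ^ 2) := by
    rw [← Complex.mul_conj', qq, map_sub]
    linear_combination -(z - a) * hzz
  have h2 : ‖y‖ ^ 2 = ‖z - a‖ ^ 2 := by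
    rw [← norm_pow, hy, h1, norm_mul, hz, one_mul, norm_pow, Complex.norm_real, norm_norm]
  have h3 : y * (starRingEnd ℂ) y = (‖z - a‖ : ℂ) ^ 2 := by
    rw [Complex.mul_conj']; exact_mod_cast h2
  apply mul_left_cancel₀ h0
  rw [← pow_two, hy, h1, ← h3]; ring

structure Seq (a : ℕ → ℂ) (ε : ℕ → ℝ) : Prop where
  ha : ∀ n, ‖a n‖ < 1
  pos : ∀ n, 0 < ε n
  zero : ε 0 ≤ 1 / 8
  step : ∀ n, ε (n + 1) ≤ ε n / 4

variable {a : ℕ → ℂ} {ε : ℕ → ℝ}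

lemma Seq.geom (h : Seq a ε) (n j : ℕ) : ε (n + j) ≤ ε n * (1 / 4) ^ j := by
  induction j with
  | zero => simp
  | succ j ih =>
    have := h.step (n + j)
    rw [← add_assoc, pow_succ]
    linarith

lemma Seq.tail (h : Seq a ε) {z : ℂ} (hz : ‖z‖ ≤ 1) {y : ℕ → ℂ} (hy : ∀ j, y j ^ 2 = qq (a j) z) (n : ℕ) :
    Summable (fun j => (ε j : ℂ) * y j) ∧
    ‖(∑' j, (ε j : ℂ) * y j) - ∑ j ∈ Finset.range n, (ε j : ℂ) * y j‖ ≤ 8 / 3 * ε n := by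
  have hb : ∀ n j, ‖(ε (j + n) : ℂ) * y (j + n)‖ ≤ (2 * ε n) * (1 / 4) ^ j := by
    intro n j
    have h1 := h.geom n j
    have h2 := y_bound _ _ _ (h.ha (j + n)) hz (hy _)
    have h3 := h.pos (n + j)
    rw [norm_mul, Complex.norm_real, Real.norm_of_nonneg (h.pos _).le, add_comm j n]
    rw [add_comm j n] at h2
    have h4 := norm_nonneg (y (n + j))
    nlinarith
  have hg : ∀ n, HasSum (fun j : ℕ => (2 * ε n) * (1 / 4 : ℝ) ^ j) (8 / 3 * ε n) := by
    intro n
    have := (hasSum_geometric_of_lt_one (r := (1/4 : ℝ)) (by norm_num) (by norm_num)).mul_left (2 * ε n)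
    have h2 : 2 * ε n * (1 - 1 / 4)⁻¹ = 8 / 3 * ε n := by norm_num; ring
    rwa [h2] at this
  have hs : Summable (fun j => (ε j : ℂ) * y j) :=
    Summable.of_norm_bounded (hg 0).summable (fun j => by simpa using hb 0 j)
  refine ⟨hs, ?_⟩
  rw [← hs.sum_add_tsum_nat_add n, add_sub_cancel_left]
  exact tsum_of_norm_bounded (hg n) (hb n)

def YY (a : ℕ → ℂ) (ε : ℕ → ℝ) : Set (ℂ × ℂ) :=
  {t | ‖t.1‖ = 1 ∧ ∃ y : ℕ → ℂ, (∀ j, y j ^ 2 = qq (a j) t.1) ∧ t.2 = ∑' j, (ε j : ℂ) * y j}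

lemma Seq.small (h : Seq a ε) {z : ℂ} (hz : ‖z‖ ≤ 1) {y : ℕ → ℂ} (hy : ∀ j, y j ^ 2 = qq (a j) z) :
    ‖∑' j, (ε j : ℂ) * y j‖ ≤ 1 / 3 := by
  have := (h.tail hz hy 0).2
  simp only [Finset.range_zero, Finset.sum_empty, sub_zero] at this
  linarith [h.zero]

lemma Seq.YY_norm (h : Seq a ε) {t : ℂ × ℂ} (ht : t ∈ YY a ε) :
    ‖t.1‖ = 1 ∧ ‖t.2‖ ≤ 1 / 3 ∧ ‖(t.1 - t.2) / (1 - t.2)‖ = 1 := by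
  obtain ⟨h1, y, hy, h2⟩ := ht
  have h3 : ‖t.2‖ ≤ 1 / 3 := by rw [h2]; exact h.small h1.le hy
  refine ⟨h1, h3, ?_⟩
  have h4 : t.2 = t.1 * (starRingEnd ℂ) t.2 := by
    rw [h2, Complex.conj_tsum, ← tsum_mul_left]
    refine tsum_congr fun j => ?_
    rw [map_mul, Complex.conj_ofReal]
    nth_rewrite 1 [y_sym _ _ _ h1 (hy j)]
    ring
  have h5 : t.1 - t.2 = t.1 * (starRingEnd ℂ) (1 - t.2) := by
    rw [map_sub, map_one, mul_sub, ← h4, mul_one]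
  have h6 : 1 - t.2 ≠ 0 := by
    intro h0
    have : t.2 = 1 := by linear_combination -h0
    rw [this] at h3; norm_num at h3
  rw [norm_div, h5, norm_mul, h1, one_mul, RCLike.norm_conj]
  exact div_self (norm_ne_zero_iff.2 h6)

lemma Seq.YY_good (h : Seq a ε) {P : ℕ → MvPolynomial (Fin 2) ℂ} {θ : ℕ → ℝ}
    (hθ : ∀ n, ε (n + 1) ≤ θ n / 8)
    (hP : ∀ n z x, ev z x (P n) = 0 ↔ ∃ y : ℕ → ℂ, (∀ j, y j ^ 2 = qq (a j) z) ∧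
        x = ∑ j ∈ Finset.range n, (ε j : ℂ) * y j) (n : ℕ) : ∀ t ∈ YY a ε,
    ‖t.1‖ = 1 ∧ ‖t.2‖ ≤ 1 / 2 ∧ ‖(t.1 - t.2) / (1 - t.2)‖ ≤ 1 ∧
      ∃ x : ℂ, ‖x‖ ≤ 1 ∧ ev t.1 x (P (n + 1)) = 0 ∧ ‖t.2 - x‖ ≤ θ n := by
  intro t ht
  obtain ⟨h1, h2, h3⟩ := h.YY_norm ht
  obtain ⟨-, y, hy, hty⟩ := ht
  refine ⟨h1, by linarith, h3.le, ∑ j ∈ Finset.range (n + 1), (ε j : ℂ) * y j, ?_, (hP _ _ _).2 ⟨y, hy, rfl⟩, ?_⟩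
  · have h4 := (h.tail h1.le hy (n + 1)).2
    rw [← hty] at h4
    have h5 := h.geom 0 (n + 1)
    have h6 : ((1:ℝ) / 4) ^ (n + 1) ≤ 1 := pow_le_one₀ (by norm_num) (by norm_num)
    have h7 := norm_sub_norm_le (∑ j ∈ Finset.range (n + 1), (ε j : ℂ) * y j) t.2
    rw [norm_sub_rev] at h7
    have := h.zero
    have := h.pos 0
    rw [zero_add] at h5
    nlinarith
  · have h4 := (h.tail h1.le hy (n + 1)).2
    rw [← hty] at h4
    have := hθ n
    have := h.pos (n + 1)
    linarith

lemma unif (F : MvPolynomial (Fin 2) ℂ) (R : ℝ) {η : ℝ} (hη : 0 < η) :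
    ∃ δ > 0, ∀ z x x' : ℂ, ‖z‖ ≤ 1 → ‖x‖ ≤ R → ‖x'‖ ≤ R → ‖x - x'‖ < δ →
      ‖ev z x F - ev z x' F‖ < η := by
  have huc := ((isCompact_closedBall (0:ℂ) 1).prod (isCompact_closedBall (0:ℂ) R)).uniformContinuousOn_of_continuous
      (ev_cont F).continuousOn
  rw [Metric.uniformContinuousOn_iff] at huc
  obtain ⟨θ, hθ, h⟩ := huc η hη
  refine ⟨θ, hθ, fun z x x' hz hx hx' hd => ?_⟩
  have := h (z, x) (by simpa using ⟨hz, hx⟩) (z, x') (by simpa using ⟨hz, hx'⟩) (by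
      rw [Prod.dist_eq]; simp only [dist_self, dist_eq_norm]
      rw [max_lt_iff]; exact ⟨hθ, hd⟩)
  rwa [dist_eq_norm] at this

lemma Seq.F_bound (h : Seq a ε) (F : MvPolynomial (Fin 2) ℂ) (m : ℝ)
    (hF : ∀ t ∈ YY a ε, ‖ev t.1 t.2 F‖ ≤ m) (z : ℂ) (hz : ‖z‖ ≤ 1) (y : ℕ → ℂ)
    (hy : ∀ j, y j ^ 2 = qq (a j) z) : ‖ev z (∑' j, (ε j : ℂ) * y j) F‖ ≤ m := by
  refine le_of_forall_pos_le_add fun η hη => ?_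
  obtain ⟨δ, hδ, hu⟩ := unif F 2 (half_pos hη)
  obtain ⟨N, hN⟩ := exists_pow_lt_of_lt_one hδ (by norm_num : (1/4 : ℝ) < 1)
  have hN' : 8 / 3 * ε N < δ := by
    have := h.geom 0 N
    rw [zero_add] at this
    have h0 := h.zero
    have : (0:ℝ) < (1/4) ^ N := by positivity
    nlinarith
  have hN1 : 8 / 3 * ε N ≤ 1 := by
    have := h.geom 0 N
    rw [zero_add] at this
    have h0 := h.zero
    have h2 := h.pos 0
    have : ((1:ℝ)/4) ^ N ≤ 1 := pow_le_one₀ (by norm_num) (by norm_num)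
    nlinarith
  have near : ∀ z : ℂ, ‖z‖ ≤ 1 → ∀ y : ℕ → ℂ, (∀ j, y j ^ 2 = qq (a j) z) →
      ‖ev z (∑' j, (ε j : ℂ) * y j) F - ev z (∑ j ∈ Finset.range N, (ε j : ℂ) * y j) F‖ < η / 2 := by
    intro z hz y hy
    have h1 := (h.tail hz hy N).2
    have h2 := h.small hz hy
    have h7 := norm_sub_norm_le (∑ j ∈ Finset.range N, (ε j : ℂ) * y j) (∑' j, (ε j : ℂ) * y j)
    rw [norm_sub_rev] at h7
    exact hu z _ _ hz (by linarith) (by linarith) (by linarith)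
  have h3 := max_fin a (fun j => (ε j : ℂ)) N F (m + η / 2) (by
    intro z y hz hy
    have h1 := near z hz.le y hy
    have h2 := hF (z, ∑' j, (ε j : ℂ) * y j) ⟨hz, y, hy, rfl⟩
    have h7 := norm_sub_norm_le (ev z (∑ j ∈ Finset.range N, (ε j : ℂ) * y j) F)
      (ev z (∑' j, (ε j : ℂ) * y j) F)
    rw [norm_sub_rev] at h7
    simp only at h2
    linarith) z y hz hy
  have h1 := near z hz y hy
  have h7 := norm_sub_norm_le (ev z (∑' j, (ε j : ℂ) * y j) F)
    (ev z (∑ j ∈ Finset.range N, (ε j : ℂ) * y j) F)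
  linarith

lemma sub_poly (p : MvPolynomial (Fin 2) ℂ) (k : ℕ) : ∃ F : MvPolynomial (Fin 2) ℂ, ∀ z x : ℂ,
    ev z x F = ev z ((z - x) * ∑ i ∈ Finset.range k, x ^ i) p := by
  refine ⟨bind₁ ![X 0, (X 0 - X 1) * ∑ i ∈ Finset.range k, X 1 ^ i] p, fun z x => ?_⟩
  unfold ev
  rw [← aeval_eq_eval, aeval_bind₁, aeval_eq_eval]
  simp only [aeval_eq_eval]
  congr 1
  congr 1
  funext i
  fin_cases i <;> simp

lemma approx_w (z x : ℂ) (hz : ‖z‖ ≤ 1) (hx : ‖x‖ ≤ 1 / 3) (k : ℕ) :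
    ‖(z - x) / (1 - x)‖ ≤ 6 ∧ ‖(z - x) * ∑ i ∈ Finset.range k, x ^ i‖ ≤ 6 ∧
    ‖(z - x) / (1 - x) - (z - x) * ∑ i ∈ Finset.range k, x ^ i‖ ≤ 3 * (1 / 2) ^ k := by
  have h1 : ‖z - x‖ ≤ 4 / 3 := (norm_sub_le _ _).trans (by linarith)
  have h2 : 2 / 3 ≤ ‖1 - x‖ := by
    have := norm_sub_norm_le 1 x
    rw [norm_one] at this; linarith
  have h3 : 1 - x ≠ 0 := norm_pos_iff.1 (by linarith)
  have h4 : ‖(z - x) / (1 - x)‖ ≤ 2 := by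
    rw [norm_div, div_le_iff₀ (by linarith)]
    linarith
  have h5 : ‖(z - x) / (1 - x) - (z - x) * ∑ i ∈ Finset.range k, x ^ i‖ ≤ 3 * (1 / 2) ^ k := by
    have : (z - x) / (1 - x) - (z - x) * ∑ i ∈ Finset.range k, x ^ i = (z - x) / (1 - x) * x ^ k := by
      have := geom_sum_mul_neg x k
      field_simp
      linear_combination -(z - x) * this
    rw [this, norm_mul, norm_pow]
    gcongr <;> linarith
  refine ⟨by linarith, ?_, h5⟩
  have h7 := norm_sub_norm_le ((z - x) * ∑ i ∈ Finset.range k, x ^ i) ((z - x) / (1 - x))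
  rw [norm_sub_rev] at h7
  have : ((1:ℝ)/2) ^ k ≤ 1 := pow_le_one₀ (by norm_num) (by norm_num)
  linarith

lemma Seq.p_bound (h : Seq a ε) (p : MvPolynomial (Fin 2) ℂ) (m : ℝ)
    (hF : ∀ t ∈ YY a ε, ‖ev t.1 ((t.1 - t.2) / (1 - t.2)) p‖ ≤ m) (z : ℂ) (hz : ‖z‖ ≤ 1) (y : ℕ → ℂ)
    (hy : ∀ j, y j ^ 2 = qq (a j) z) :
    ‖ev z ((z - ∑' j, (ε j : ℂ) * y j) / (1 - ∑' j, (ε j : ℂ) * y j)) p‖ ≤ m := by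
  refine le_of_forall_pos_le_add fun η hη => ?_
  obtain ⟨δ, hδ, hu⟩ := unif p 6 (half_pos hη)
  obtain ⟨N, hN⟩ := exists_pow_lt_of_lt_one (by positivity : 0 < δ / 3) (by norm_num : (1/2 : ℝ) < 1)
  obtain ⟨F, hFF⟩ := sub_poly p N
  have near : ∀ z x : ℂ, ‖z‖ ≤ 1 → ‖x‖ ≤ 1 / 3 →
      ‖ev z ((z - x) / (1 - x)) p - ev z x F‖ < η / 2 := by
    intro z x hz hx
    obtain ⟨h1, h2, h3⟩ := approx_w z x hz hx N
    rw [hFF]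
    exact hu z _ _ hz h1 h2 (by linarith)
  have h3 := h.F_bound F (m + η / 2) (by
    intro t ht
    obtain ⟨h4, h5, -⟩ := h.YY_norm ht
    have h1 := near t.1 t.2 h4.le h5
    have h2 := hF t ht
    have h7 := norm_sub_norm_le (ev t.1 t.2 F) (ev t.1 ((t.1 - t.2) / (1 - t.2)) p)
    rw [norm_sub_rev] at h7
    linarith) z hz y hy
  have h1 := near z _ hz (h.small hz hy)
  have h7 := norm_sub_norm_le (ev z ((z - ∑' j, (ε j : ℂ) * y j) / (1 - ∑' j, (ε j : ℂ) * y j)) p)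
    (ev z (∑' j, (ε j : ℂ) * y j) F)
  linarith

lemma Seq.exists_PH (h : Seq a ε) : ∃ w, PH (YY a ε) 0 w := by
  choose y hy using fun j => exists_sqrt (qq (a j) 0)
  have key := fun p m hF => h.p_bound p m hF 0 (by simp) y hy
  refine ⟨_, by simp, ?_, key⟩
  have := key (X 1) 1 (fun t ht => by
    simp only [ev, eval_X]
    simpa using (h.YY_norm ht).2.2.le)
  simpa [ev] using this

end HullTorus

namespace HullTorus

open MvPolynomial Filter Topology

lemma peak_unif {η : ℝ} (h0 : 0 < η) (h1 : η ≤ 1) : ∃ N : ℕ, ∀ w : ℂ, ‖w‖ = 1 →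
    ‖1 - w‖ * ‖(1 + w) / 2‖ ^ N ≤ η := by
  obtain ⟨k, hk⟩ := exists_pow_lt_of_lt_one (by positivity : 0 < η / 2)
    (by nlinarith : 1 - η ^ 2 / 4 < 1)
  refine ⟨2 * k, fun w hw => ?_⟩
  have hle : ‖(1 + w) / 2‖ ≤ 1 := by
    rw [norm_div, Complex.norm_ofNat, div_le_one (by norm_num)]
    exact (norm_add_le _ _).trans (by rw [norm_one, hw]; norm_num)
  have hp : ‖(1 + w) / 2‖ ^ 2 = 1 - ‖1 - w‖ ^ 2 / 4 := by
    have := parallelogram_law_with_norm ℝ (1:ℂ) w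
    rw [norm_one, hw] at this
    rw [norm_div, Complex.norm_ofNat, div_pow]
    linarith
  have h2 : ‖1 - w‖ ≤ 2 := (norm_sub_le _ _).trans (by rw [norm_one, hw]; norm_num)
  rcases le_total ‖1 - w‖ η with h | h
  · calc _ ≤ η * 1 := by
          gcongr
          exact pow_le_one₀ (norm_nonneg _) hle
      _ = η := mul_one _
  · rw [pow_mul, hp]
    have h4 : (1 - ‖1 - w‖ ^ 2 / 4) ≤ 1 - η ^ 2 / 4 := by nlinarith
    have h5 : 0 ≤ 1 - ‖1 - w‖ ^ 2 / 4 := by rw [← hp]; positivity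
    calc _ ≤ 2 * (1 - η ^ 2 / 4) ^ k := by gcongr
      _ ≤ η := by linarith

lemma peak {Y : Set (ℂ × ℂ)} (i j : Fin 2) {z w : ℂ}
    (hY : ∀ t ∈ Y, ‖(![t.1, (t.1 - t.2) / (1 - t.2)] : Fin 2 → ℂ) j‖ = 1 ∧
      ‖1 - (![t.1, (t.1 - t.2) / (1 - t.2)] : Fin 2 → ℂ) i‖ ≤
        2 * ‖1 - (![t.1, (t.1 - t.2) / (1 - t.2)] : Fin 2 → ℂ) j‖)
    (h : PH Y z w) (hj : (![z, w] : Fin 2 → ℂ) j = 1) : (![z, w] : Fin 2 → ℂ) i = 1 := by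
  by_contra hne
  have hpos : 0 < ‖1 - (![z, w] : Fin 2 → ℂ) i‖ := norm_pos_iff.2 (sub_ne_zero.2 (Ne.symm hne))
  set r := ‖1 - (![z, w] : Fin 2 → ℂ) i‖ with hr
  obtain ⟨N, hN⟩ := peak_unif (η := min 1 (r / 4)) (by positivity) (min_le_left _ _)
  have hev : ∀ v : Fin 2 → ℂ, eval v ((1 - X i) * (C (1 / 2) * (1 + X j)) ^ N : MvPolynomial (Fin 2) ℂ) =
      (1 - v i) * ((1 + v j) / 2) ^ N := by
    intro v
    simp only [map_mul, map_sub, map_one, map_pow, map_add, eval_X, eval_C]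
    congr 2; ring
  have := h.2.2 ((1 - X i) * (C (1 / 2) * (1 + X j)) ^ N) (2 * (r / 4)) (by
    intro t ht
    obtain ⟨h1, h2⟩ := hY t ht
    rw [ev, hev, norm_mul, norm_pow]
    have h3 := hN _ h1
    have h4 := min_le_right 1 (r / 4)
    calc _ ≤ (2 * ‖1 - (![t.1, (t.1 - t.2) / (1 - t.2)] : Fin 2 → ℂ) j‖) *
          ‖(1 + (![t.1, (t.1 - t.2) / (1 - t.2)] : Fin 2 → ℂ) j) / 2‖ ^ N := by gcongr
      _ ≤ _ := by linarith)
  rw [ev, hev, hj] at this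
  norm_num at this
  linarith

variable {a : ℕ → ℂ} {ε : ℕ → ℝ}

lemma Seq.YY_comp (h : Seq a ε) {t : ℂ × ℂ} (ht : t ∈ YY a ε) :
    ‖1 - t.1‖ ≤ 2 * ‖1 - (t.1 - t.2) / (1 - t.2)‖ ∧
    ‖1 - (t.1 - t.2) / (1 - t.2)‖ ≤ 2 * ‖1 - t.1‖ := by
  obtain ⟨h1, h2, -⟩ := h.YY_norm ht
  have h3 : 2 / 3 ≤ ‖1 - t.2‖ := by
    have := norm_sub_norm_le 1 t.2
    rw [norm_one] at this; linarith
  have h4 : ‖1 - t.2‖ ≤ 4 / 3 := (norm_sub_le _ _).trans (by rw [norm_one]; linarith)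
  have h5 : 1 - t.2 ≠ 0 := norm_pos_iff.1 (by linarith)
  have h6 : 1 - (t.1 - t.2) / (1 - t.2) = (1 - t.1) / (1 - t.2) := by field_simp; ring
  have h7 : ‖1 - (t.1 - t.2) / (1 - t.2)‖ * ‖1 - t.2‖ = ‖1 - t.1‖ := by
    rw [h6, norm_div, div_mul_cancel₀ _ (norm_ne_zero_iff.2 h5)]
  have h8 := norm_nonneg (1 - (t.1 - t.2) / (1 - t.2))
  constructor <;> nlinarith

lemma Seq.PH_one (h : Seq a ε) {z w : ℂ} (hp : PH (YY a ε) z w) : z = 1 ↔ w = 1 := by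
  constructor
  · intro hz
    exact peak 1 0 (fun t ht => ⟨by simpa using (h.YY_norm ht).1, by simpa using (h.YY_comp ht).2⟩) hp
      (by simpa using hz)
  · intro hz
    exact peak 0 1 (fun t ht => ⟨by simpa using (h.YY_norm ht).2.2, by simpa using (h.YY_comp ht).1⟩) hp
      (by simpa using hz)

def Xtop : Set (Fin 2 → ℂ) := {h | h ∈ Torus ∧ (h 0 ^ 2 * h 1).re = (h 0).re}

def Yset (a : ℕ → ℂ) (ε : ℕ → ℝ) : Set (Fin 2 → ℂ) :=
  (fun t : ℂ × ℂ => ![t.1, (t.1 - t.2) / (1 - t.2)]) '' YY a ε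

def XX (a : ℕ → ℂ) (ε : ℕ → ℝ) : Set (Fin 2 → ℂ) := closure (Yset a ε) ∪ Xtop

lemma torus_closed : IsClosed Torus := by
  have : Torus = {z : Fin 2 → ℂ | ‖z 0‖ = 1} ∩ {z | ‖z 1‖ = 1} := rfl
  rw [this]
  exact (isClosed_eq (by fun_prop) (by fun_prop)).inter (isClosed_eq (by fun_prop) (by fun_prop))

lemma torus_compact : IsCompact Torus := by
  refine (isCompact_closedBall (0 : Fin 2 → ℂ) 1).of_isClosed_subset torus_closed ?_
  intro h hh
  rw [mem_closedBall_zero_iff, pi_norm_le_iff_of_nonneg zero_le_one]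
  intro i
  fin_cases i
  · exact hh.1.le
  · exact hh.2.le

lemma xtop_closed : IsClosed Xtop :=
  torus_closed.inter (isClosed_eq (by fun_prop) (by fun_prop))

lemma XX_closed : IsClosed (XX a ε) := isClosed_closure.union xtop_closed

lemma Seq.XX_sub (h : Seq a ε) : XX a ε ⊆ Torus := by
  refine Set.union_subset (closure_minimal ?_ torus_closed) (fun x hx => hx.1)
  rintro _ ⟨t, ht, rfl⟩
  obtain ⟨h1, -, h2⟩ := h.YY_norm ht
  exact ⟨by simpa using h1, by simpa using h2⟩

lemma conj_one {z : ℂ} (hz : ‖z‖ = 1) : z * (starRingEnd ℂ) z = 1 := by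
  rw [Complex.mul_conj, Complex.normSq_eq_norm_sq, hz]; norm_num

lemma xtop_zero {z w : ℂ} (hz : ‖z‖ = 1) (hw : ‖w‖ = 1) (h : (z ^ 2 * w).re = z.re) :
    (z * w - 1) * (z ^ 3 * w - 1) = 0 := by
  have h1 := conj_one hz
  have h2 := conj_one hw
  have h3 : z ^ 2 * w + (starRingEnd ℂ) (z ^ 2 * w) = z + (starRingEnd ℂ) z := by
    rw [Complex.add_conj, Complex.add_conj, h]
  rw [map_mul, map_pow] at h3
  have h5 : (z * (starRingEnd ℂ) z) ^ 2 * (w * (starRingEnd ℂ) w) = 1 := by rw [h1, h2]; norm_num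
  linear_combination z ^ 2 * w * h3 - h5 + z * w * h1

lemma xtop_of_zero {z w : ℂ} (hz : ‖z‖ ≤ 1) (hw : ‖w‖ ≤ 1) (h : (z * w - 1) * (z ^ 3 * w - 1) = 0) :
    ‖z‖ = 1 ∧ ‖w‖ = 1 ∧ (z ^ 2 * w).re = z.re := by
  have hz0 := norm_nonneg z
  have hw0 := norm_nonneg w
  rcases mul_eq_zero.1 h with h | h
  · have h1 : ‖z‖ * ‖w‖ = 1 := by rw [← norm_mul, sub_eq_zero.1 h, norm_one]
    have h2 : ‖z‖ = 1 := by nlinarith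
    have h3 : ‖w‖ = 1 := by nlinarith
    refine ⟨h2, h3, ?_⟩
    have : z ^ 2 * w = z := by linear_combination z * h
    rw [this]
  · have h1 : ‖z‖ ^ 3 * ‖w‖ = 1 := by rw [← norm_pow, ← norm_mul, sub_eq_zero.1 h, norm_one]
    have h4 : ‖z‖ ^ 3 ≤ 1 := pow_le_one₀ hz0 hz
    have h5 : ‖z‖ ^ 3 ≤ ‖z‖ := by
      have := pow_le_one₀ (n := 2) hz0 hz
      nlinarith
    have h3 : ‖w‖ = 1 := by nlinarith
    have h2 : ‖z‖ = 1 := by nlinarith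
    refine ⟨h2, h3, ?_⟩
    have : z ^ 2 * w = (starRingEnd ℂ) z := by
      linear_combination (starRingEnd ℂ) z * h - z ^ 2 * w * conj_one h2
    rw [this, Complex.conj_re]

lemma hull_le {K : Set (Fin 2 → ℂ)} {h : Fin 2 → ℂ} (hh : h ∈ polyHull K) (p : MvPolynomial (Fin 2) ℂ)
    {m : ℝ} (hm : 0 ≤ m) (hK : ∀ x ∈ K, ‖eval x p‖ ≤ m) : ‖eval h p‖ ≤ m := by
  refine (hh p).trans (Real.sSup_le ?_ hm)
  rintro _ ⟨x, hx, rfl⟩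
  exact hK x hx

lemma YY_nonempty : (YY a ε).Nonempty := by
  choose y hy using fun j => exists_sqrt (qq (a j) 1)
  exact ⟨(1, ∑' j, (ε j : ℂ) * y j), by simp, y, hy, rfl⟩

lemma eta2 (h : Fin 2 → ℂ) : (![h 0, h 1] : Fin 2 → ℂ) = h := by
  funext i; fin_cases i <;> rfl

lemma Seq.hull_PH (hs : Seq a ε) {h : Fin 2 → ℂ} (hh : h ∈ polyHull (XX a ε)) (hX : h ∉ XX a ε) :
    PH (YY a ε) (h 0) (h 1) := by
  have h0 : ‖h 0‖ ≤ 1 := by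
    have := hull_le hh (X 0) zero_le_one (fun x hx => by simpa using (hs.XX_sub hx).1.le)
    simpa using this
  have h1 : ‖h 1‖ ≤ 1 := by
    have := hull_le hh (X 1) zero_le_one (fun x hx => by simpa using (hs.XX_sub hx).2.le)
    simpa using this
  refine ⟨h0, h1, fun p m hp => ?_⟩
  have hm : 0 ≤ m := by
    obtain ⟨t, ht⟩ := YY_nonempty (a := a) (ε := ε)
    exact (norm_nonneg _).trans (hp t ht)
  have hq : (h 0 * h 1 - 1) * (h 0 ^ 3 * h 1 - 1) ≠ 0 := by
    intro hq
    obtain ⟨k1, k2, k3⟩ := xtop_of_zero h0 h1 hq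
    exact hX (Or.inr ⟨⟨k1, k2⟩, k3⟩)
  have hq' := norm_pos_iff.2 hq
  have hcl : ∀ x ∈ closure (Yset a ε), ‖eval x p‖ ≤ m := by
    refine closure_minimal (t := {x | ‖eval x p‖ ≤ m}) ?_
      (isClosed_le (MvPolynomial.continuous_eval p).norm continuous_const)
    rintro _ ⟨t, ht, rfl⟩
    exact hp t ht
  rw [ev, eta2]
  refine pow_bound (C := 4 / ‖(h 0 * h 1 - 1) * (h 0 ^ 3 * h 1 - 1)‖) hm fun k => ?_
  have hev : ∀ x : Fin 2 → ℂ, eval x ((X 0 * X 1 - 1) * (X 0 ^ 3 * X 1 - 1) * p ^ k) =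
      (x 0 * x 1 - 1) * (x 0 ^ 3 * x 1 - 1) * (eval x p) ^ k := by
    intro x; simp
  have := hull_le hh ((X 0 * X 1 - 1) * (X 0 ^ 3 * X 1 - 1) * p ^ k) (m := 4 * m ^ k) (by positivity) (by
    rintro x (hx | hx)
    · rw [hev, norm_mul, norm_pow]
      have hT := hs.XX_sub (Or.inl hx)
      gcongr
      · rw [norm_mul]
        have e1 : ‖x 0 * x 1 - 1‖ ≤ 2 := (norm_sub_le _ _).trans (by
          rw [norm_mul, hT.1, hT.2, norm_one]; norm_num)
        have e2 : ‖x 0 ^ 3 * x 1 - 1‖ ≤ 2 := (norm_sub_le _ _).trans (by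
          rw [norm_mul, norm_pow, hT.1, hT.2, norm_one]; norm_num)
        calc _ ≤ (2:ℝ) * 2 := by gcongr
          _ = 4 := by norm_num
      · exact hcl x hx
    · rw [hev, xtop_zero hx.1.1 hx.1.2 hx.2, zero_mul, norm_zero]
      positivity)
  rw [hev, norm_mul, norm_pow] at this
  rw [div_mul_eq_mul_div, le_div_iff₀ hq', mul_comm]
  exact this

lemma Seq.hull_nonempty (hs : Seq a ε) : (polyHull (XX a ε) \ XX a ε).Nonempty := by
  obtain ⟨w, hw⟩ := hs.exists_PH
  refine ⟨![0, w], fun p => ?_, fun hX => ?_⟩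
  · refine hw.2.2 p _ fun t ht => ?_
    have hb : BddAbove ((fun w => ‖eval w p‖) '' XX a ε) := by
      refine BddAbove.mono (Set.image_mono hs.XX_sub) ?_
      exact (torus_compact.image (MvPolynomial.continuous_eval p).norm).bddAbove
    exact le_csSup hb ⟨_, Or.inl (subset_closure ⟨t, ht, rfl⟩), rfl⟩
  · have := (hs.XX_sub hX).1
    simp at this

end HullTorus

namespace HullTorus

open MvPolynomial Filter Topology

def Good1 (a : ℕ → ℂ) (Y : Set (ℂ × ℂ)) : Prop := ∀ n : ℕ,
    (∃ s : ℝ, 0 < s ∧ s ≤ 1 / (n + 1) ∧ ∀ w w' : ℂ, PH Y (a n) w → PH Y (a n + s) w' →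
      1 / (n + 1) ≤ ‖1 - w‖ → 1 / (n + 1) ≤ ‖1 - w'‖ →
      (n + 1) * s < ‖(a n - w) / (1 - w) - (a n + s - w') / (1 - w')‖) ∧
    ∀ z c : ℂ, ¬ ∀ v ∈ closedBall (0:ℂ) (1 / (n + 1)), ∃ w, PH Y z w ∧ 1 / (n + 1) ≤ ‖1 - w‖ ∧
      c + v = (z - w) / (1 - w)

lemma strict_of {f : ℂ → ℂ} (hf : DifferentiableOn ℂ f (ball 0 1)) {t : ℂ} (ht : t ∈ ball (0:ℂ) 1) :
    HasStrictDerivAt f (deriv f t) t :=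
  ((hf.analyticAt (isOpen_ball.mem_nhds ht)).hasStrictDerivAt)

lemma caseA {a : ℕ → ℂ} {Y : Set (ℂ × ℂ)} (hG : Good1 a Y)
    (hd : ∀ b : ℂ, ‖b‖ < 1 → ∀ r > 0, ∀ N : ℕ, ∃ n ≥ N, ‖a n - b‖ < r)
    (hone : ∀ z w, PH Y z w → (z = 1 ↔ w = 1)) {f g : ℂ → ℂ}
    (hf : DifferentiableOn ℂ f (ball 0 1)) (hg : DifferentiableOn ℂ g (ball 0 1))
    (hPH : ∀ t ∈ ball (0:ℂ) 1, PH Y (f t) (g t)) : ∀ t ∈ ball (0:ℂ) 1, deriv f t = 0 := by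
  intro t0 ht0
  by_contra hne
  obtain ⟨t1, ht1, hne1, hlt⟩ : ∃ t1 ∈ ball (0:ℂ) 1, deriv f t1 ≠ 0 ∧ ‖f t1‖ < 1 := by
    have hN : {t | t ∈ ball (0:ℂ) 1 ∧ deriv f t ≠ 0} ∈ 𝓝 t0 := by
      have hc : ContinuousAt (deriv f) t0 :=
        (hf.analyticAt (isOpen_ball.mem_nhds ht0)).deriv.continuousAt
      filter_upwards [isOpen_ball.mem_nhds ht0, hc.eventually_ne hne] with t h1 h2 using ⟨h1, h2⟩
    have h2 : f '' {t | t ∈ ball (0:ℂ) 1 ∧ deriv f t ≠ 0} ∈ 𝓝 (f t0) := by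
      rw [← (strict_of hf ht0).map_nhds_eq hne]
      exact image_mem_map hN
    have h3 : f t0 ∈ closure (ball (0:ℂ) 1) := by
      rw [closure_ball _ one_ne_zero]
      simpa using (hPH t0 ht0).1
    obtain ⟨_, ⟨t, ht, rfl⟩, h4⟩ := mem_closure_iff_nhds.1 h3 _ h2
    exact ⟨t, ht.1, ht.2, by simpa using h4⟩
  have hst := strict_of hf ht1
  have hg1 : g t1 ≠ 1 := by
    intro h
    have := (hone _ _ (hPH t1 ht1)).2 h
    rw [this, norm_one] at hlt
    exact lt_irrefl _ hlt
  obtain ⟨ψ, hψ0, hψ1, hψ⟩ : ∃ ψ : ℂ → ℂ, ψ (f t1) = t1 ∧ (∀ᶠ y in 𝓝 (f t1), f (ψ y) = y) ∧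
      HasStrictDerivAt ψ (deriv f t1)⁻¹ (f t1) := by
    refine ⟨hst.localInverse f _ t1 hne1, ?_, ?_, hst.to_localInverse hne1⟩
    · exact HasStrictFDerivAt.localInverse_apply_image _
    · exact HasStrictFDerivAt.eventually_right_inverse _
  set b := f t1 with hb
  have hgψ : HasStrictDerivAt (fun z => g (ψ z)) (deriv g t1 * (deriv f t1)⁻¹) b := by
    have h1 : HasStrictDerivAt g (deriv g t1) (ψ b) := by rw [hψ0]; exact strict_of hg ht1
    exact h1.comp b hψ
  have hden : 1 - g (ψ b) ≠ 0 := by rw [hψ0]; exact sub_ne_zero.2 hg1.symm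
  have hX := ((hasStrictDerivAt_id b).sub hgψ).fun_div
    ((hasStrictDerivAt_const b (1:ℂ)).sub hgψ) hden
  obtain ⟨K, S, hS, hLip⟩ := hX.hasStrictFDerivAt.exists_lipschitzOnWith
  have hr : 0 < ‖1 - g (ψ b)‖ := norm_pos_iff.2 hden
  have hcψ : ContinuousAt ψ b := hψ.hasDerivAt.continuousAt
  have hcg : ContinuousAt (fun z => ‖1 - g (ψ z)‖) b :=
    (continuousAt_const.sub hgψ.hasDerivAt.continuousAt).norm
  have hev : ∀ᶠ z in 𝓝 b, z ∈ S ∧ f (ψ z) = z ∧ ψ z ∈ ball (0:ℂ) 1 ∧ ‖1 - g (ψ b)‖ / 2 < ‖1 - g (ψ z)‖ := by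
    filter_upwards [hS, hψ1, hcψ.eventually_mem (isOpen_ball.mem_nhds (by rw [hψ0]; exact ht1)),
      hcg.eventually (lt_mem_nhds (half_lt_self hr))] with z h1 h2 h3 h4 using ⟨h1, h2, h3, h4⟩
  obtain ⟨δ, hδ, hball⟩ := Metric.eventually_nhds_iff.1 hev
  obtain ⟨N1, hN1⟩ := exists_nat_ge (K : ℝ)
  obtain ⟨N2, hN2⟩ := exists_nat_one_div_lt (by positivity : 0 < min (δ / 2) (‖1 - g (ψ b)‖ / 2))
  obtain ⟨n, hn, hab⟩ := hd b hlt (δ / 2) (half_pos hδ) (max N1 N2)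
  obtain ⟨⟨s, hs0, hs1, hs⟩, -⟩ := hG n
  have hnN2 : 1 / ((n:ℝ) + 1) < min (δ / 2) (‖1 - g (ψ b)‖ / 2) := by
    refine lt_of_le_of_lt ?_ hN2
    have : (N2 : ℝ) ≤ n := by exact_mod_cast (le_max_right _ _).trans hn
    gcongr
  have hnK : (K : ℝ) ≤ n := hN1.trans (by exact_mod_cast (le_max_left _ _).trans hn)
  obtain ⟨p1, p2, p3, p4⟩ := hball (y := a n) (by rw [dist_eq_norm]; linarith)
  obtain ⟨q1, q2, q3, q4⟩ := hball (y := a n + s) (by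
    rw [dist_eq_norm]
    have : a n + s - b = (a n - b) + s := by ring
    rw [this]
    refine (norm_add_le _ _).trans_lt ?_
    rw [Complex.norm_real, Real.norm_of_nonneg hs0.le]
    have := min_le_left (δ / 2) (‖1 - g (ψ b)‖ / 2)
    linarith)
  have hm := min_le_right (δ / 2) (‖1 - g (ψ b)‖ / 2)
  have hc := hs (g (ψ (a n))) (g (ψ (a n + s))) (by
    have := hPH _ p3; rwa [p2] at this) (by
    have := hPH _ q3; rwa [q2] at this) (by linarith) (by linarith)
  have hl := hLip.norm_sub_le p1 q1
  have h9 : ‖a n - (a n + (s:ℂ))‖ = s := by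
    rw [sub_add_cancel_left, norm_neg, Complex.norm_real, Real.norm_of_nonneg hs0.le]
  rw [h9] at hl
  simp only [Pi.sub_apply, id] at hl
  nlinarith

lemma caseB {a : ℕ → ℂ} {Y : Set (ℂ × ℂ)} (hG : Good1 a Y)
    (hone : ∀ z w, PH Y z w → (z = 1 ↔ w = 1)) {z0 : ℂ} {g : ℂ → ℂ}
    (hg : DifferentiableOn ℂ g (ball 0 1))
    (hPH : ∀ t ∈ ball (0:ℂ) 1, PH Y z0 (g t)) : ∀ t ∈ ball (0:ℂ) 1, deriv g t = 0 := by
  intro t0 ht0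
  by_contra hne
  have hz0 : z0 ≠ 1 := by
    intro h
    apply hne
    have : g =ᶠ[𝓝 t0] fun _ => 1 := by
      filter_upwards [isOpen_ball.mem_nhds ht0] with t ht using (hone _ _ (hPH t ht)).1 h
    rw [this.deriv_eq]; simp
  have hden : 1 - g t0 ≠ 0 := by
    intro h
    exact hz0 ((hone _ _ (hPH t0 ht0)).2 (sub_eq_zero.1 h).symm)
  have hst := strict_of hg ht0
  have hX := ((hasStrictDerivAt_const t0 z0).sub hst).fun_div
    ((hasStrictDerivAt_const t0 (1:ℂ)).sub hst) hden
  have hr : 0 < ‖1 - g t0‖ := norm_pos_iff.2 hden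
  have hcg : ContinuousAt (fun z => ‖1 - g z‖) t0 :=
    (continuousAt_const.sub hst.hasDerivAt.continuousAt).norm
  have hN : {t | t ∈ ball (0:ℂ) 1 ∧ ‖1 - g t0‖ / 2 < ‖1 - g t‖} ∈ 𝓝 t0 := by
    filter_upwards [isOpen_ball.mem_nhds ht0, hcg.eventually (lt_mem_nhds (half_lt_self hr))] with t h1 h2
      using ⟨h1, h2⟩
  have hmap := hX.map_nhds_eq (by
    refine div_ne_zero ?_ (pow_ne_zero _ hden)
    simp only [Pi.sub_apply]
    have : (0 - deriv g t0) * (1 - g t0) - (z0 - g t0) * (0 - deriv g t0) = deriv g t0 * (z0 - 1) := by ring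
    rw [this]
    exact mul_ne_zero hne (sub_ne_zero.2 hz0))
  have himg := image_mem_map hN (m := fun t => (z0 - g t) / (1 - g t))
  simp only [Pi.sub_apply] at hmap
  rw [hmap] at himg
  obtain ⟨δ, hδ, hball⟩ := Metric.mem_nhds_iff.1 himg
  obtain ⟨n, hn⟩ := exists_nat_one_div_lt (by positivity : 0 < min δ (‖1 - g t0‖ / 2))
  have m1 := min_le_left δ (‖1 - g t0‖ / 2)
  have m2 := min_le_right δ (‖1 - g t0‖ / 2)
  refine (hG n).2 z0 ((z0 - g t0) / (1 - g t0)) fun v hv => ?_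
  rw [mem_closedBall_zero_iff] at hv
  obtain ⟨t, ⟨ht, ht'⟩, hh⟩ := hball (show (z0 - g t0) / (1 - g t0) + v ∈ _ by
    rw [mem_ball, dist_eq_norm, add_sub_cancel_left]; linarith)
  exact ⟨g t, hPH t ht, by linarith, hh.symm⟩

lemma const_of {f : ℂ → ℂ} (hf : DifferentiableOn ℂ f (ball 0 1))
    (h : ∀ t ∈ ball (0:ℂ) 1, deriv f t = 0) : ∀ z ∈ ball (0:ℂ) 1, ∀ w ∈ ball (0:ℂ) 1, f z = f w := by
  intro z hz w hw
  exact isOpen_ball.is_const_of_deriv_eq_zero (convex_ball _ _).isPreconnected hf h hz hw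

lemma no_disc {a : ℕ → ℂ} {Y : Set (ℂ × ℂ)} (hG : Good1 a Y)
    (hd : ∀ b : ℂ, ‖b‖ < 1 → ∀ r > 0, ∀ N : ℕ, ∃ n ≥ N, ‖a n - b‖ < r)
    (hone : ∀ z w, PH Y z w → (z = 1 ↔ w = 1)) {S : Set (Fin 2 → ℂ)}
    (hS : ∀ h ∈ S, PH Y (h 0) (h 1)) : NoAnalyticDisk S := by
  intro φ hφ hmem
  have hf : DifferentiableOn ℂ (fun t => φ t 0) (ball 0 1) := (differentiableOn_pi.1 hφ) 0
  have hg : DifferentiableOn ℂ (fun t => φ t 1) (ball 0 1) := (differentiableOn_pi.1 hφ) 1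
  have cf := const_of hf (caseA hG hd hone hf hg fun t ht => hS _ (hmem t ht))
  have cg := const_of hg (caseB (z0 := φ 0 0) hG hone hg fun t ht => by
    have := hS _ (hmem t ht)
    have h2 : φ t 0 = φ 0 0 := cf t ht 0 (by simp)
    rwa [h2] at this)
  intro z hz w hw
  funext i
  fin_cases i
  · exact cf z hz w hw
  · exact cg z hz w hw

end HullTorus

open HullTorus

theorem stmt12 :
    ∃ X : Set (Fin 2 → ℂ), X ⊆ Torus ∧ IsClosed X ∧
      (polyHull X \ X).Nonempty ∧ NoAnalyticDisk (polyHull X \ X) ∧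
      ∃ U V : Set (Fin 2 → ℂ), U ⊆ Torus ∧ V ⊆ Torus ∧
        IsOpen (Subtype.val ⁻¹' U : Set Torus) ∧
        IsOpen (Subtype.val ⁻¹' V : Set Torus) ∧
        Disjoint U V ∧ U ∪ V = Torus \ X ∧
        (∃ c : ℂ, ‖c‖ = 1 ∧ ∀ z ∈ U, z 0 ≠ c) ∧
        (∃ c : ℂ, ‖c‖ = 1 ∧ ∀ z ∈ V, z 0 ≠ c) := by
  obtain ⟨a, ai, ha, hd⟩ := dense_seq
  obtain ⟨P, ε, θ, hpos, h0, hstep, hθ, hP, hGood⟩ := construct a ai ha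
  have hs : Seq a ε := ⟨ha, hpos, h0, hstep⟩
  have hG : Good1 a (YY a ε) := fun n => hGood n (YY a ε) (hs.YY_good hθ hP n)
  have hXc : IsClosed (XX a ε) := XX_closed
  have hre : ∀ z : Fin 2 → ℂ, z ∈ Torus → (z 1).re ≤ 1 ∧ -1 ≤ (z 1).re := by
    intro z hz
    have := Complex.abs_re_le_norm (z 1)
    rw [hz.2] at this
    have := abs_le.1 this
    exact ⟨this.2, this.1⟩
  refine ⟨XX a ε, hs.XX_sub, hXc, hs.hull_nonempty,
    no_disc hG hd (fun z w h => hs.PH_one h) (fun h hh => hs.hull_PH hh.1 hh.2),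
    Torus ∩ ({h | (h 0).re < (h 0 ^ 2 * h 1).re} \ XX a ε),
    Torus ∩ ({h | (h 0 ^ 2 * h 1).re < (h 0).re} \ XX a ε), Set.inter_subset_left, Set.inter_subset_left,
    ?_, ?_, ?_, ?_, ⟨1, by simp, ?_⟩, ⟨-1, by simp, ?_⟩⟩
  · have ho : IsOpen ({h : Fin 2 → ℂ | (h 0).re < (h 0 ^ 2 * h 1).re} \ XX a ε) :=
      (isOpen_lt (by fun_prop) (by fun_prop)).sdiff hXc
    rw [Subtype.preimage_coe_self_inter]
    exact ho.preimage continuous_subtype_val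
  · have ho : IsOpen ({h : Fin 2 → ℂ | (h 0 ^ 2 * h 1).re < (h 0).re} \ XX a ε) :=
      (isOpen_lt (by fun_prop) (by fun_prop)).sdiff hXc
    rw [Subtype.preimage_coe_self_inter]
    exact ho.preimage continuous_subtype_val
  · rw [Set.disjoint_left]
    rintro h ⟨-, h1, -⟩ ⟨-, h2, -⟩
    exact lt_asymm (show (h 0).re < (h 0 ^ 2 * h 1).re from h1) h2
  · ext h
    constructor
    · rintro (⟨h1, h2, h3⟩ | ⟨h1, h2, h3⟩) <;> exact ⟨h1, h3⟩
    · rintro ⟨h1, h3⟩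
      rcases lt_trichotomy (h 0).re (h 0 ^ 2 * h 1).re with h2 | h2 | h2
      · exact Or.inl ⟨h1, h2, h3⟩
      · exact absurd (Or.inr ⟨h1, h2.symm⟩) h3
      · exact Or.inr ⟨h1, h2, h3⟩
  · rintro z ⟨h1, h2, -⟩ hz
    have h2 : (z 0).re < (z 0 ^ 2 * z 1).re := h2
    rw [hz] at h2
    simp at h2
    linarith [(hre z h1).1]
  · rintro z ⟨h1, h2, -⟩ hz
    have h2 : (z 0 ^ 2 * z 1).re < (z 0).re := h2
    rw [hz] at h2
    simp at h2
    linarith [(hre z h1).2]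
end

section
/- Let S³ = {(z_1,z_2) ∈ ℂ² : |z_1|² + |z_2|² = 1}, and for c ∈ ℂ with |c| < 1 let S_c = {(z_1,z_2) ∈ S³ : z_1 = c}. Let X ⊆ S³ be a compact set that is disjoint from the circle {(z_1, 0) : |z_1| = 1} and such that for no c with |c| < 1 does X contain the full circle S_c. Then there exists a C^∞ function g̃ : ℂ² → ℝ whose restriction g to S³ has zero set exactly X and is nonconstant on every circle S_c with |c| < 1. -/
/-- The unit sphere `S³ = {(z₁,z₂) ∈ ℂ² : |z₁|² + |z₂|² = 1}`. -/
def SphS3 : Set (Fin 2 → ℂ) := {z | ‖z 0‖ ^ 2 + ‖z 1‖ ^ 2 = 1}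

/-- The circle `S_c = {(z₁,z₂) ∈ S³ : z₁ = c}`. -/
def circleFiber (c : ℂ) : Set (Fin 2 → ℂ) := {z ∈ SphS3 | z 0 = c}

/-- Second-coordinate radius of the circle over `c`. -/
noncomputable def radS (c : ℂ) : ℝ := Real.sqrt (1 - ‖c‖ ^ 2)

/-- A point on the circle over `c`. -/
noncomputable def ptS (ω c : ℂ) : Fin 2 → ℂ := ![c, (radS c : ℂ) * ω]

theorem radS_pos {c : ℂ} (hc : ‖c‖ < 1) : 0 < radS c := by
  apply Real.sqrt_pos.2
  nlinarith [norm_nonneg c]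

theorem ptS_mem {c ω : ℂ} (hc : ‖c‖ < 1) (hω : ‖ω‖ = 1) : ptS ω c ∈ circleFiber c := by
  refine ⟨?_, by simp [ptS]⟩
  have h : 0 ≤ 1 - ‖c‖ ^ 2 := by nlinarith [norm_nonneg c]
  simp [SphS3, ptS, hω, radS, Real.sq_sqrt h]

theorem radS_contDiffAt {c : ℂ} (hc : ‖c‖ < 1) : ContDiffAt ℝ 1 radS c := by
  unfold radS
  apply ContDiffAt.sqrt
  · exact (contDiff_const.sub (contDiff_norm_sq ℝ)).contDiffAt
  · nlinarith [norm_nonneg c]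

theorem ptS_contDiffAt {c : ℂ} (hc : ‖c‖ < 1) (ω : ℂ) : ContDiffAt ℝ 1 (ptS ω) c := by
  rw [contDiffAt_pi]
  intro i
  fin_cases i
  · simpa [ptS] using (contDiffAt_fun_id : ContDiffAt ℝ 1 (fun x : ℂ => x) c)
  · have h1 : ContDiffAt ℝ 1 (fun c => ((radS c : ℝ) : ℂ)) c :=
      Complex.ofRealCLM.contDiff.contDiffAt.comp c (radS_contDiffAt hc)
    simpa [ptS] using h1.mul contDiffAt_const

/-- The obstruction map. -/
noncomputable def obsT (f : (Fin 2 → ℂ) → ℝ) (c : ℂ) : ℝ × ℝ × ℝ :=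
  let L : ℂ → ℝ := fun ω => Real.log (f (ptS ω c))
  ((L (-1) - L 1) / (2 * radS c),
   (L (-Complex.I) - L Complex.I) / (2 * radS c),
   (L Complex.I + L (-Complex.I) - L 1 - L (-1)) / (4 * radS c ^ 2))

theorem obsT_contDiffAt {f : (Fin 2 → ℂ) → ℝ} (hf : ContDiff ℝ 1 f) {c : ℂ} (hc : ‖c‖ < 1)
    (hp : ∀ ω : ℂ, ‖ω‖ = 1 → f (ptS ω c) ≠ 0) : ContDiffAt ℝ 1 (obsT f) c := by
  have hL : ∀ ω : ℂ, ‖ω‖ = 1 → ContDiffAt ℝ 1 (fun c => Real.log (f (ptS ω c))) c :=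
    fun ω hω => (hf.contDiffAt.comp c (ptS_contDiffAt hc ω)).log (hp ω hω)
  have hs := radS_contDiffAt hc
  have hs0 := radS_pos hc
  have a1 := hL 1 (by simp)
  have a2 := hL (-1) (by simp)
  have a3 := hL Complex.I (by simp)
  have a4 := hL (-Complex.I) (by simp)
  unfold obsT
  refine ContDiffAt.prodMk ?_ (ContDiffAt.prodMk ?_ ?_)
  · exact (a2.sub a1).div (contDiffAt_const.mul hs) (by positivity)
  · exact (a4.sub a3).div (contDiffAt_const.mul hs) (by positivity)
  · exact (((a3.add a4).sub a1).sub a2).div (contDiffAt_const.mul (hs.pow 2)) (by positivity)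

theorem exists_good (f : (Fin 2 → ℂ) → ℝ) (hf : ContDiff ℝ 1 f) :
    ∃ t : ℝ × ℝ × ℝ, ∀ c : ℂ, ‖c‖ < 1 → (∀ ω : ℂ, ‖ω‖ = 1 → f (ptS ω c) ≠ 0) →
      obsT f c ≠ t := by
  set U : Set ℂ := {c | ‖c‖ < 1 ∧ ∀ ω : ℂ, ‖ω‖ = 1 → f (ptS ω c) ≠ 0} with hU
  have h1 : dimH (obsT f '' U) ≤ dimH U := by
    apply dimH_image_le_of_locally_lipschitzOn
    intro c hc
    obtain ⟨K, s, hs, hl⟩ := (obsT_contDiffAt hf hc.1 hc.2).exists_lipschitzOnWith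
    exact ⟨K, s, mem_nhdsWithin_of_mem_nhds hs, hl⟩
  have h2 : dimH U ≤ 2 := by
    have := dimH_mono (Set.subset_univ U)
    rw [Real.dimH_univ_eq_finrank ℂ, Complex.finrank_real_complex] at this
    exact_mod_cast this
  have h3 : Dense (obsT f '' U)ᶜ := by
    apply dense_compl_of_dimH_lt_finrank
    have : Module.finrank ℝ (ℝ × ℝ × ℝ) = 3 := by simp
    rw [this]
    refine (h1.trans h2).trans_lt ?_
    norm_num
  obtain ⟨t, ht⟩ := h3.nonempty
  exact ⟨t, fun c hc hp h => ht ⟨c, ⟨hc, hp⟩, h⟩⟩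

theorem stmt14 (X : Set (Fin 2 → ℂ)) (hXS : X ⊆ SphS3) (hXc : IsCompact X)
    (hdisj : Disjoint X {z : Fin 2 → ℂ | ‖z 0‖ = 1 ∧ z 1 = 0})
    (hnc : ∀ c : ℂ, ‖c‖ < 1 → ¬ circleFiber c ⊆ X) :
    ∃ g : (Fin 2 → ℂ) → ℝ, ContDiff ℝ (⊤ : ℕ∞) g ∧
      (∀ z ∈ SphS3, (g z = 0 ↔ z ∈ X)) ∧
      (∀ c : ℂ, ‖c‖ < 1 → ∃ z ∈ circleFiber c, ∃ w ∈ circleFiber c, g z ≠ g w) := by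
  obtain ⟨f, hsupp, hf, hr⟩ := hXc.isClosed.isOpen_compl.exists_contDiff_support_eq (n := ⊤)
  have hf0 : ∀ z, f z = 0 ↔ z ∈ X := by
    intro z
    have : z ∈ f.support ↔ z ∈ Xᶜ := by rw [hsupp]
    simpa [not_iff_not] using this
  have hfn : ∀ z, 0 ≤ f z := fun z => (hr ⟨z, rfl⟩).1
  obtain ⟨⟨t1, t2, t3⟩, ht⟩ := exists_good f (hf.of_le (by exact_mod_cast le_top))
  set h : (Fin 2 → ℂ) → ℝ := fun z => t1 * (z 1).re + t2 * (z 1).im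
    + t3 * ((z 1).re ^ 2 - (z 1).im ^ 2) with hh
  have hz1 : ContDiff ℝ (⊤ : ℕ∞) (fun z : Fin 2 → ℂ => z 1) := contDiff_apply ℝ ℂ 1
  have hre : ContDiff ℝ (⊤ : ℕ∞) (fun z : Fin 2 → ℂ => (z 1).re) :=
    Complex.reCLM.contDiff.comp hz1
  have him : ContDiff ℝ (⊤ : ℕ∞) (fun z : Fin 2 → ℂ => (z 1).im) :=
    Complex.imCLM.contDiff.comp hz1
  have hhs : ContDiff ℝ (⊤ : ℕ∞) h :=
    ((contDiff_const.mul hre).add (contDiff_const.mul him)).add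
      (contDiff_const.mul ((hre.pow 2).sub (him.pow 2)))
  have hg0 : ∀ z, f z * Real.exp (h z) = 0 ↔ z ∈ X := by
    intro z
    simp [hf0]
  refine ⟨fun z => f z * Real.exp (h z), hf.mul hhs.exp, fun z _ => hg0 z, ?_⟩
  intro c hc
  by_contra! hcon
  by_cases hX : ∃ z ∈ circleFiber c, z ∈ X
  · obtain ⟨z, hz, hzX⟩ := hX
    apply hnc c hc
    intro w hw
    rw [← hg0, ← hcon z hz w hw, hg0]
    exact hzX
  push Not at hX
  have hne : ∀ ω : ℂ, ‖ω‖ = 1 → f (ptS ω c) ≠ 0 := fun ω hω h0 =>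
    hX _ (ptS_mem hc hω) ((hf0 _).1 h0)
  apply ht c hc hne
  have hlog : ∀ ω ω' : ℂ, ‖ω‖ = 1 → ‖ω'‖ = 1 →
      Real.log (f (ptS ω c)) + h (ptS ω c) = Real.log (f (ptS ω' c)) + h (ptS ω' c) := by
    intro ω ω' hω hω'
    have e := congrArg Real.log (hcon _ (ptS_mem hc hω) _ (ptS_mem hc hω'))
    rwa [Real.log_mul (hne ω hω) (Real.exp_ne_zero _), Real.log_mul (hne ω' hω')
      (Real.exp_ne_zero _), Real.log_exp, Real.log_exp] at e
  have e1 := hlog 1 (-1) (by simp) (by simp)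
  have e2 := hlog Complex.I (-Complex.I) (by simp) (by simp)
  have e3 := hlog 1 Complex.I (by simp) (by simp)
  have v1 : h (ptS 1 c) = t1 * radS c + t3 * radS c ^ 2 := by simp [hh, ptS]
  have v2 : h (ptS (-1) c) = - t1 * radS c + t3 * radS c ^ 2 := by simp [hh, ptS]
  have v3 : h (ptS Complex.I c) = t2 * radS c - t3 * radS c ^ 2 := by
    simp [hh, ptS]; ring
  have v4 : h (ptS (-Complex.I) c) = - t2 * radS c - t3 * radS c ^ 2 := by
    simp [hh, ptS]; ring
  rw [v1, v2] at e1
  rw [v3, v4] at e2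
  rw [v1, v3] at e3
  have hs := radS_pos hc
  unfold obsT
  simp only [Prod.mk.injEq]
  refine ⟨?_, ?_, ?_⟩
  · rw [div_eq_iff (by positivity)]; linarith
  · rw [div_eq_iff (by positivity)]; linarith
  · rw [div_eq_iff (by positivity)]; linarith
end
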